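/- Let n be a positive integer and let C be an ℝ-linear subspace of the space of n×n real matrices such that every nonzero matrix in C is invertible. Then dim_ℝ C ≤ ρ(n), where ρ(n) is the n-th Radon–Hurwitz number. -/

import Mathlib

/-- The `n`-th Radon–Hurwitz number: writing `n = (2a+1)·2^b` and
`b = c + 4e` with `0 ≤ c ≤ 3`, it is `ρ(n) = 2^c + 8e`. -/
def radonHurwitz (n : ℕ) : ℕ :=
  2 ^ (padicValNat 2 n % 4) + 8 * (padicValNat 2 n / 4)


set_option linter.unusedSectionVars false
open scoped RealInnerProductSpace

namespace AdamsProof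

section Inertia
variable {E : Type*} [NormedAddCommGroup E] [InnerProductSpace ℝ E] [FiniteDimensional ℝ E]

/-- The subspace of vectors whose coordinates vanish wherever `P` holds. -/
def coordSub {ι : Type*} [Fintype ι] (b : OrthonormalBasis ι ℝ E) (P : ι → Prop) :
    Submodule ℝ E where
  carrier := {f | ∀ i, P i → ⟪b i, f⟫ = 0}
  add_mem' := by
    intro f g hf hg i hi
    simp [inner_add_right, hf i hi, hg i hi]
  zero_mem' := by intro i _; simp
  smul_mem' := by
    intro c f hf i hi
    simp [inner_smul_right, hf i hi]

theorem mem_coordSub {ι : Type*} [Fintype ι] (b : OrthonormalBasis ι ℝ E) (P : ι → Prop)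
    (f : E) : f ∈ coordSub b P ↔ ∀ i, P i → ⟪b i, f⟫ = 0 := Iff.rfl

theorem finrank_coordSub {ι : Type*} [Fintype ι] (b : OrthonormalBasis ι ℝ E) (P : ι → Prop) :
    Module.finrank ℝ (coordSub b P) = Nat.card {i // ¬ P i} := by
  classical
  have h : coordSub b P = Submodule.span ℝ (Set.range fun i : {i // ¬ P i} => b i) := by
    apply le_antisymm
    · intro f hf
      rw [← b.sum_repr' f]
      refine Submodule.sum_mem _ fun i _ => ?_
      by_cases hi : P i
      · rw [hf i hi]; simp
      · exact Submodule.smul_mem _ _ (Submodule.subset_span ⟨⟨i, hi⟩, rfl⟩)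
    · rw [Submodule.span_le]
      rintro _ ⟨⟨i, hi⟩, rfl⟩ l hl
      apply b.orthonormal.2
      rintro rfl
      exact hi hl
  rw [h, finrank_span_eq_card]
  · simp
  · exact (b.orthonormal.comp _ Subtype.val_injective).linearIndependent

/-- `T` has positive index `m` and is nondegenerate. -/
def HasPos (T : E →L[ℝ] E) (m : ℕ) : Prop :=
  ∃ U V : Submodule ℝ E, (∀ u ∈ U, u ≠ 0 → 0 < ⟪T u, u⟫) ∧ (∀ v ∈ V, v ≠ 0 → ⟪T v, v⟫ < 0) ∧
    Module.finrank ℝ U = m ∧ Module.finrank ℝ U + Module.finrank ℝ V = Module.finrank ℝ E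

theorem finrank_add_le_of_disjoint (U V : Submodule ℝ E) (h : ∀ u ∈ U, u ∈ V → u = 0) :
    Module.finrank ℝ U + Module.finrank ℝ V ≤ Module.finrank ℝ E := by
  have h1 : U ⊓ V = ⊥ := by
    rw [eq_bot_iff]
    rintro u ⟨h1, h2⟩
    exact h u h1 h2
  have := Submodule.finrank_sup_add_finrank_inf_eq U V
  rw [h1, finrank_bot] at this
  have := Submodule.finrank_le (U ⊔ V)
  omega

theorem finrank_sup_of_disjoint (U V : Submodule ℝ E) (h : ∀ u ∈ U, u ∈ V → u = 0) :
    Module.finrank ℝ (U ⊔ V : Submodule ℝ E) = Module.finrank ℝ U + Module.finrank ℝ V := by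
  have h1 : U ⊓ V = ⊥ := by
    rw [eq_bot_iff]
    rintro u ⟨h1, h2⟩
    exact h u h1 h2
  have := Submodule.finrank_sup_add_finrank_inf_eq U V
  rw [h1, finrank_bot] at this
  omega

theorem HasPos.unique {T : E →L[ℝ] E} {m m' : ℕ} (h : HasPos T m) (h' : HasPos T m') :
    m = m' := by
  have key : ∀ m m', HasPos T m → HasPos T m' → m ≤ m' := by
    rintro m m' ⟨U, V, hU, hV, hm, hs⟩ ⟨U', V', hU', hV', hm', hs'⟩
    have := finrank_add_le_of_disjoint U V' (by
      intro u hu hv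
      by_contra h0
      linarith [hU u hu h0, hV' u hv h0])
    omega
  exact le_antisymm (key _ _ h h') (key _ _ h' h)

/-- Spectral splitting of a symmetric operator. -/
theorem spectral_split (T : E →L[ℝ] E) (hT : (T : E →ₗ[ℝ] E).IsSymmetric) :
    ∃ U V : Submodule ℝ E,
      (∀ δ : ℝ, (∀ (μ : ℝ) (f : E), f ≠ 0 → T f = μ • f → μ ≠ 0 → δ ≤ |μ|) →
        (∀ u ∈ U, δ * ‖u‖ ^ 2 ≤ ⟪T u, u⟫) ∧ (∀ v ∈ V, ⟪T v, v⟫ ≤ -(δ * ‖v‖ ^ 2))) ∧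
      (∀ u ∈ U, ∀ h, T h = 0 → ⟪u, h⟫ = 0) ∧ (∀ u ∈ V, ∀ h, T h = 0 → ⟪u, h⟫ = 0) ∧
      (Module.finrank ℝ U + Module.finrank ℝ V +
        Module.finrank ℝ (LinearMap.ker (T : E →ₗ[ℝ] E)) = Module.finrank ℝ E) ∧
      (∀ B : E →L[ℝ] E, B * T = T * B → ∀ u ∈ U, B u ∈ U) := by
  classical
  obtain ⟨n, hn⟩ : ∃ n, Module.finrank ℝ E = n := ⟨_, rfl⟩
  let b := hT.eigenvectorBasis hn
  let ev := hT.eigenvalues hn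
  have hb : ∀ i, T (b i) = ev i • b i := fun i => hT.apply_eigenvectorBasis hn i
  have hTf : ∀ f i, ⟪b i, T f⟫ = ev i * ⟪b i, f⟫ := by
    intro f i
    have := hT (b i) f
    simp only [ContinuousLinearMap.coe_coe] at this
    rw [← this, hb, inner_smul_left]
    simp
  have hq : ∀ f, ⟪T f, f⟫ = ∑ i, ev i * ⟪b i, f⟫ ^ 2 := by
    intro f
    rw [← b.sum_inner_mul_inner]
    refine Finset.sum_congr rfl fun i _ => ?_
    rw [real_inner_comm, hTf]; ring
  have hnorm : ∀ f, ‖f‖ ^ 2 = ∑ i, ⟪b i, f⟫ ^ 2 := by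
    intro f
    rw [← real_inner_self_eq_norm_sq, ← b.sum_inner_mul_inner]
    refine Finset.sum_congr rfl fun i _ => ?_
    rw [real_inner_comm]; ring
  have hker : LinearMap.ker (T : E →ₗ[ℝ] E) = coordSub b (fun i => ev i ≠ 0) := by
    ext f
    rw [mem_coordSub, LinearMap.mem_ker]
    constructor
    · intro h i hi
      have := hTf f i
      simp only [ContinuousLinearMap.coe_coe] at h
      rw [h, inner_zero_right] at this
      exact (mul_eq_zero.mp this.symm).resolve_left hi
    · intro h
      apply b.toBasis.ext_elem
      intro i
      simp only [OrthonormalBasis.coe_toBasis_repr_apply, OrthonormalBasis.repr_apply_apply,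
        ContinuousLinearMap.coe_coe, hTf, map_zero]
      by_cases hi : ev i = 0
      · simp [hi]
      · simp [h i hi]
  have ho : ∀ P Q : Fin n → Prop, (∀ i, P i ∨ Q i) → ∀ u ∈ coordSub b P, ∀ v ∈ coordSub b Q,
      ⟪u, v⟫ = 0 := by
    intro P Q hPQ u hu v hv
    rw [← b.sum_inner_mul_inner]
    refine Finset.sum_eq_zero fun i _ => ?_
    rcases hPQ i with h | h
    · rw [real_inner_comm, hu i h, zero_mul]
    · rw [hv i h, mul_zero]
  refine ⟨coordSub b (fun i => ev i ≤ 0), coordSub b (fun i => 0 ≤ ev i), ?_, ?_, ?_, ?_, ?_⟩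
  · intro δ hδ
    have hδ' : ∀ i, ev i ≠ 0 → δ ≤ |ev i| := fun i hi =>
      hδ (ev i) (b i) (b.orthonormal.ne_zero i) (hb i) hi
    constructor
    · intro u hu
      rw [hq, hnorm, Finset.mul_sum]
      refine Finset.sum_le_sum fun i _ => ?_
      by_cases hi : ev i ≤ 0
      · rw [hu i hi]; simp
      · have := hδ' i (by linarith)
        rw [abs_of_pos (by linarith)] at this
        exact mul_le_mul_of_nonneg_right this (sq_nonneg _)
    · intro u hu
      rw [hq, hnorm, Finset.mul_sum, ← Finset.sum_neg_distrib]
      refine Finset.sum_le_sum fun i _ => ?_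
      by_cases hi : 0 ≤ ev i
      · rw [hu i hi]; simp
      · have := hδ' i (by linarith)
        rw [abs_of_neg (by linarith)] at this
        nlinarith [mul_le_mul_of_nonneg_right this (sq_nonneg ⟪b i, u⟫)]
  · intro u hu h hh
    have hh' : h ∈ coordSub b (fun i => ev i ≠ 0) := by rw [← hker]; exact hh
    exact ho _ _ (fun i => by rcases eq_or_ne (ev i) 0 with h | h; exacts [Or.inl h.le, Or.inr h])
      u hu h hh'
  · intro u hu h hh
    have hh' : h ∈ coordSub b (fun i => ev i ≠ 0) := by rw [← hker]; exact hh
    exact ho _ _ (fun i => by rcases eq_or_ne (ev i) 0 with h | h; exacts [Or.inl h.ge, Or.inr h])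
      u hu h hh'
  · rw [hker, finrank_coordSub, finrank_coordSub, finrank_coordSub, hn]
    simp only [Nat.card_eq_fintype_card, Fintype.card_subtype]
    have e : ∀ i, (if ¬ ev i ≤ 0 then 1 else 0) + (if ¬ 0 ≤ ev i then 1 else 0) +
        (if ¬ ev i ≠ 0 then 1 else 0) = 1 := by
      intro i
      rcases lt_trichotomy (ev i) 0 with h | h | h
      · simp [h.le, h, h.ne]
      · simp [h]
      · simp [h.le, h, h.ne']
    simp only [Finset.card_filter, ← Finset.sum_add_distrib]
    rw [Finset.sum_congr rfl (fun i _ => e i)]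
    simp
  · intro B hB u hu i hi
    have hBT : ∀ f, B (T f) = T (B f) := fun f => congrArg (fun S : E →L[ℝ] E => S f) hB
    rw [← b.sum_repr' u, map_sum, inner_sum]
    refine Finset.sum_eq_zero fun l _ => ?_
    rw [map_smul, inner_smul_right]
    by_cases hl : ev l ≤ 0
    · rw [hu l hl, zero_mul]
    · have h1 := hTf (B (b l)) i
      rw [← hBT, hb, map_smul, inner_smul_right] at h1
      have h2 : (ev l - ev i) * ⟪b i, B (b l)⟫ = 0 := by linarith
      rcases mul_eq_zero.mp h2 with h | h
      · exfalso; linarith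
      · rw [h, mul_zero]

theorem exists_gap (T : E →L[ℝ] E) (hinj : ∀ f, T f = 0 → f = 0) :
    ∃ δ > 0, ∀ f, δ * ‖f‖ ≤ ‖T f‖ := by
  obtain ⟨K, hK, h⟩ := (T : E →ₗ[ℝ] E).exists_antilipschitzWith
    (LinearMap.ker_eq_bot'.mpr hinj)
  refine ⟨(K : ℝ)⁻¹, by positivity, fun f => ?_⟩
  have := h.le_mul_dist f 0
  simp only [dist_zero_right, map_zero, ContinuousLinearMap.coe_coe] at this
  rw [inv_mul_le_iff₀ (by positivity)]
  exact this

/-- A nondegenerate symmetric operator has an index, with quantitative gap and an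
invariant positive subspace. -/
theorem exists_hasPos (T : E →L[ℝ] E) (hT : (T : E →ₗ[ℝ] E).IsSymmetric)
    (hinj : ∀ f, T f = 0 → f = 0) :
    ∃ δ > 0, ∃ U V : Submodule ℝ E, (∀ u ∈ U, δ * ‖u‖ ^ 2 ≤ ⟪T u, u⟫) ∧
      (∀ v ∈ V, ⟪T v, v⟫ ≤ -(δ * ‖v‖ ^ 2)) ∧
      Module.finrank ℝ U + Module.finrank ℝ V = Module.finrank ℝ E ∧
      (∀ B : E →L[ℝ] E, B * T = T * B → ∀ u ∈ U, B u ∈ U) := by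
  obtain ⟨δ, hδ, hg⟩ := exists_gap T hinj
  obtain ⟨U, V, h1, -, -, h4, h5⟩ := spectral_split T hT
  obtain ⟨h6, h7⟩ := h1 δ (by
    intro μ f hf hTf _
    have := hg f
    rw [hTf, norm_smul, Real.norm_eq_abs] at this
    exact le_of_mul_le_mul_right this (norm_pos_iff.mpr hf))
  have hk : LinearMap.ker (T : E →ₗ[ℝ] E) = ⊥ := LinearMap.ker_eq_bot'.mpr hinj
  rw [hk, finrank_bot, add_zero] at h4
  exact ⟨δ, hδ, U, V, h6, h7, h4, h5⟩

theorem hasPos_of_gap {T S : E →L[ℝ] E} {δ : ℝ} {U V : Submodule ℝ E}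
    (hU : ∀ u ∈ U, δ * ‖u‖ ^ 2 ≤ ⟪T u, u⟫) (hV : ∀ v ∈ V, ⟪T v, v⟫ ≤ -(δ * ‖v‖ ^ 2))
    (hs : Module.finrank ℝ U + Module.finrank ℝ V = Module.finrank ℝ E) (hST : ‖S - T‖ < δ) :
    HasPos S (Module.finrank ℝ U) := by
  have key : ∀ f, |⟪S f, f⟫ - ⟪T f, f⟫| ≤ ‖S - T‖ * ‖f‖ ^ 2 := by
    intro f
    have e : ⟪S f, f⟫ - ⟪T f, f⟫ = ⟪(S - T) f, f⟫ := by
      simp [inner_sub_left]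
    rw [e]
    calc _ ≤ ‖(S - T) f‖ * ‖f‖ := abs_real_inner_le_norm _ _
      _ ≤ (‖S - T‖ * ‖f‖) * ‖f‖ := by gcongr; exact (S - T).le_opNorm f
      _ = _ := by ring
  refine ⟨U, V, ?_, ?_, rfl, hs⟩
  · intro u hu h0
    have hp : 0 < ‖u‖ ^ 2 := by positivity
    have := (abs_le.mp (key u)).1
    nlinarith [hU u hu]
  · intro u hu h0
    have hp : 0 < ‖u‖ ^ 2 := by positivity
    have := (abs_le.mp (key u)).2
    nlinarith [hV u hu]

/-- Homotopy invariance of the index along a segment. -/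
theorem HasPos.homotopy {A B : E →L[ℝ] E} (hA : (A : E →ₗ[ℝ] E).IsSymmetric)
    (hB : (B : E →ₗ[ℝ] E).IsSymmetric)
    (hinj : ∀ t : ℝ, 0 ≤ t → t ≤ 1 → ∀ f, ((1 - t) • A + t • B) f = 0 → f = 0)
    {m : ℕ} (h : HasPos A m) : HasPos B m := by
  let T : ℝ → (E →L[ℝ] E) := fun t => (1 - t) • A + t • B
  have hTs : ∀ t, ((T t : E →L[ℝ] E) : E →ₗ[ℝ] E).IsSymmetric := by
    intro t f g
    have h1 := hA f g
    have h2 := hB f g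
    simp only [ContinuousLinearMap.coe_coe] at h1 h2
    simp [T, inner_add_left, inner_add_right, inner_smul_left, inner_smul_right, h1, h2]
  have hloc : ∀ t ∈ Set.Icc (0:ℝ) 1, ∃ m, ∃ ε > 0, ∀ s, |s - t| < ε → HasPos (T s) m := by
    intro t ht
    obtain ⟨δ, hδ, U, V, hU, hV, hs, -⟩ := exists_hasPos (T t) (hTs t) (hinj t ht.1 ht.2)
    refine ⟨_, δ / (‖B - A‖ + 1), by positivity, fun s hst => hasPos_of_gap hU hV hs ?_⟩
    have e : T s - T t = (s - t) • (B - A) := by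
      simp only [T]; module
    rw [e, norm_smul, Real.norm_eq_abs]
    rw [lt_div_iff₀ (by positivity)] at hst
    nlinarith [abs_nonneg (s - t), norm_nonneg (B - A)]
  choose! M ε hε hM using hloc
  have hcont : ContinuousOn M (Set.Icc (0:ℝ) 1) := by
    intro t ht
    have : M =ᶠ[nhdsWithin t (Set.Icc 0 1)] fun _ => M t := by
      have h1 : ∀ᶠ s in nhdsWithin t (Set.Icc 0 1), |s - t| < ε t := by
        apply Filter.Eventually.filter_mono nhdsWithin_le_nhds
        exact Metric.ball_mem_nhds t (hε t ht)
      filter_upwards [h1, self_mem_nhdsWithin] with s hs hs2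
      exact (hM s hs2 s (by simpa using hε s hs2)).unique (hM t ht s hs)
    exact (continuousWithinAt_const).congr_of_eventuallyEq this rfl
  have hconst : M 0 = M 1 :=
    isPreconnected_Icc.constant hcont (by simp) (by simp)
  have h0 : HasPos A (M 0) := by
    simpa [T] using hM 0 (by simp) 0 (by simpa using hε 0 (by simp))
  have h1 : HasPos B (M 1) := by
    simpa [T] using hM 1 (by simp) 1 (by simpa using hε 1 (by simp))
  rw [h.unique h0, hconst]
  exact h1

/-- Joint diagonalisation principle: positivity can be checked on joint eigenvectors. -/
theorem joint_nonneg {ι : Type*} [Finite ι] (Z : ι → E →L[ℝ] E)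
    (hZ : ∀ i, (Z i : E →ₗ[ℝ] E).IsSymmetric) (hc : ∀ i l, Z i * Z l = Z l * Z i)
    (M : E →L[ℝ] E) (hM : ∀ i, M * Z i = Z i * M)
    (hpos : ∀ (χ : ι → ℝ) (v : E), (∀ i, Z i v = χ i • v) → 0 ≤ ⟪M v, v⟫) (f : E) :
    0 ≤ ⟪M f, f⟫ := by
  classical
  have htop := LinearMap.IsSymmetric.iSup_iInf_eq_top_of_commute
    (T := fun i => (Z i : E →ₗ[ℝ] E)) hZ (by
      intro i l _
      have := hc i l
      show (Z i : E →ₗ[ℝ] E) * (Z l : E →ₗ[ℝ] E) = (Z l : E →ₗ[ℝ] E) * (Z i : E →ₗ[ℝ] E)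
      ext v
      exact congrArg (fun S : E →L[ℝ] E => S v) this)
  have hf : f ∈ ⨆ χ : ι → ℝ, ⨅ i, Module.End.eigenspace (Z i : E →ₗ[ℝ] E) (χ i) := by
    rw [htop]; trivial
  rw [Submodule.mem_iSup_iff_exists_finsupp] at hf
  obtain ⟨v, hv, rfl⟩ := hf
  have hv' : ∀ χ i, Z i (v χ) = χ i • v χ := by
    intro χ i
    have := hv χ
    rw [Submodule.mem_iInf] at this
    exact Module.End.mem_eigenspace_iff.mp (this i)
  have horth : ∀ χ χ', χ ≠ χ' → ⟪M (v χ), v χ'⟫ = 0 := by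
    intro χ χ' hne
    obtain ⟨i, hi⟩ := Function.ne_iff.mp hne
    have h1 := hZ i (M (v χ)) (v χ')
    simp only [ContinuousLinearMap.coe_coe] at h1
    have h2 : Z i (M (v χ)) = χ i • M (v χ) := by
      have := congrArg (fun S : E →L[ℝ] E => S (v χ)) (hM i)
      simp only [mul_apply_eq_comp] at this
      rw [← this, hv', map_smul]
    rw [h2, hv', inner_smul_left, inner_smul_right] at h1
    simp only [conj_trivial] at h1
    have h3 : (χ i - χ' i) * ⟪M (v χ), v χ'⟫ = 0 := by linarith
    exact (mul_eq_zero.mp h3).resolve_left (sub_ne_zero.mpr hi)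
  rw [Finsupp.sum, map_sum, sum_inner]
  refine Finset.sum_nonneg fun χ hχ => ?_
  rw [inner_sum]
  refine Finset.sum_nonneg fun χ' hχ' => ?_
  by_cases h : χ = χ'
  · subst h; exact hpos χ _ (hv' χ)
  · rw [horth _ _ h]

end Inertia
end AdamsProof

namespace AdamsProof

section Algebra
variable {I : Type*} [Fintype I] [DecidableEq I] {R : Type*} [Ring R] [StarRing R] [Algebra ℝ R]

theorem sq_sum_anti (a : I → R) (h : ∀ i l, i ≠ l → a i * a l + a l * a i = 0) :
    (∑ i, a i) * (∑ i, a i) = ∑ i, a i * a i := by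
  have h2 : (∑ i, a i) * (∑ i, a i) + (∑ i, a i) * (∑ i, a i) =
      ∑ i, a i * a i + ∑ i, a i * a i := by
    have e1 : (∑ i, a i) * (∑ i, a i) = ∑ i, ∑ l, a i * a l := by
      rw [Finset.sum_mul_sum]
    have e2 : (∑ i, a i) * (∑ i, a i) = ∑ i, ∑ l, a l * a i := by
      rw [e1, Finset.sum_comm]
    nth_rewrite 1 [e1]
    rw [e2, ← Finset.sum_add_distrib, ← Finset.sum_add_distrib]
    refine Finset.sum_congr rfl fun i _ => ?_
    rw [← Finset.sum_add_distrib]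
    rw [Finset.sum_eq_single i]
    · intro l _ hl
      exact h i l (Ne.symm hl)
    · simp
  have h3 : (2:ℝ) • ((∑ i, a i) * (∑ i, a i)) = (2:ℝ) • ∑ i, a i * a i := by
    rw [two_smul, two_smul]; exact h2
  exact smul_right_injective R (two_ne_zero (α := ℝ)) h3

/-- The algebraic data: `x, z, p` (spin operators at the sites `I`), the parity `Pi`, and the
twisted Clifford elements `Γ` with signs `η`. -/
structure Sys (I : Type*) (R : Type*) [Ring R] [StarRing R] [Algebra ℝ R] (j : ℝ) where
  x : I → R
  z : I → R
  p : I → R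
  Γ : I → R
  Pi : R
  η : I → ℝ
  sx : ∀ i, star (x i) = x i
  sz : ∀ i, star (z i) = z i
  sp : ∀ i, star (p i) = -p i
  sPi : star Pi = Pi
  sΓ : ∀ i, star (Γ i) = η i • Γ i
  hη : ∀ i, η i = 1 ∨ η i = -1
  xx : ∀ i l, x i * x l = x l * x i
  zz : ∀ i l, z i * z l = z l * z i
  pp : ∀ i l, p i * p l = p l * p i
  xz : ∀ i l, i ≠ l → x i * z l = z l * x i
  pz : ∀ i l, i ≠ l → p i * z l = z l * p i
  xp : ∀ i l, i ≠ l → x i * p l = p l * x i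
  xz' : ∀ i, x i * z i - z i * x i = p i
  pz' : ∀ i, p i * z i - z i * p i = x i
  xp' : ∀ i, x i * p i - p i * x i = z i
  cas : ∀ i, x i * x i + z i * z i - p i * p i = (j * (j + 1)) • (1 : R)
  PiPi : Pi * Pi = 1
  Piz : ∀ i, Pi * z i = z i * Pi
  Pix : ∀ i, Pi * x i = -(x i * Pi)
  Pip : ∀ i, Pi * p i = -(p i * Pi)
  PiΓ : ∀ i, Pi * Γ i = Γ i * Pi
  zΓ : ∀ i l, z i * Γ l = Γ l * z i
  xΓ : ∀ i l, Γ l * x i = -(η l • (x i * Γ l))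
  pΓ : ∀ i l, Γ l * p i = -(η l • (p i * Γ l))
  ΓΓ : ∀ i l, i ≠ l → Γ i * Γ l = -((η i * η l) • (Γ l * Γ i))
  Γsq : ∀ i, Γ i * Γ i = η i • (1 : R)

/-- A family of couplings. -/
structure Sys.Cpl {j : ℝ} (S : Sys I R j) (G : I → R) : Prop where
  sG : ∀ i, star (G i) = G i
  xG : ∀ i l, x S i * G l = G l * x S i
  zG : ∀ i l, z S i * G l = G l * z S i
  pG : ∀ i l, p S i * G l = G l * p S i
  PiG : ∀ i, Pi S * G i = G i * Pi S
  ΓG : ∀ i l, Γ S l * G i = η S l • (G i * Γ S l)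

namespace Sys
variable {j : ℝ} (S : Sys I R j) {G : I → R}

def D (G : I → R) : R := ∑ i, S.x i * G i + ∑ i, S.p i * S.Γ i
def lam : R := ∑ i, S.z i - (((Fintype.card I : ℝ) - 1) * j) • (1 : R)
def L (G : I → R) : R := S.D G + S.lam * S.Pi

variable {S}

theorem etasq (i : I) : S.η i * S.η i = 1 := by
  rcases S.hη i with h | h <;> rw [h] <;> norm_num

theorem PP_anti (i l : I) (h : i ≠ l) :
    (S.p i * S.Γ i) * (S.p l * S.Γ l) + (S.p l * S.Γ l) * (S.p i * S.Γ i) = 0 := by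
  have e1 : (S.p i * S.Γ i) * (S.p l * S.Γ l) = S.p i * (S.Γ i * S.p l) * S.Γ l := by noncomm_ring
  have e2 : (S.p l * S.Γ l) * (S.p i * S.Γ i) = S.p l * (S.Γ l * S.p i) * S.Γ i := by noncomm_ring
  have e3 : S.p l * S.p i * (S.Γ l * S.Γ i) = S.p i * S.p l * -((S.η l * S.η i) • (S.Γ i * S.Γ l)) := by
    rw [S.pp l i, S.ΓΓ l i h.symm]
  rw [e1, e2, S.pΓ, S.pΓ]
  simp only [mul_neg, neg_mul, mul_smul_comm, smul_mul_assoc, ← mul_assoc] at e3 ⊢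
  rw [e3]
  rcases S.hη i with h1 | h1 <;> rcases S.hη l with h2 | h2 <;> simp [h1, h2]

theorem PP_sq (i : I) : (S.p i * S.Γ i) * (S.p i * S.Γ i) = -(S.p i * S.p i) := by
  have e1 : (S.p i * S.Γ i) * (S.p i * S.Γ i) = S.p i * (S.Γ i * S.p i) * S.Γ i := by noncomm_ring
  rw [e1, S.pΓ]
  have e2 : S.p i * -(S.η i • (S.p i * S.Γ i)) * S.Γ i = -(S.η i • (S.p i * S.p i * (S.Γ i * S.Γ i))) := by
    simp only [mul_neg, neg_mul, mul_smul_comm, smul_mul_assoc, ← mul_assoc]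
  rw [e2, S.Γsq, mul_smul_comm, smul_smul, etasq, one_smul, mul_one]

theorem ΓxG (hG : S.Cpl G) (i l : I) : S.Γ l * (S.x i * G i) = -(S.x i * G i * S.Γ l) := by
  rw [← mul_assoc, S.xΓ, neg_mul, smul_mul_assoc, mul_assoc, hG.ΓG, mul_smul_comm, smul_smul,
    etasq, one_smul, mul_assoc]

theorem D_sq (hG : S.Cpl G) : S.D G * S.D G =
    (∑ i, S.x i * G i) * (∑ i, S.x i * G i) + ∑ i, S.z i * G i * S.Γ i - ∑ i, S.p i * S.p i := by
  have hP : (∑ i, S.p i * S.Γ i) * (∑ i, S.p i * S.Γ i) = -∑ i, S.p i * S.p i := by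
    rw [sq_sum_anti _ PP_anti, ← Finset.sum_neg_distrib]
    exact Finset.sum_congr rfl fun i _ => PP_sq i
  have hXP : (∑ i, S.x i * G i) * (∑ i, S.p i * S.Γ i) + (∑ i, S.p i * S.Γ i) * (∑ i, S.x i * G i)
      = ∑ i, S.z i * G i * S.Γ i := by
    rw [Finset.sum_mul_sum, Finset.sum_mul_sum, Finset.sum_comm, ← Finset.sum_add_distrib]
    refine Finset.sum_congr rfl fun l _ => ?_
    rw [← Finset.sum_add_distrib]
    have e : ∀ i, S.x i * G i * (S.p l * S.Γ l) + S.p l * S.Γ l * (S.x i * G i) =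
        (S.x i * S.p l - S.p l * S.x i) * G i * S.Γ l := by
      intro i
      rw [mul_assoc (S.p l), ΓxG hG]
      have : S.x i * G i * (S.p l * S.Γ l) = S.x i * (G i * S.p l) * S.Γ l := by noncomm_ring
      rw [this, ← hG.pG]
      noncomm_ring
    rw [Finset.sum_eq_single l]
    · rw [e, S.xp']
    · intro i _ hi
      rw [e, S.xp i l hi, sub_self, zero_mul, zero_mul]
    · simp
  have : S.D G * S.D G = (∑ i, S.x i * G i) * (∑ i, S.x i * G i) +
      ((∑ i, S.x i * G i) * (∑ i, S.p i * S.Γ i) + (∑ i, S.p i * S.Γ i) * (∑ i, S.x i * G i)) +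
      (∑ i, S.p i * S.Γ i) * (∑ i, S.p i * S.Γ i) := by
    unfold D; noncomm_ring
  rw [this, hP, hXP, sub_eq_add_neg]

theorem D_lam (hG : S.Cpl G) : S.D G * S.lam - S.lam * S.D G =
    ∑ i, (S.p i * G i + S.x i * S.Γ i) := by
  have e1 : S.D G * S.lam - S.lam * S.D G = S.D G * (∑ i, S.z i) - (∑ i, S.z i) * S.D G := by
    unfold lam
    simp only [mul_sub, sub_mul, mul_smul_comm, smul_mul_assoc, one_mul, mul_one]
    abel
  rw [e1]
  unfold D
  rw [← Finset.sum_add_distrib, Finset.sum_mul_sum, Finset.sum_mul_sum, Finset.sum_comm,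
    ← Finset.sum_sub_distrib]
  refine Finset.sum_congr rfl fun l _ => ?_
  rw [← Finset.sum_sub_distrib]
  have e : ∀ i, (S.x i * G i + S.p i * S.Γ i) * S.z l - S.z l * (S.x i * G i + S.p i * S.Γ i) =
      (S.x i * S.z l - S.z l * S.x i) * G i + (S.p i * S.z l - S.z l * S.p i) * S.Γ i := by
    intro i
    have h1 : S.x i * G i * S.z l = S.x i * S.z l * G i := by
      rw [mul_assoc, ← hG.zG, mul_assoc]
    have h2 : S.p i * S.Γ i * S.z l = S.p i * S.z l * S.Γ i := by
      rw [mul_assoc, ← S.zΓ, mul_assoc]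
    rw [add_mul, h1, h2]
    noncomm_ring
  rw [Finset.sum_eq_single l]
  · rw [e, S.xz', S.pz']
  · intro i _ hi
    rw [e, S.xz i l hi, S.pz i l hi]; simp
  · simp

theorem Pi_D (hG : S.Cpl G) : S.Pi * S.D G = -(S.D G * S.Pi) := by
  unfold D
  rw [mul_add, add_mul, neg_add, Finset.mul_sum, Finset.mul_sum, Finset.sum_mul, Finset.sum_mul,
    ← Finset.sum_neg_distrib, ← Finset.sum_neg_distrib]
  congr 1
  · refine Finset.sum_congr rfl fun i _ => ?_
    rw [← mul_assoc, S.Pix, neg_mul, mul_assoc, hG.PiG, mul_assoc]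
  · refine Finset.sum_congr rfl fun i _ => ?_
    rw [← mul_assoc, S.Pip, neg_mul, mul_assoc, S.PiΓ, mul_assoc]

theorem Pi_lam : S.Pi * S.lam = S.lam * S.Pi := by
  unfold lam
  rw [mul_sub, sub_mul (∑ i, S.z i), Finset.mul_sum, Finset.sum_mul]
  congr 1
  · exact Finset.sum_congr rfl fun i _ => S.Piz i
  · simp

theorem lamPi_sq : S.lam * S.Pi * (S.lam * S.Pi) = S.lam * S.lam := by
  have : S.lam * S.Pi * (S.lam * S.Pi) = S.lam * (S.Pi * S.lam) * S.Pi := by noncomm_ring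
  rw [this, Pi_lam]
  have : S.lam * (S.lam * S.Pi) * S.Pi = S.lam * S.lam * (S.Pi * S.Pi) := by noncomm_ring
  rw [this, S.PiPi, mul_one]

theorem Lt_sq (hG : S.Cpl G) (t : ℝ) :
    (S.D G + t • (S.lam * S.Pi)) * (S.D G + t • (S.lam * S.Pi)) =
    S.D G * S.D G + t • ((S.D G * S.lam - S.lam * S.D G) * S.Pi) + (t * t) • (S.lam * S.lam) := by
  have h1 : S.lam * S.Pi * S.D G = -(S.lam * S.D G * S.Pi) := by
    rw [mul_assoc, Pi_D hG, mul_neg, mul_assoc]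
  have h2 := lamPi_sq (S := S)
  have h3 : S.D G * (S.lam * S.Pi) = S.D G * S.lam * S.Pi := (mul_assoc _ _ _).symm
  simp only [add_mul, mul_add, smul_mul_assoc, mul_smul_comm, h1, h2, h3, sub_mul]
  module

variable [StarModule ℝ R]
theorem star_D (hG : S.Cpl G) : star (S.D G) = S.D G := by
  unfold D
  rw [star_add, star_sum, star_sum]
  congr 1
  · refine Finset.sum_congr rfl fun i _ => ?_
    rw [star_mul, S.sx, hG.sG, hG.xG]
  · refine Finset.sum_congr rfl fun i _ => ?_
    rw [star_mul, S.sp, S.sΓ, mul_neg, smul_mul_assoc, S.pΓ, smul_neg, smul_smul, etasq, one_smul,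
      neg_neg]

theorem star_lam : star S.lam = S.lam := by
  unfold lam
  simp [star_sum, S.sz]

theorem star_L (hG : S.Cpl G) : star (S.L G) = S.L G := by
  unfold L
  rw [star_add, star_D hG, star_mul, star_lam, S.sPi, Pi_lam]

end Sys
end Algebra
end AdamsProof

namespace AdamsProof

section Nondeg
variable {E : Type*} [NormedAddCommGroup E] [InnerProductSpace ℝ E] [FiniteDimensional ℝ E]
variable {I : Type*} [Fintype I] [DecidableEq I]

theorem inner_star (A : E →L[ℝ] E) (f g : E) : ⟪A f, g⟫ = ⟪f, (star A) g⟫ := by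
  rw [ContinuousLinearMap.star_eq_adjoint, ContinuousLinearMap.adjoint_inner_right]

theorem symm_of_star {A : E →L[ℝ] E} (h : star A = A) : (A : E →ₗ[ℝ] E).IsSymmetric := by
  intro f g
  simpa [h] using inner_star A f g

theorem inner_symm {A : E →L[ℝ] E} (h : star A = A) (f g : E) : ⟪A f, g⟫ = ⟪f, A g⟫ := by
  rw [inner_star, h]

theorem inner_sq {A : E →L[ℝ] E} (h : star A = A) (f : E) : ⟪(A * A) f, f⟫ = ‖A f‖ ^ 2 := by
  rw [mul_apply_eq_comp, inner_symm h, real_inner_self_eq_norm_sq]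

theorem inner_sq_skew {A : E →L[ℝ] E} (h : star A = -A) (f : E) :
    ⟪(A * A) f, f⟫ = -‖A f‖ ^ 2 := by
  rw [mul_apply_eq_comp, inner_star, h, ← real_inner_self_eq_norm_sq]
  simp [inner_neg_right]

theorem clm_sum_apply (A : I → E →L[ℝ] E) (f : E) : (∑ i, A i) f = ∑ i, A i f := by
  simp

theorem num_ineq (χ : I → ℝ) (j c : ℝ) (hc : 0 ≤ c) (hc1 : c ≤ 1) (hχ : ∀ i, χ i ≤ j) :
    0 ≤ (∑ i, χ i - ((Fintype.card I : ℝ) - 1) * j) ^ 2 + c * (∑ i, (j ^ 2 - χ i ^ 2)) - c * j ^ 2 := by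
  obtain ⟨y, hy⟩ : ∃ y : I → ℝ, ∀ i, χ i = j - y i := ⟨fun i => j - χ i, fun i => by ring⟩
  have hy0 : ∀ i, 0 ≤ y i := fun i => by linarith [hχ i, hy i]
  have e1 : ∑ i, χ i = (Fintype.card I : ℝ) * j - ∑ i, y i := by
    simp [hy, Finset.sum_sub_distrib]
  have e2 : ∑ i, (j ^ 2 - χ i ^ 2) = 2 * j * ∑ i, y i - ∑ i, y i ^ 2 := by
    rw [Finset.mul_sum, ← Finset.sum_sub_distrib]
    refine Finset.sum_congr rfl fun i _ => ?_
    rw [hy]; ring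
  have e3 : ∑ i, y i ^ 2 ≤ (∑ i, y i) ^ 2 := by
    rw [sq (∑ i, y i), Finset.sum_mul]
    refine Finset.sum_le_sum fun i _ => ?_
    rw [sq]
    exact mul_le_mul_of_nonneg_left
      (Finset.single_le_sum (fun i _ => hy0 i) (Finset.mem_univ i)) (hy0 i)
  rw [e1, e2]
  have : (↑(Fintype.card I) * j - ∑ i, y i - (↑(Fintype.card I) - 1) * j) = j - ∑ i, y i := by ring
  rw [this]
  nlinarith [mul_nonneg (sub_nonneg.mpr hc1) (sq_nonneg (j - ∑ i, y i)),
    mul_nonneg hc (sub_nonneg.mpr e3)]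

namespace Sys
variable {j : ℝ} {S : Sys I (E →L[ℝ] E) j} {G : I → E →L[ℝ] E}

theorem norm_cas (i : I) (f : E) :
    ‖S.x i f‖ ^ 2 + ‖S.z i f‖ ^ 2 + ‖S.p i f‖ ^ 2 = j * (j + 1) * ‖f‖ ^ 2 := by
  have h := congrArg (fun A : E →L[ℝ] E => ⟪A f, f⟫) (S.cas i)
  simp only [sub_apply, add_apply,
    smul_apply, one_apply_eq_self, inner_sub_left, inner_add_left,
    inner_sq (S.sx i), inner_sq (S.sz i), inner_sq_skew (S.sp i), inner_smul_left,
    real_inner_self_eq_norm_sq, conj_trivial] at h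
  linarith

theorem norm_Γ (i : I) (f : E) : ‖S.Γ i f‖ = ‖f‖ := by
  have : ‖S.Γ i f‖ ^ 2 = ‖f‖ ^ 2 := by
    rw [← real_inner_self_eq_norm_sq, inner_star, S.sΓ, ← mul_apply_eq_comp, smul_mul_assoc, S.Γsq,
      smul_smul, etasq, one_smul, one_apply_eq_self, real_inner_self_eq_norm_sq]
  exact (sq_eq_sq₀ (norm_nonneg _) (norm_nonneg _)).mp this

theorem norm_Pi (f : E) : ‖S.Pi f‖ = ‖f‖ := by
  have : ‖S.Pi f‖ ^ 2 = ‖f‖ ^ 2 := by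
    rw [← real_inner_self_eq_norm_sq, inner_star, S.sPi, ← mul_apply_eq_comp, S.PiPi,
      one_apply_eq_self, real_inner_self_eq_norm_sq]
  exact (sq_eq_sq₀ (norm_nonneg _) (norm_nonneg _)).mp this

theorem star_X (hG : S.Cpl G) : star (∑ i, S.x i * G i) = ∑ i, S.x i * G i := by
  rw [star_sum]
  refine Finset.sum_congr rfl fun i _ => ?_
  rw [star_mul, S.sx, hG.sG, hG.xG]

theorem X_bound (hG : S.Cpl G) {c : ℝ}
    (hpos : ∀ (ξ : I → ℝ) (f : E), c * (∑ i, ξ i ^ 2) * ‖f‖ ^ 2 ≤ ‖(∑ i, ξ i • G i) f‖ ^ 2)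
    (f : E) : c * ∑ i, ‖S.x i f‖ ^ 2 ≤ ‖(∑ i, S.x i * G i) f‖ ^ 2 := by
  have key := joint_nonneg S.x (fun i => symm_of_star (S.sx i)) S.xx
    ((∑ i, S.x i * G i) * (∑ i, S.x i * G i) - c • ∑ i, S.x i * S.x i) ?_ ?_ f
  · simp only [sub_apply, inner_sub_left, inner_sq (star_X hG),
      smul_apply, inner_smul_left, clm_sum_apply, sum_inner,
      inner_sq (S.sx _), conj_trivial] at key ⊢
    linarith
  · intro l
    have h1 : (∑ i, S.x i * G i) * S.x l = S.x l * (∑ i, S.x i * G i) := by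
      rw [Finset.mul_sum, Finset.sum_mul]
      refine Finset.sum_congr rfl fun i _ => ?_
      rw [mul_assoc, ← hG.xG, ← mul_assoc, S.xx, mul_assoc]
    have h2 : (∑ i, S.x i * S.x i) * S.x l = S.x l * (∑ i, S.x i * S.x i) := by
      rw [Finset.mul_sum, Finset.sum_mul]
      refine Finset.sum_congr rfl fun i _ => ?_
      rw [mul_assoc, S.xx i l, ← mul_assoc, S.xx i l, mul_assoc]
    rw [sub_mul, mul_sub, mul_assoc, h1, ← mul_assoc, h1, smul_mul_assoc, h2, mul_smul_comm,
      mul_assoc]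
  · intro χ v hv
    have h1 : (∑ i, S.x i * G i) v = (∑ i, χ i • G i) v := by
      rw [clm_sum_apply, clm_sum_apply]
      refine Finset.sum_congr rfl fun i _ => ?_
      rw [hG.xG, mul_apply_eq_comp, hv, map_smul, smul_apply]
    have h2 := hpos χ v
    simp only [sub_apply, inner_sub_left, inner_sq (star_X hG),
      smul_apply, inner_smul_left, clm_sum_apply (fun i => S.x i * S.x i),
      sum_inner, inner_sq (S.sx _), conj_trivial, hv, norm_smul, h1, Real.norm_eq_abs, mul_pow,
      sq_abs, ← Finset.sum_mul] 
    linarith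

theorem lam_apply (v : E) (χ : I → ℝ) (hv : ∀ i, S.z i v = χ i • v) :
    S.lam v = (∑ i, χ i - ((Fintype.card I : ℝ) - 1) * j) • v := by
  unfold lam
  rw [sub_apply, clm_sum_apply, smul_apply,
    one_apply_eq_self, sub_smul, Finset.sum_smul]
  congr 1
  exact Finset.sum_congr rfl fun i _ => hv i

theorem lam_z (i : I) : S.lam * S.z i = S.z i * S.lam := by
  unfold lam
  rw [sub_mul, mul_sub, Finset.sum_mul, Finset.mul_sum]
  congr 1
  · exact Finset.sum_congr rfl fun l _ => S.zz l i
  · simp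

theorem lam_bound (hz : ∀ i χ f, f ≠ 0 → S.z i f = χ • f → χ ≤ j) {c : ℝ} (hc : 0 ≤ c)
    (hc1 : c ≤ 1) (f : E) :
    c * j ^ 2 * ‖f‖ ^ 2 ≤ ‖S.lam f‖ ^ 2 + c * ∑ i, (j ^ 2 * ‖f‖ ^ 2 - ‖S.z i f‖ ^ 2) := by
  have key := joint_nonneg S.z (fun i => symm_of_star (S.sz i)) S.zz
    (S.lam * S.lam + c • ∑ i, ((j ^ 2) • (1 : E →L[ℝ] E) - S.z i * S.z i)
      - (c * j ^ 2) • (1 : E →L[ℝ] E)) ?_ ?_ f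
  · simp only [sub_apply, add_apply, inner_sub_left,
      inner_add_left, inner_sq (star_lam (S := S)), smul_apply,
      inner_smul_left, clm_sum_apply, sum_inner, inner_sq (S.sz _), conj_trivial,
      one_apply_eq_self, real_inner_self_eq_norm_sq] at key ⊢
    linarith
  · intro l
    have h2 : (∑ i, ((j ^ 2) • (1 : E →L[ℝ] E) - S.z i * S.z i)) * S.z l =
        S.z l * (∑ i, ((j ^ 2) • (1 : E →L[ℝ] E) - S.z i * S.z i)) := by
      rw [Finset.mul_sum, Finset.sum_mul]
      refine Finset.sum_congr rfl fun i _ => ?_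
      rw [sub_mul, mul_sub, mul_assoc, S.zz i l, ← mul_assoc, S.zz i l, mul_assoc]
      simp
    rw [sub_mul, mul_sub, add_mul, mul_add, mul_assoc, lam_z, ← mul_assoc, lam_z, smul_mul_assoc,
      h2, mul_smul_comm, mul_assoc]
    simp
  · intro χ v hv
    by_cases h0 : v = 0
    · simp [h0]
    have h1 := num_ineq χ j c hc hc1 (fun i => hz i (χ i) v h0 (hv i))
    simp only [sub_apply, add_apply, inner_sub_left,
      inner_add_left, inner_sq (star_lam (S := S)), smul_apply,
      inner_smul_left, clm_sum_apply, sum_inner, inner_sq (S.sz _), conj_trivial,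
      one_apply_eq_self, real_inner_self_eq_norm_sq, lam_apply v χ hv, hv, norm_smul,
      Real.norm_eq_abs, mul_pow, sq_abs, ← sub_mul, ← Finset.sum_mul]
    have := mul_nonneg h1 (sq_nonneg ‖v‖)
    linarith

theorem L_inj (hj : 0 ≤ j) (hG : S.Cpl G) (hz : ∀ i χ f, f ≠ 0 → S.z i f = χ • f → χ ≤ j)
    {c M : ℝ} (hc : 0 ≤ c) (hc1 : c ≤ 1) (hM0 : 0 ≤ M) (hM : ∀ i f, ‖G i f‖ ≤ M * ‖f‖)
    (hpos : ∀ (ξ : I → ℝ) (f : E), c * (∑ i, ξ i ^ 2) * ‖f‖ ^ 2 ≤ ‖(∑ i, ξ i • G i) f‖ ^ 2)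
    (hbig : (Fintype.card I : ℝ) * ((j + 1) * (2 * M + 1)) < c * j ^ 2) (f : E)
    (hf : S.L G f = 0) : f = 0 := by
  by_contra hne
  have hfp : 0 < ‖f‖ ^ 2 := by positivity
  have e := Lt_sq hG 1
  rw [one_smul, one_smul, mul_one, one_smul, D_sq hG, D_lam hG] at e
  have e' : (∑ i, (S.p i * G i + S.x i * S.Γ i)) * S.Pi =
      ∑ i, S.p i * G i * S.Pi + ∑ i, S.x i * S.Γ i * S.Pi := by
    rw [Finset.sum_mul, ← Finset.sum_add_distrib]
    exact Finset.sum_congr rfl fun i _ => add_mul _ _ _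
  rw [e'] at e
  have e0 := congrArg (fun A : E →L[ℝ] E => ⟪A f, f⟫) e
  have hL : (S.D G + S.lam * S.Pi) f = 0 := hf
  rw [mul_apply_eq_comp, hL, map_zero, inner_zero_left] at e0
  simp only [sub_apply, add_apply, inner_sub_left,
      inner_add_left, inner_sq (star_lam (S := S)), inner_sq (star_X hG)] at e0
  rw [clm_sum_apply, clm_sum_apply, clm_sum_apply, clm_sum_apply, clm_sum_apply, sum_inner, sum_inner, sum_inner,
    sum_inner] at e0
  simp only [inner_sq_skew (S.sp _)] at e0
  have b1 : ∀ i, ‖S.x i f‖ ≤ (j + 1) * ‖f‖ ∧ ‖S.z i f‖ ≤ (j + 1) * ‖f‖ ∧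
      ‖S.p i f‖ ≤ (j + 1) * ‖f‖ := by
    intro i
    have h := norm_cas (S := S) i f
    have h2 : j * (j + 1) * ‖f‖ ^ 2 ≤ ((j + 1) * ‖f‖) ^ 2 := by nlinarith
    refine ⟨?_, ?_, ?_⟩ <;> refine (sq_le_sq₀ (norm_nonneg _) (by positivity)).mp ?_ <;>
      nlinarith [sq_nonneg ‖S.x i f‖, sq_nonneg ‖S.z i f‖, sq_nonneg ‖S.p i f‖]
  have t1 : ∀ i, -((j + 1) * M * ‖f‖ ^ 2) ≤ ⟪(S.p i * G i * S.Pi) f, f⟫ := by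
    intro i
    have h1 : ⟪(S.p i * G i * S.Pi) f, f⟫ = -⟪G i (S.Pi f), S.p i f⟫ := by
      rw [mul_apply_eq_comp, mul_apply_eq_comp, inner_star, S.sp]; simp [inner_neg_right]
    have h2 := real_inner_le_norm (G i (S.Pi f)) (S.p i f)
    have h3 : ‖G i (S.Pi f)‖ * ‖S.p i f‖ ≤ (M * ‖f‖) * ((j + 1) * ‖f‖) := by
      gcongr
      · simpa [norm_Pi] using hM i (S.Pi f)
      · exact (b1 i).2.2
    rw [h1]; nlinarith
  have t2 : ∀ i, -((j + 1) * ‖f‖ ^ 2) ≤ ⟪(S.x i * S.Γ i * S.Pi) f, f⟫ := by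
    intro i
    rw [mul_apply_eq_comp, mul_apply_eq_comp, inner_symm (S.sx i)]
    have h2 := (abs_le.mp (abs_real_inner_le_norm (S.Γ i (S.Pi f)) (S.x i f))).1
    rw [norm_Γ, norm_Pi] at h2
    have h3 := mul_le_mul_of_nonneg_left (b1 i).1 (norm_nonneg f)
    nlinarith
  have t3 : ∀ i, -((j + 1) * M * ‖f‖ ^ 2) ≤ ⟪(S.z i * G i * S.Γ i) f, f⟫ := by
    intro i
    rw [mul_apply_eq_comp, mul_apply_eq_comp, inner_symm (S.sz i)]
    have h2 := (abs_le.mp (abs_real_inner_le_norm (G i (S.Γ i f)) (S.z i f))).1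
    have h3 : ‖G i (S.Γ i f)‖ * ‖S.z i f‖ ≤ (M * ‖f‖) * ((j + 1) * ‖f‖) := by
      gcongr
      · simpa [norm_Γ] using hM i (S.Γ i f)
      · exact (b1 i).2.1
    nlinarith
  have s1 := Finset.sum_le_sum (fun i (_ : i ∈ Finset.univ) => t1 i)
  have s2 := Finset.sum_le_sum (fun i (_ : i ∈ Finset.univ) => t2 i)
  have s3 := Finset.sum_le_sum (fun i (_ : i ∈ Finset.univ) => t3 i)
  simp only [Finset.sum_const, Finset.card_univ, nsmul_eq_mul] at s1 s2 s3
  have hX := X_bound hG hpos f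
  rw [clm_sum_apply] at hX
  have hl := lam_bound hz hc hc1 f
  have hcas : ∑ i, (j ^ 2 * ‖f‖ ^ 2 - ‖S.z i f‖ ^ 2) ≤
      ∑ i, ‖S.x i f‖ ^ 2 + ∑ i, ‖S.p i f‖ ^ 2 := by
    rw [← Finset.sum_add_distrib]
    refine Finset.sum_le_sum fun i _ => ?_
    nlinarith [norm_cas (S := S) i f]
  have hcas2 := mul_le_mul_of_nonneg_left hcas hc
  have hp0 : 0 ≤ ∑ i, ‖S.p i f‖ ^ 2 := Finset.sum_nonneg fun i _ => sq_nonneg _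
  have hb := mul_lt_mul_of_pos_right hbig hfp
  rw [Finset.sum_neg_distrib] at e0
  nlinarith [mul_nonneg (sub_nonneg.mpr hc1) hp0]

end Sys
end Nondeg
end AdamsProof

namespace AdamsProof

section Perturb
variable {E : Type*} [NormedAddCommGroup E] [InnerProductSpace ℝ E] [FiniteDimensional ℝ E]

/-- Degenerate perturbation theory for the index. -/
theorem hasPos_perturb (D : E →L[ℝ] E) (hD : star D = D)
    (hgap : ∀ (μ : ℝ) (f : E), f ≠ 0 → D f = μ • f → μ ≠ 0 → 1 ≤ |μ|) :
    ∃ m : ℕ, ∀ (B : E →L[ℝ] E) (t : ℝ) (N₁ N₂ : Submodule ℝ E), star B = B → 0 < t → t * ‖B‖ < 1 →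
      (∀ h, D h = 0 → D (B h) = 0) → (∀ h ∈ N₁, D h = 0 ∧ (h ≠ 0 → 0 < ⟪B h, h⟫)) →
      (∀ h ∈ N₂, D h = 0 ∧ (h ≠ 0 → ⟪B h, h⟫ < 0)) →
      Module.finrank ℝ N₁ + Module.finrank ℝ N₂ =
        Module.finrank ℝ (LinearMap.ker (D : E →ₗ[ℝ] E)) →
      HasPos (D + t • B) (m + Module.finrank ℝ N₁) := by
  obtain ⟨U, V, h1, hU, hV, hsum, -⟩ := spectral_split D (symm_of_star hD)
  obtain ⟨hU1, hV1⟩ := h1 1 hgap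
  refine ⟨Module.finrank ℝ U, ?_⟩
  intro B t N₁ N₂ hB ht htB hker hN₁ hN₂ hN
  have key : ∀ u h, (∀ g, D g = 0 → ⟪u, g⟫ = 0) → D h = 0 →
      ⟪(D + t • B) (u + h), u + h⟫ = ⟪D u, u⟫ + t * ⟪B u, u⟫ + t * ⟪B h, h⟫ := by
    intro u h hu hh
    have e1 : ⟪D u, h⟫ = 0 := by rw [inner_symm hD, hh, inner_zero_right]
    have e2 : ⟪B u, h⟫ = 0 := by rw [inner_symm hB]; exact hu _ (hker h hh)
    have e3 : ⟪B h, u⟫ = 0 := by rw [real_inner_comm]; exact hu _ (hker h hh)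
    simp only [add_apply, smul_apply, map_add, inner_add_left, inner_add_right, hh,
      inner_smul_left, inner_zero_left, conj_trivial, e1, e2, e3, smul_add]
    ring
  have hb : ∀ u, |t * ⟪B u, u⟫| ≤ (t * ‖B‖) * ‖u‖ ^ 2 := by
    intro u
    rw [abs_mul, abs_of_pos ht]
    have : |⟪B u, u⟫| ≤ ‖B‖ * ‖u‖ ^ 2 := by
      calc _ ≤ ‖B u‖ * ‖u‖ := abs_real_inner_le_norm _ _
        _ ≤ (‖B‖ * ‖u‖) * ‖u‖ := by gcongr; exact B.le_opNorm u
        _ = _ := by ring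
    calc _ ≤ t * (‖B‖ * ‖u‖ ^ 2) := by gcongr
      _ = _ := by ring
  refine ⟨U ⊔ N₁, V ⊔ N₂, ?_, ?_, ?_, ?_⟩
  · intro f hf hf0
    obtain ⟨u, hu, h, hh, rfl⟩ := Submodule.mem_sup.mp hf
    rw [key u h (hU u hu) (hN₁ h hh).1]
    have q1 := hU1 u hu
    have q2 := (abs_le.mp (hb u)).1
    by_cases h0 : h = 0
    · have hu0 : u ≠ 0 := by rintro rfl; simp [h0] at hf0
      have : 0 < ‖u‖ ^ 2 := by positivity
      subst h0
      simp only [map_zero, inner_zero_left, mul_zero, add_zero]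
      nlinarith
    · have q3 := mul_pos ht ((hN₁ h hh).2 h0)
      nlinarith [sq_nonneg ‖u‖]
  · intro f hf hf0
    obtain ⟨u, hu, h, hh, rfl⟩ := Submodule.mem_sup.mp hf
    rw [key u h (hV u hu) (hN₂ h hh).1]
    have q1 := hV1 u hu
    have q2 := (abs_le.mp (hb u)).2
    by_cases h0 : h = 0
    · have hu0 : u ≠ 0 := by rintro rfl; simp [h0] at hf0
      have : 0 < ‖u‖ ^ 2 := by positivity
      subst h0
      simp only [map_zero, inner_zero_left, mul_zero, add_zero]
      nlinarith
    · have q3 := mul_pos ht (neg_pos.mpr ((hN₂ h hh).2 h0))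
      nlinarith [sq_nonneg ‖u‖]
  · exact finrank_sup_of_disjoint _ _ fun u hu hn =>
      inner_self_eq_zero.mp (hU u hu u (hN₁ u hn).1)
  · rw [finrank_sup_of_disjoint U N₁ fun u hu hn => inner_self_eq_zero.mp (hU u hu u (hN₁ u hn).1),
      finrank_sup_of_disjoint V N₂ fun u hu hn => inner_self_eq_zero.mp (hV u hu u (hN₂ u hn).1)]
    omega

/-- Simultaneous fixed subspaces of commuting involutions with flips. -/
theorem flip_count {I : Type*} [DecidableEq I] (E₀ : Submodule ℝ E) (s τ : I → E →L[ℝ] E)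
    (hs : ∀ i, s i * s i = 1) (hτ : ∀ i, τ i * τ i = 1) (hss : ∀ i l, s i * s l = s l * s i)
    (hτs : ∀ i, τ i * s i = -(s i * τ i)) (hτs' : ∀ i l, i ≠ l → τ i * s l = s l * τ i)
    (hs0 : ∀ i, ∀ f ∈ E₀, s i f ∈ E₀) (hτ0 : ∀ i, ∀ f ∈ E₀, τ i f ∈ E₀) (A : Finset I) :
    ∃ EA : Submodule ℝ E, (∀ f, f ∈ EA ↔ f ∈ E₀ ∧ ∀ i ∈ A, s i f = -f) ∧
      Module.finrank ℝ EA * 2 ^ A.card = Module.finrank ℝ E₀ := by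
  have app : ∀ {P Q : E →L[ℝ] E}, P = Q → ∀ f, P f = Q f := fun h f => by rw [h]
  induction A using Finset.induction_on with
  | empty => exact ⟨E₀, by simp, by simp⟩
  | insert a A ha ih =>
    obtain ⟨EA, hEA, hcard⟩ := ih
    let W : ℝ → Submodule ℝ E := fun σ => EA ⊓ LinearMap.ker ((s a - σ • 1 : E →L[ℝ] E) : E →ₗ[ℝ] E)
    have hW : ∀ σ f, f ∈ W σ ↔ f ∈ EA ∧ s a f = σ • f := by
      intro σ f
      simp [W, sub_eq_zero]
    have hsA : ∀ f ∈ EA, s a f ∈ EA := by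
      intro f hf
      rw [hEA] at hf ⊢
      refine ⟨hs0 a f hf.1, fun i hi => ?_⟩
      have := app (hss i a) f
      rw [mul_apply_eq_comp, mul_apply_eq_comp] at this
      rw [this, hf.2 i hi, map_neg]
    have hτA : ∀ σ, ∀ f ∈ W σ, τ a f ∈ W (-σ) := by
      intro σ f hf
      rw [hW] at hf ⊢
      have h1 := app (hτs a) f
      rw [mul_apply_eq_comp, hf.2, map_smul] at h1
      refine ⟨?_, ?_⟩
      · rw [hEA] at hf ⊢
        refine ⟨hτ0 a f hf.1.1, fun i hi => ?_⟩
        have hne : a ≠ i := by rintro rfl; exact ha hi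
        have := app (hτs' a i hne) f
        rw [mul_apply_eq_comp, mul_apply_eq_comp] at this
        rw [← this, hf.1.2 i hi, map_neg]
      · rw [neg_smul, h1]; simp
    have hdim : ∀ σ, Module.finrank ℝ (W σ) ≤ Module.finrank ℝ (W (-σ)) := by
      intro σ
      refine LinearMap.finrank_le_finrank_of_injective
        (f := ((τ a : E →ₗ[ℝ] E).restrict (p := W σ) (q := W (-σ)) (hτA σ))) ?_
      intro f g hfg
      have h2 : τ a (f : E) = τ a (g : E) := congrArg Subtype.val hfg
      have h3 := congrArg (τ a) h2
      rw [← mul_apply_eq_comp, ← mul_apply_eq_comp, hτ] at h3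
      exact Subtype.ext h3
    have hsum : Module.finrank ℝ EA = Module.finrank ℝ (W (-1)) + Module.finrank ℝ (W 1) := by
      have hE : EA = W (-1) ⊔ W 1 := by
        apply le_antisymm
        · intro f hf
          have hss1 : s a (s a f) = f := by
            rw [← mul_apply_eq_comp, hs]; rfl
          have : f = (1 / 2 : ℝ) • (f - s a f) + (1 / 2 : ℝ) • (f + s a f) := by module
          rw [this]
          refine Submodule.add_mem_sup ?_ ?_
          · rw [hW]
            refine ⟨EA.smul_mem _ (EA.sub_mem hf (hsA f hf)), ?_⟩
            rw [map_smul, map_sub, hss1]; module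
          · rw [hW]
            refine ⟨EA.smul_mem _ (EA.add_mem hf (hsA f hf)), ?_⟩
            rw [map_smul, map_add, hss1]; module
        · exact sup_le (fun f hf => ((hW (-1) f).mp hf).1) (fun f hf => ((hW 1 f).mp hf).1)
      have hd := finrank_sup_of_disjoint (W (-1)) (W 1) (by
        intro f h1 h2
        have h1 := ((hW _ _).mp h1).2
        have h2 := ((hW _ _).mp h2).2
        rw [h1] at h2
        have h3 : (2:ℝ) • f = 0 := by
          have : (2:ℝ) • f = (1:ℝ) • f - (-1 : ℝ) • f := by module
          rw [this, h2, sub_self]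
        exact (smul_eq_zero.mp h3).resolve_left two_ne_zero)
      rw [← hE] at hd
      exact hd
    have e1 := hdim (-1)
    have e2 := hdim 1
    rw [neg_neg] at e1
    refine ⟨W (-1), ?_, ?_⟩
    · intro f
      rw [hW, hEA, neg_one_smul]
      constructor
      · rintro ⟨⟨h1, h2⟩, h3⟩
        refine ⟨h1, fun i hi => ?_⟩
        rcases Finset.mem_insert.mp hi with rfl | hi
        · exact h3
        · exact h2 i hi
      · rintro ⟨h1, h2⟩
        exact ⟨⟨h1, fun i hi => h2 i (Finset.mem_insert_of_mem hi)⟩, h2 a (Finset.mem_insert_self _ _)⟩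
    · rw [Finset.card_insert_of_notMem ha, ← hcard, pow_succ]
      have : Module.finrank ℝ EA = Module.finrank ℝ (W (-1)) * 2 := by omega
      rw [this]; ring
end Perturb
end AdamsProof

namespace AdamsProof

section Alg2
variable {I : Type*} [Fintype I] [DecidableEq I] {R : Type*} [Ring R] [StarRing R] [Algebra ℝ R]
variable [StarModule ℝ R]

/-- Clifford couplings. -/
structure Sys.Cl {j : ℝ} (S : Sys I R j) (C : I → R) : Prop where
  cpl : S.Cpl C
  anti : ∀ i l, i ≠ l → C i * C l = -(C l * C i)
  sq : ∀ i, C i * C i = 1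

namespace Sys
variable {j : ℝ} {S : Sys I R j} {C : I → R}

theorem star_s (h : S.Cl C) (i : I) : star (C i * S.Γ i) = C i * S.Γ i := by
  rw [star_mul, S.sΓ, h.cpl.sG, smul_mul_assoc, h.cpl.ΓG, smul_smul, etasq, one_smul]

theorem s_sq (h : S.Cl C) (i : I) : (C i * S.Γ i) * (C i * S.Γ i) = 1 := by
  have e : (C i * S.Γ i) * (C i * S.Γ i) = C i * (S.Γ i * C i) * S.Γ i := by noncomm_ring
  rw [e, h.cpl.ΓG]
  have e : C i * S.η i • (C i * S.Γ i) * S.Γ i = S.η i • ((C i * C i) * (S.Γ i * S.Γ i)) := by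
    simp only [mul_smul_comm, smul_mul_assoc, mul_assoc]
  rw [e, h.sq, S.Γsq, one_mul, smul_smul, etasq, one_smul]

theorem s_comm (h : S.Cl C) (i l : I) :
    (C i * S.Γ i) * (C l * S.Γ l) = (C l * S.Γ l) * (C i * S.Γ i) := by
  by_cases hil : i = l
  · rw [hil]
  have key : ∀ i l, (C i * S.Γ i) * (C l * S.Γ l) = S.η i • (C i * C l * (S.Γ i * S.Γ l)) := by
    intro i l
    have e : (C i * S.Γ i) * (C l * S.Γ l) = C i * (S.Γ i * C l) * S.Γ l := by noncomm_ring
    rw [e, h.cpl.ΓG]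
    simp only [mul_smul_comm, smul_mul_assoc, mul_assoc]
  rw [key, key, h.anti i l hil, S.ΓΓ i l hil]
  simp only [mul_neg, neg_mul, neg_neg, mul_smul_comm, smul_neg, smul_smul]
  rw [← mul_assoc (S.η i), etasq, one_mul]

theorem s_z (h : S.Cl C) (i l : I) : (C i * S.Γ i) * S.z l = S.z l * (C i * S.Γ i) := by
  rw [mul_assoc, ← S.zΓ, ← mul_assoc, ← h.cpl.zG, mul_assoc]

theorem s_Pi (h : S.Cl C) (i : I) : (C i * S.Γ i) * S.Pi = S.Pi * (C i * S.Γ i) := by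
  rw [mul_assoc, ← S.PiΓ, ← mul_assoc, ← h.cpl.PiG, mul_assoc]

theorem D_sq' (h : S.Cl C) : S.D C * S.D C =
    ∑ i, ((j * (j + 1)) • (1 : R) - S.z i * S.z i + S.z i * (C i * S.Γ i)) := by
  rw [D_sq h.cpl, sq_sum_anti]
  · rw [← Finset.sum_add_distrib, ← Finset.sum_sub_distrib]
    refine Finset.sum_congr rfl fun i _ => ?_
    have e : S.x i * C i * (S.x i * C i) = S.x i * S.x i := by
      have : S.x i * C i * (S.x i * C i) = S.x i * (C i * S.x i) * C i := by noncomm_ring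
      rw [this, ← h.cpl.xG]
      have : S.x i * (S.x i * C i) * C i = S.x i * S.x i * (C i * C i) := by noncomm_ring
      rw [this, h.sq, mul_one]
    rw [e, ← S.cas i]
    noncomm_ring
  · intro i l hil
    have e : ∀ i l, S.x i * C i * (S.x l * C l) = S.x i * S.x l * (C i * C l) := by
      intro i l
      have : S.x i * C i * (S.x l * C l) = S.x i * (C i * S.x l) * C l := by noncomm_ring
      rw [this, ← h.cpl.xG]; noncomm_ring
    rw [e, e, h.anti i l hil, S.xx i l]; noncomm_ring

theorem XX_anti (i l : I) (h : i ≠ l) :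
    (S.x i * S.Γ i) * (S.x l * S.Γ l) + (S.x l * S.Γ l) * (S.x i * S.Γ i) = 0 := by
  have e1 : (S.x i * S.Γ i) * (S.x l * S.Γ l) = S.x i * (S.Γ i * S.x l) * S.Γ l := by noncomm_ring
  have e2 : (S.x l * S.Γ l) * (S.x i * S.Γ i) = S.x l * (S.Γ l * S.x i) * S.Γ i := by noncomm_ring
  have e3 : S.x l * S.x i * (S.Γ l * S.Γ i) = S.x i * S.x l * -((S.η l * S.η i) • (S.Γ i * S.Γ l)) := by
    rw [S.xx l i, S.ΓΓ l i h.symm]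
  rw [e1, e2, S.xΓ, S.xΓ]
  simp only [mul_neg, neg_mul, mul_smul_comm, smul_mul_assoc, ← mul_assoc] at e3 ⊢
  rw [e3]
  rcases S.hη i with h1 | h1 <;> rcases S.hη l with h2 | h2 <;> simp [h1, h2]

theorem XX_sq (i : I) : (S.x i * S.Γ i) * (S.x i * S.Γ i) = -(S.x i * S.x i) := by
  have e1 : (S.x i * S.Γ i) * (S.x i * S.Γ i) = S.x i * (S.Γ i * S.x i) * S.Γ i := by noncomm_ring
  rw [e1, S.xΓ]
  have e2 : S.x i * -(S.η i • (S.x i * S.Γ i)) * S.Γ i = -(S.η i • (S.x i * S.x i * (S.Γ i * S.Γ i))) := by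
    simp only [mul_neg, neg_mul, mul_smul_comm, smul_mul_assoc, ← mul_assoc]
  rw [e2, S.Γsq, mul_smul_comm, smul_smul, etasq, one_smul, mul_one]

theorem D'_sq (h : S.Cl C) :
    (∑ i, (S.p i * C i + S.x i * S.Γ i)) * (∑ i, (S.p i * C i + S.x i * S.Γ i)) =
      -(S.D C * S.D C) := by
  have ec : ∀ i l, S.p i * C i * (S.p l * C l) = S.p i * S.p l * (C i * C l) := by
    intro i l
    have : S.p i * C i * (S.p l * C l) = S.p i * (C i * S.p l) * C l := by noncomm_ring
    rw [this, ← h.cpl.pG]; noncomm_ring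
  have eX : ∀ i l, S.p i * C i * (S.x l * S.Γ l) + S.x l * S.Γ l * (S.p i * C i) =
      (S.p i * S.x l - S.x l * S.p i) * (C i * S.Γ l) := by
    intro i l
    have e1 : S.Γ l * (S.p i * C i) = -(S.p i * C i * S.Γ l) := by
      rw [← mul_assoc, S.pΓ, neg_mul, smul_mul_assoc, mul_assoc, h.cpl.ΓG, mul_smul_comm, smul_smul,
        etasq, one_smul, mul_assoc]
    have e2 : S.p i * C i * (S.x l * S.Γ l) = S.p i * (C i * S.x l) * S.Γ l := by noncomm_ring
    rw [mul_assoc (S.x l), e1, e2, ← h.cpl.xG]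
    noncomm_ring
  rw [D_sq' h, sq_sum_anti, ← Finset.sum_neg_distrib]
  · refine Finset.sum_congr rfl fun i _ => ?_
    have e : (S.p i * C i + S.x i * S.Γ i) * (S.p i * C i + S.x i * S.Γ i) =
        S.p i * C i * (S.p i * C i) + (S.x i * S.Γ i) * (S.x i * S.Γ i) +
        (S.p i * C i * (S.x i * S.Γ i) + S.x i * S.Γ i * (S.p i * C i)) := by noncomm_ring
    have e2 : S.p i * S.x i - S.x i * S.p i = -S.z i := by rw [← S.xp' i]; noncomm_ring
    rw [e, ec, eX, XX_sq, h.sq, mul_one, e2, ← S.cas i]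
    noncomm_ring
  · intro i l hil
    have e : (S.p i * C i + S.x i * S.Γ i) * (S.p l * C l + S.x l * S.Γ l) +
       (S.p l * C l + S.x l * S.Γ l) * (S.p i * C i + S.x i * S.Γ i) =
       (S.p i * C i * (S.p l * C l) + S.p l * C l * (S.p i * C i)) +
       ((S.x i * S.Γ i) * (S.x l * S.Γ l) + (S.x l * S.Γ l) * (S.x i * S.Γ i)) +
       (S.p i * C i * (S.x l * S.Γ l) + S.x l * S.Γ l * (S.p i * C i)) +
       (S.p l * C l * (S.x i * S.Γ i) + S.x i * S.Γ i * (S.p l * C l)) := by noncomm_ring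
    rw [e, eX, eX, XX_anti i l hil, ec, ec, h.anti i l hil, S.pp i l, S.xp i l hil,
      S.xp l i (Ne.symm hil)]
    noncomm_ring

theorem Pi_D' (hC : S.Cpl C) : S.Pi * (S.D C * S.lam - S.lam * S.D C) =
    -((S.D C * S.lam - S.lam * S.D C) * S.Pi) := by
  rw [mul_sub, ← mul_assoc, ← mul_assoc, Pi_D hC, Pi_lam, neg_mul, mul_assoc, Pi_lam,
    mul_assoc S.lam, Pi_D hC]
  noncomm_ring

theorem Y_sq (h : S.Cl C) : ((S.D C * S.lam - S.lam * S.D C) * S.Pi) *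
    ((S.D C * S.lam - S.lam * S.D C) * S.Pi) = S.D C * S.D C := by
  have h1 := Pi_D' h.cpl
  have h2 := D'_sq h
  rw [← D_lam h.cpl] at h2
  set D' := S.D C * S.lam - S.lam * S.D C
  have e : D' * S.Pi * (D' * S.Pi) = D' * (S.Pi * D') * S.Pi := by noncomm_ring
  rw [e, h1]
  have e : D' * -(D' * S.Pi) * S.Pi = -((D' * D') * (S.Pi * S.Pi)) := by noncomm_ring
  rw [e, h2, S.PiPi, mul_one, neg_neg]

theorem star_Y (h : S.Cpl C) : star ((S.D C * S.lam - S.lam * S.D C) * S.Pi) =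
    (S.D C * S.lam - S.lam * S.D C) * S.Pi := by
  have h1 := Pi_D' h
  rw [star_mul, S.sPi, star_sub, star_mul, star_mul, star_D h, star_lam]
  rw [mul_sub] at h1 ⊢
  rw [← neg_eq_iff_eq_neg] at h1
  rw [← h1]
  noncomm_ring

theorem s_lam (h : S.Cl C) (i : I) : (C i * S.Γ i) * S.lam = S.lam * (C i * S.Γ i) := by
  unfold lam
  rw [mul_sub, sub_mul (∑ i, S.z i), Finset.mul_sum, Finset.sum_mul]
  congr 1
  · exact Finset.sum_congr rfl fun l _ => s_z h i l
  · simp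

end Sys
end Alg2
end AdamsProof

namespace AdamsProof

section Spec
variable {E : Type*} [NormedAddCommGroup E] [InnerProductSpace ℝ E] [FiniteDimensional ℝ E]
variable {I : Type*} [Fintype I] [DecidableEq I]

theorem app {P Q : E →L[ℝ] E} (h : P = Q) (f : E) : P f = Q f := by rw [h]

namespace Sys
variable {J : ℕ} {S : Sys I (E →L[ℝ] E) (J : ℝ)} {C : I → E →L[ℝ] E}

/-- The eigenvalues of all the `z i` are integers in `[-J, J]`. -/
def IntSpec (S : Sys I (E →L[ℝ] E) (J : ℝ)) : Prop :=
  ∀ i (χ : ℝ) f, f ≠ 0 → S.z i f = χ • f → ∃ w : ℤ, χ = w ∧ -(J : ℤ) ≤ w ∧ w ≤ J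

/-- The joint family. -/
def zs (S : Sys I (E →L[ℝ] E) (J : ℝ)) (C : I → E →L[ℝ] E) : I ⊕ I → E →L[ℝ] E :=
  Sum.elim S.z (fun i => C i * S.Γ i)

theorem joint (h : S.Cl C) (hIS : S.IntSpec) (hJ : 2 ≤ J) (M : E →L[ℝ] E)
    (hMz : ∀ i, M * S.z i = S.z i * M) (hMs : ∀ i, M * (C i * S.Γ i) = (C i * S.Γ i) * M)
    (hpos : ∀ (w : I → ℝ) (v : E), (∀ i, S.z i (C i (S.Γ i v)) = w i • v) →
      (∀ i, w i = -J ∨ (-J + 1 ≤ w i ∧ w i ≤ J)) →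
      (S.D C * S.D C) v = (∑ i, (J + w i) * (J + 1 - w i)) • v → 0 ≤ ⟪M v, v⟫) (f : E) :
    0 ≤ ⟪M f, f⟫ := by
  refine joint_nonneg (zs S C) ?_ ?_ M ?_ ?_ f
  · rintro (i | i)
    · exact symm_of_star (S.sz i)
    · exact symm_of_star (star_s h i)
  · rintro (i | i) (l | l)
    · exact S.zz i l
    · exact (s_z h l i).symm
    · exact s_z h i l
    · exact s_comm h i l
  · rintro (i | i)
    · exact hMz i
    · exact hMs i
  · intro χ v hv
    by_cases h0 : v = 0
    · simp [h0]
    have hz : ∀ i, S.z i v = χ (Sum.inl i) • v := fun i => hv (Sum.inl i)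
    have hs : ∀ i, (C i * S.Γ i) v = χ (Sum.inr i) • v := fun i => hv (Sum.inr i)
    have hs2 : ∀ i, χ (Sum.inr i) * χ (Sum.inr i) = 1 := by
      intro i
      have := app (s_sq h i) v
      rw [mul_apply_eq_comp, hs, map_smul, hs, smul_smul, one_apply_eq_self] at this
      have h2 : (χ (Sum.inr i) * χ (Sum.inr i) - 1) • v = 0 := by
        rw [sub_smul, this, one_smul, sub_self]
      linarith [(smul_eq_zero.mp h2).resolve_right h0]
    have hzs : ∀ i, S.z i (C i (S.Γ i v)) = (χ (Sum.inl i) * χ (Sum.inr i)) • v := by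
      intro i
      rw [← mul_apply_eq_comp (C i), hs, map_smul, hz, smul_smul, mul_comm]
    refine hpos (fun i => χ (Sum.inl i) * χ (Sum.inr i)) v hzs ?_ ?_
    · intro i
      obtain ⟨w, hw, h1, h2⟩ := hIS i (χ (Sum.inl i)) v h0 (hz i)
      have hσ : χ (Sum.inr i) = 1 ∨ χ (Sum.inr i) = -1 := mul_self_eq_one_iff.mp (hs2 i)
      have key : ∀ u : ℤ, -(J:ℤ) ≤ u → u ≤ J → ((u : ℝ) = -J ∨ (-(J:ℝ) + 1 ≤ u ∧ (u:ℝ) ≤ J)) := by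
        intro u h1 h2
        rcases eq_or_lt_of_le h1 with h3 | h3
        · left; rw [← h3]; push_cast; rfl
        · right
          constructor
          · exact_mod_cast h3
          · exact_mod_cast h2
      rcases hσ with hσ | hσ
      · simp only [hσ, mul_one, hw]; exact key w h1 h2
      · simp only [hσ, hw]
        have := key (-w) (by omega) (by omega)
        push_cast at this
        simpa using this
    · rw [D_sq' h, clm_sum_apply, Finset.sum_smul]
      refine Finset.sum_congr rfl fun i _ => ?_
      rw [add_apply, sub_apply, smul_apply, one_apply_eq_self, mul_apply_eq_comp, mul_apply_eq_comp,
        mul_apply_eq_comp, hzs, hz, map_smul, hz, smul_smul, ← sub_smul, ← add_smul]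
      congr 1
      linear_combination (χ (Sum.inl i))^2 * (hs2 i)

theorem D2_z (h : S.Cl C) (i : I) : (S.D C * S.D C) * S.z i = S.z i * (S.D C * S.D C) := by
  rw [D_sq' h, Finset.mul_sum, Finset.sum_mul]
  refine Finset.sum_congr rfl fun l _ => ?_
  have e1 : S.z l * S.z l * S.z i = S.z i * (S.z l * S.z l) := by
    rw [mul_assoc, S.zz l i, ← mul_assoc, S.zz l i, mul_assoc]
  have e2 : S.z l * (C l * S.Γ l) * S.z i = S.z i * (S.z l * (C l * S.Γ l)) := by
    rw [mul_assoc, s_z h, ← mul_assoc, S.zz l i, mul_assoc]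
  simp only [add_mul, sub_mul, e1, e2, mul_add, mul_sub, smul_mul_assoc, mul_smul_comm, one_mul, mul_one]

theorem D2_s (h : S.Cl C) (i : I) :
    (S.D C * S.D C) * (C i * S.Γ i) = (C i * S.Γ i) * (S.D C * S.D C) := by
  rw [D_sq' h, Finset.mul_sum, Finset.sum_mul]
  refine Finset.sum_congr rfl fun l _ => ?_
  have e1 : S.z l * S.z l * (C i * S.Γ i) = (C i * S.Γ i) * (S.z l * S.z l) := by
    rw [mul_assoc, ← s_z h, ← mul_assoc, ← s_z h, mul_assoc]
  have e2 : S.z l * (C l * S.Γ l) * (C i * S.Γ i) = (C i * S.Γ i) * (S.z l * (C l * S.Γ l)) := by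
    rw [mul_assoc, s_comm h, ← mul_assoc, ← s_z h, mul_assoc]
  simp only [add_mul, sub_mul, e1, e2, mul_add, mul_sub, smul_mul_assoc, mul_smul_comm, one_mul, mul_one]

theorem term_nonneg (hJ : 2 ≤ J) {w : ℝ} (hw : w = -J ∨ (-J + 1 ≤ w ∧ w ≤ J)) :
    0 ≤ (J + w) * (J + 1 - w) ∧ ((J + w) * (J + 1 - w) = 0 ∨ 4 ≤ (J + w) * (J + 1 - w)) ∧
    (1 / (2 * J : ℝ)) * (w + J) ^ 2 ≤ (J + w) * (J + 1 - w) := by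
  have hJ' : (2:ℝ) ≤ J := by exact_mod_cast hJ
  rcases hw with hw | ⟨h1, h2⟩
  · subst hw; simp
  · have h3 : 4 ≤ (J + w) * (J + 1 - w) := by
      nlinarith [mul_nonneg (by linarith : 0 ≤ J + w - 1) (by linarith : 0 ≤ J - w)]
    refine ⟨by linarith, Or.inr h3, ?_⟩
    rw [one_div, inv_mul_le_iff₀ (by linarith)]
    have : (w + J) ≤ 2 * J * (J + 1 - w) := by nlinarith
    nlinarith [mul_le_mul_of_nonneg_left this (by linarith : 0 ≤ J + w)]

theorem D2_gap (h : S.Cl C) (hIS : S.IntSpec) (hJ : 2 ≤ J) (f : E) :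
    4 * ⟪(S.D C * S.D C) f, f⟫ ≤ ⟪(S.D C * S.D C) ((S.D C * S.D C) f), f⟫ := by
  have := joint h hIS hJ ((S.D C * S.D C) * (S.D C * S.D C) - (4:ℝ) • (S.D C * S.D C)) ?_ ?_ ?_ f
  · rw [sub_apply, inner_sub_left, smul_apply, inner_smul_left, mul_apply_eq_comp (S.D C * S.D C)] at this
    simp only [conj_trivial] at this
    linarith
  · intro i
    rw [sub_mul, mul_sub, smul_mul_assoc, mul_smul_comm, D2_z h, mul_assoc, D2_z h, ← mul_assoc, D2_z h,
      mul_assoc]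
  · intro i
    rw [sub_mul, mul_sub, smul_mul_assoc, mul_smul_comm, D2_s h, mul_assoc, D2_s h, ← mul_assoc, D2_s h,
      mul_assoc]
  · intro w v _ hw hv
    rw [sub_apply, inner_sub_left, smul_apply, inner_smul_left, mul_apply_eq_comp (S.D C * S.D C), hv,
      map_smul, hv, smul_smul, inner_smul_left, inner_smul_left, real_inner_self_eq_norm_sq]
    simp only [conj_trivial]
    set a := ∑ i, (J + w i) * (J + 1 - w i) with ha
    have : a = 0 ∨ 4 ≤ a := by
      by_cases hall : ∀ i, (J + w i) * (J + 1 - w i) = 0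
      · left; rw [ha]; exact Finset.sum_eq_zero fun i _ => hall i
      · push Not at hall
        obtain ⟨i, hi⟩ := hall
        right
        have h4 := (term_nonneg hJ (hw i)).2.1.resolve_left hi
        refine h4.trans ?_
        exact Finset.single_le_sum (f := fun i => (J + w i) * (J + 1 - w i))
          (fun l _ => (term_nonneg hJ (hw l)).1) (Finset.mem_univ i)
    rcases this with h | h
    · simp [h]
    · nlinarith [sq_nonneg ‖v‖, mul_nonneg (mul_nonneg (by linarith : 0 ≤ a) (by linarith : 0 ≤ a - 4))
        (sq_nonneg ‖v‖)]

theorem sqrt_gap (h : S.Cl C) (hIS : S.IntSpec) (hJ : 2 ≤ J) {T : E →L[ℝ] E}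
    (hT : T * T = S.D C * S.D C) (μ : ℝ) (f : E) (hf : f ≠ 0) (hμ : T f = μ • f) :
    μ = 0 ∨ 4 ≤ μ ^ 2 := by
  have h1 := D2_gap h hIS hJ f
  have h2 : (S.D C * S.D C) f = (μ ^ 2) • f := by
    rw [← hT, mul_apply_eq_comp, hμ, map_smul, hμ, smul_smul, sq]
  rw [h2, map_smul, h2, smul_smul, inner_smul_left, inner_smul_left, real_inner_self_eq_norm_sq] at h1
  simp only [conj_trivial] at h1
  by_cases h0 : μ = 0
  · exact Or.inl h0
  right
  have hfp : 0 < ‖f‖ ^ 2 := by positivity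
  have hm : 0 < μ ^ 2 := by positivity
  by_contra hlt
  push Not at hlt
  nlinarith [mul_pos (mul_pos hm (sub_pos.mpr hlt)) hfp]

theorem ker_D (h : S.Cl C) (hIS : S.IntSpec) (hJ : 2 ≤ J) (f : E) :
    S.D C f = 0 ↔ ∀ i, S.z i ((C i * S.Γ i) f) = -(J : ℝ) • f := by
  have hJ' : (2:ℝ) ≤ J := by exact_mod_cast hJ
  constructor
  · intro hf i
    set B := S.z i * (C i * S.Γ i) + (J:ℝ) • (1 : E →L[ℝ] E) with hB
    have sB : star B = B := by
      rw [hB, star_add, star_mul, star_s h, S.sz, s_z h]; simp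
    have hBz : ∀ l, B * S.z l = S.z l * B := by
      intro l
      rw [hB, add_mul, mul_add, mul_assoc, s_z h, ← mul_assoc, S.zz i l, mul_assoc]; simp
    have hBs : ∀ l, B * (C l * S.Γ l) = (C l * S.Γ l) * B := by
      intro l
      rw [hB, add_mul, mul_add, mul_assoc, s_comm h, ← mul_assoc, ← s_z h, mul_assoc]; simp
    have := joint h hIS hJ ((S.D C * S.D C) - (1 / (2 * J : ℝ)) • (B * B)) ?_ ?_ ?_ f
    · rw [sub_apply, mul_apply_eq_comp, hf, map_zero, zero_sub, inner_neg_left, smul_apply,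
        inner_smul_left, inner_sq sB] at this
      simp only [conj_trivial] at this
      have h1 : 0 < 1 / (2 * J : ℝ) := by positivity
      have h2 : ‖B f‖ ^ 2 ≤ 0 := by
        by_contra hlt
        push Not at hlt
        nlinarith [mul_pos h1 hlt]
      have h3 : B f = 0 := by
        have : ‖B f‖ ^ 2 = 0 := le_antisymm h2 (sq_nonneg _)
        simpa using this
      rw [hB, add_apply, smul_apply, one_apply_eq_self, mul_apply_eq_comp] at h3
      rw [neg_smul]; exact eq_neg_of_add_eq_zero_left h3
    · intro l
      exact (show Commute _ _ from D2_z h l).sub_left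
        (((show Commute _ _ from hBz l).mul_left (hBz l)).smul_left _)
    · intro l
      exact (show Commute _ _ from D2_s h l).sub_left
        (((show Commute _ _ from hBs l).mul_left (hBs l)).smul_left _)
    · intro w v hzs hw hv
      have hBv : B v = (w i + J) • v := by
        rw [hB, add_apply, smul_apply, one_apply_eq_self, mul_apply_eq_comp, mul_apply_eq_comp, hzs,
          add_smul]
      rw [sub_apply, hv, smul_apply, mul_apply_eq_comp, hBv, map_smul, hBv, smul_smul, smul_smul,
        inner_sub_left, inner_smul_left, inner_smul_left, real_inner_self_eq_norm_sq]
      simp only [conj_trivial]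
      rw [← sub_mul]
      refine mul_nonneg ?_ (sq_nonneg _)
      have h1 := (term_nonneg hJ (hw i)).2.2
      have h2 := Finset.single_le_sum (f := fun i => (J + w i) * (J + 1 - w i))
          (fun l _ => (term_nonneg hJ (hw l)).1) (Finset.mem_univ i)
      nlinarith
  · intro hf
    have h2 : ∀ i, S.z i (S.z i f) = ((J:ℝ) ^ 2) • f := by
      intro i
      have e : S.z i (S.z i f) = S.z i ((C i * S.Γ i) (S.z i ((C i * S.Γ i) f))) := by
        have : S.z i * S.z i = S.z i * (C i * S.Γ i) * (S.z i * (C i * S.Γ i)) := by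
          have h5 := s_z h i i
          have h6 := s_sq h i
          set s := C i * S.Γ i
          rw [← h5]
          have e1 : s * S.z i * (s * S.z i) = s * (S.z i * s) * S.z i := by noncomm_ring
          have e2 : s * (s * S.z i) * S.z i = s * s * (S.z i * S.z i) := by noncomm_ring
          rw [e1, ← h5, e2, h6, one_mul]
        exact app this f
      rw [e, hf, map_smul, map_smul, hf, smul_smul]; congr 1; ring
    have h3 : (S.D C * S.D C) f = 0 := by
      rw [D_sq' h, clm_sum_apply]
      refine Finset.sum_eq_zero fun i _ => ?_
      rw [add_apply, sub_apply, smul_apply, one_apply_eq_self, mul_apply_eq_comp, mul_apply_eq_comp,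
        hf, h2, ← sub_smul, ← add_smul]
      have : (J * (J + 1) - (J:ℝ) ^ 2 + -J) = 0 := by ring
      rw [this, zero_smul]
    have h4 := inner_sq (star_D h.cpl) f
    rw [h3, inner_zero_left] at h4
    simpa using h4.symm

theorem Dt_ker (h : S.Cl C) (hIS : S.IntSpec) (hJ : 2 ≤ J) (t : ℝ) (ht : 0 < t) (ht1 : t ≤ 1) (f : E)
    (hf : (S.D C + t • (S.lam * S.Pi)) f = 0) : S.D C f = 0 ∧ S.lam f = 0 := by
  have e := Lt_sq h.cpl t
  have hY := Y_sq h
  have sY := star_Y h.cpl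
  set Y := (S.D C * S.lam - S.lam * S.D C) * S.Pi with hYd
  have e0 := congrArg (fun A : E →L[ℝ] E => ⟪A f, f⟫) e
  simp only [mul_apply_eq_comp (S.D C + t • (S.lam * S.Pi)), hf, map_zero, inner_zero_left, add_apply,
    inner_add_left, smul_apply, inner_smul_left, conj_trivial, inner_sq (star_D h.cpl),
    inner_sq (star_lam (S := S))] at e0
  have key := joint_nonneg (fun _ : Unit => Y) (fun _ => symm_of_star sY) (fun _ _ => rfl)
    ((1 / 2 : ℝ) • (Y * Y) + t • Y) (by
      intro _; rw [add_mul, mul_add, smul_mul_assoc, mul_smul_comm, smul_mul_assoc, mul_smul_comm,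
        mul_assoc]) (by
      intro χ v hv
      have hv := hv ()
      by_cases h0 : v = 0
      · simp [h0]
      rw [add_apply, smul_apply, smul_apply, mul_apply_eq_comp, hv, map_smul, hv, smul_smul, smul_smul,
        smul_smul, ← add_smul, inner_smul_left, real_inner_self_eq_norm_sq]
      simp only [conj_trivial]
      refine mul_nonneg ?_ (sq_nonneg _)
      rcases sqrt_gap h hIS hJ hY _ v h0 hv with h1 | h1
      · simp [h1]
      · nlinarith [sq_nonneg (χ () + 2 * t), sq_nonneg (χ ())]) f
  rw [add_apply, smul_apply, smul_apply, hY, inner_add_left, inner_smul_left, inner_smul_left,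
    inner_sq (star_D h.cpl)] at key
  simp only [conj_trivial] at key
  have h1 : 1 / 2 * ‖S.D C f‖ ^ 2 + t * t * ‖S.lam f‖ ^ 2 ≤ 0 := by linarith
  have h2 := sq_nonneg ‖S.D C f‖
  have h3 := sq_nonneg ‖S.lam f‖
  have ht2 : 0 < t * t := by positivity
  have h4 := mul_nonneg ht2.le h3
  constructor
  · have : ‖S.D C f‖ ^ 2 = 0 := by linarith
    simpa using this
  · have : t * t * ‖S.lam f‖ ^ 2 = 0 := by linarith
    have := (mul_eq_zero.mp this).resolve_left ht2.ne'
    simpa using this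

end Sys
end Spec
end AdamsProof

namespace AdamsProof

section Model
variable {E : Type*} [NormedAddCommGroup E] [InnerProductSpace ℝ E] [FiniteDimensional ℝ E]
variable {I : Type*} [Fintype I] [DecidableEq I]

namespace Sys
variable {J : ℕ} {S : Sys I (E →L[ℝ] E) (J : ℝ)} {C : I → E →L[ℝ] E}

/-- Index of the exactly solvable model. -/
theorem model_index (h : S.Cl C) (hIS : S.IntSpec) (hJ : 2 ≤ J) (Q : E →L[ℝ] E)
    (hQQ : Q * Q = Q) (hQz : ∀ i, Q * S.z i = S.z i * Q)
    (hQs : ∀ i, Q * (C i * S.Γ i) = (C i * S.Γ i) * Q) (hzQ : ∀ i, S.z i * Q = (J:ℝ) • Q)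
    (hcorner : ∀ f, (∀ i, S.z i (S.z i f) = ((J:ℝ) ^ 2) • f) → S.Pi f = f)
    (hrest : ∀ f, (∀ i, S.z i (S.z i f) = ((J:ℝ) ^ 2) • f) → Q f = 0 →
      ⟪S.lam f, f⟫ ≤ -(J:ℝ) * ‖f‖ ^ 2)
    (τ : I → E →L[ℝ] E) (hτ : ∀ i, τ i * τ i = 1)
    (hτs : ∀ i, τ i * (C i * S.Γ i) = -((C i * S.Γ i) * τ i))
    (hτs' : ∀ i l, i ≠ l → τ i * (C l * S.Γ l) = (C l * S.Γ l) * τ i)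
    (hτQ : ∀ i, τ i * Q = Q * τ i) {m₀ : ℕ} (h0 : HasPos (-(J:ℝ) • S.Pi) m₀) :
    ∃ a : ℕ, HasPos (S.L C) (m₀ + a) ∧ a * 2 ^ Fintype.card I =
      Module.finrank ℝ (LinearMap.range (Q : E →ₗ[ℝ] E)) := by
  have hJ' : (2:ℝ) ≤ J := by exact_mod_cast hJ
  have hkz : ∀ f, S.D C f = 0 → ∀ i, S.z i (S.z i f) = ((J:ℝ) ^ 2) • f := by
    intro f hf i
    have hf := (ker_D h hIS hJ f).mp hf i
    have h5 := s_z h i i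
    have h6 := s_sq h i
    set s := C i * S.Γ i
    have e : S.z i * S.z i = S.z i * s * (S.z i * s) := by
      have e1 : s * S.z i * (s * S.z i) = s * (S.z i * s) * S.z i := by noncomm_ring
      have e2 : s * (s * S.z i) * S.z i = s * s * (S.z i * S.z i) := by noncomm_ring
      rw [← h5, e1, ← h5, e2, h6, one_mul]
    have := app e f
    simp only [mul_apply_eq_comp] at this hf
    rw [this, hf, map_smul, map_smul, hf, smul_smul]
    congr 1; ring
  have hkPi : ∀ f, S.D C f = 0 → S.Pi f = f := fun f hf => hcorner f (hkz f hf)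
  -- operators commuting with `z`, `s` preserve the kernel
  have hpres : ∀ T : E →L[ℝ] E, (∀ i, T * S.z i = S.z i * T) →
      (∀ i, T * (C i * S.Γ i) = (C i * S.Γ i) * T) → ∀ f, S.D C f = 0 → S.D C (T f) = 0 := by
    intro T h1 h2 f hf
    rw [ker_D h hIS hJ] at hf ⊢
    intro i
    have e : S.z i * (C i * S.Γ i) * T = T * (S.z i * (C i * S.Γ i)) := by
      rw [mul_assoc, ← h2, ← mul_assoc, ← h1, mul_assoc]
    have e := app e f
    have hf := hf i
    rw [← mul_apply_eq_comp] at hf ⊢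
    rw [mul_apply_eq_comp _ T, mul_apply_eq_comp T, hf, map_smul] at e
    exact e
  have sB : star (S.lam * S.Pi) = S.lam * S.Pi := by rw [star_mul, S.sPi, star_lam, Pi_lam]
  have sB2 : star (-(J:ℝ) • S.Pi) = -(J:ℝ) • S.Pi := by rw [star_smul, S.sPi]; simp
  have sD := star_D h.cpl
  have hgap : ∀ (μ : ℝ) (f : E), f ≠ 0 → S.D C f = μ • f → μ ≠ 0 → 1 ≤ |μ| := by
    intro μ f hf hμ h0
    have := (sqrt_gap h hIS hJ rfl μ f hf hμ).resolve_left h0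
    rw [← sq_abs] at this
    nlinarith [abs_nonneg μ]
  obtain ⟨m, hm⟩ := hasPos_perturb (S.D C) sD hgap
  set K := ‖S.lam * S.Pi‖ + ‖-(J:ℝ) • S.Pi‖ + 1 with hK
  have hK1 : 1 ≤ K := by rw [hK]; linarith [norm_nonneg (S.lam * S.Pi), norm_nonneg (-(J:ℝ) • S.Pi)]
  set t := 1 / K with htd
  have htK : t * K = 1 := by rw [htd]; field_simp
  have ht : 0 < t := by positivity
  have ht1 : t ≤ 1 := by rw [htd]; exact (div_le_one (by linarith)).mpr hK1
  have hb1 : t * ‖S.lam * S.Pi‖ < 1 := by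
    rw [← htK]; exact mul_lt_mul_of_pos_left (by linarith [norm_nonneg (-(J:ℝ) • S.Pi)]) ht
  have hb2 : t * ‖-(J:ℝ) • S.Pi‖ < 1 := by
    rw [← htK]; exact mul_lt_mul_of_pos_left (by linarith [norm_nonneg (S.lam * S.Pi)]) ht
  -- the reference model
  have r1 := hm (-(J:ℝ) • S.Pi) t ⊥ (LinearMap.ker (S.D C : E →ₗ[ℝ] E)) sB2 ht hb2 (by
      intro f hf
      rw [smul_apply, hkPi f hf, map_smul, hf, smul_zero]) (by
      intro f hf
      rw [Submodule.mem_bot] at hf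
      subst hf; simp) (by
      intro f hf
      have hf : S.D C f = 0 := hf
      refine ⟨hf, fun hne => ?_⟩
      rw [smul_apply, hkPi f hf, inner_smul_left, real_inner_self_eq_norm_sq]
      simp only [conj_trivial]
      have : 0 < ‖f‖ ^ 2 := by positivity
      nlinarith) (by simp)
  have r2 : HasPos (S.D C + t • (-(J:ℝ) • S.Pi)) m₀ := by
    refine HasPos.homotopy (symm_of_star sB2) (symm_of_star ?_) ?_ h0
    · rw [star_add, sD, star_smul, sB2]; simp
    · intro u hu0 hu1 f hf
      set w : ℝ := -(((1 - u) + u * t) * J) with hw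
      have hw0 : w ≠ 0 := by
        have : 0 < (1 - u) + u * t := by nlinarith
        rw [hw]; exact neg_ne_zero.mpr (mul_pos this (by linarith)).ne'
      have e1 : (1 - u) • (-(J:ℝ) • S.Pi) + u • (S.D C + t • (-(J:ℝ) • S.Pi)) =
          u • S.D C + w • S.Pi := by rw [hw]; module
      rw [e1] at hf
      have e2 : (u • S.D C + w • S.Pi) * (u • S.D C + w • S.Pi) =
          (u * u) • (S.D C * S.D C) + (w * w) • (1 : E →L[ℝ] E) := by
        have h1 := Pi_D h.cpl
        simp only [add_mul, mul_add, smul_mul_assoc, mul_smul_comm, h1, S.PiPi]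
        module
      have e3 := congrArg (fun A : E →L[ℝ] E => ⟪A f, f⟫) e2
      simp only [mul_apply_eq_comp (u • S.D C + w • S.Pi), hf, map_zero, inner_zero_left] at e3
      rw [add_apply, smul_apply, smul_apply, inner_add_left, inner_smul_left, inner_smul_left,
        inner_sq sD, one_apply_eq_self, real_inner_self_eq_norm_sq] at e3
      simp only [conj_trivial] at e3
      have h1 := mul_nonneg (mul_self_nonneg u) (sq_nonneg ‖S.D C f‖)
      have hww : 0 < w * w := mul_self_pos.mpr hw0
      have h2 := mul_nonneg hww.le (sq_nonneg ‖f‖)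
      have h3 : w * w * ‖f‖ ^ 2 = 0 := by linarith
      have := (mul_eq_zero.mp h3).resolve_left hww.ne'
      simpa using this
  have hmm : m = m₀ := by
    have := r1.unique r2
    simpa using this
  -- the two pieces of the kernel
  set N₁ : Submodule ℝ E := LinearMap.ker (S.D C : E →ₗ[ℝ] E) ⊓
    LinearMap.ker ((Q - 1 : E →L[ℝ] E) : E →ₗ[ℝ] E) with hN₁
  set N₂ : Submodule ℝ E := LinearMap.ker (S.D C : E →ₗ[ℝ] E) ⊓
    LinearMap.ker (Q : E →ₗ[ℝ] E) with hN₂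
  have mN₁ : ∀ f, f ∈ N₁ ↔ S.D C f = 0 ∧ Q f = f := by
    intro f; simp [hN₁, sub_eq_zero]
  have mN₂ : ∀ f, f ∈ N₂ ↔ S.D C f = 0 ∧ Q f = 0 := by
    intro f; simp [hN₂]
  have hzf : ∀ f, Q f = f → ∀ i, S.z i f = (J:ℝ) • f := by
    intro f hf i
    have := app (hzQ i) f
    rw [mul_apply_eq_comp, smul_apply, hf] at this
    exact this
  have hsum : Module.finrank ℝ N₁ + Module.finrank ℝ N₂ =
      Module.finrank ℝ (LinearMap.ker (S.D C : E →ₗ[ℝ] E)) := by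
    rw [← finrank_sup_of_disjoint]
    · have : N₁ ⊔ N₂ = LinearMap.ker (S.D C : E →ₗ[ℝ] E) := by
        apply le_antisymm
        · exact sup_le inf_le_left inf_le_left
        · intro f hf
          have hf : S.D C f = 0 := hf
          have e : f = Q f + (f - Q f) := by abel
          have hQf := hpres Q hQz hQs f hf
          have hQQf := app hQQ f
          rw [mul_apply_eq_comp] at hQQf
          rw [e]
          refine Submodule.add_mem_sup ?_ ?_
          · rw [mN₁]; exact ⟨hQf, hQQf⟩
          · rw [mN₂, map_sub, map_sub, hf, hQf, hQQf]; simp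
      rw [this]
    · intro f h1 h2
      rw [mN₁] at h1
      rw [mN₂] at h2
      rw [← h1.2, h2.2]
  have r3 := hm (S.lam * S.Pi) t N₁ N₂ sB ht hb1 (by
      refine hpres _ (fun i => ?_) (fun i => ?_)
      · rw [mul_assoc, S.Piz, ← mul_assoc, lam_z, mul_assoc]
      · rw [mul_assoc, ← s_Pi h, ← mul_assoc, ← s_lam h, mul_assoc]) (by
      intro f hf
      rw [mN₁] at hf
      refine ⟨hf.1, fun hne => ?_⟩
      rw [mul_apply_eq_comp, hkPi f hf.1, lam_apply f (fun _ => (J:ℝ)) (hzf f hf.2), inner_smul_left,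
        real_inner_self_eq_norm_sq]
      simp only [conj_trivial, Finset.sum_const, Finset.card_univ, nsmul_eq_mul]
      have : 0 < ‖f‖ ^ 2 := by positivity
      nlinarith) (by
      intro f hf
      rw [mN₂] at hf
      refine ⟨hf.1, fun hne => ?_⟩
      rw [mul_apply_eq_comp, hkPi f hf.1]
      have := hrest f (hkz f hf.1) hf.2
      have : 0 < ‖f‖ ^ 2 := by positivity
      nlinarith) hsum
  have r4 : HasPos (S.L C) (m₀ + Module.finrank ℝ N₁) := by
    rw [hmm] at r3
    refine HasPos.homotopy (symm_of_star ?_) (symm_of_star (star_L h.cpl)) ?_ r3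
    · rw [star_add, sD, star_smul, sB]; simp
    · intro u hu0 hu1 f hf
      have e1 : (1 - u) • (S.D C + t • (S.lam * S.Pi)) + u • S.L C =
          S.D C + ((1 - u) * t + u) • (S.lam * S.Pi) := by unfold L; module
      rw [e1] at hf
      obtain ⟨h1, h2⟩ := Dt_ker h hIS hJ _ (by nlinarith) (by nlinarith) f hf
      have hQl : Q * S.lam = S.lam * Q := by
        unfold lam
        rw [mul_sub, sub_mul (∑ i, S.z i), Finset.mul_sum, Finset.sum_mul]
        congr 1
        · exact Finset.sum_congr rfl fun l _ => hQz l
        · simp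
      have hQf : Q f = 0 := by
        have e2 := app hQl f
        have hQQf := app hQQ f
        rw [mul_apply_eq_comp] at hQQf
        rw [mul_apply_eq_comp, h2, map_zero, mul_apply_eq_comp,
          lam_apply (Q f) (fun _ => (J:ℝ)) (hzf (Q f) hQQf)] at e2
        simp only [Finset.sum_const, Finset.card_univ, nsmul_eq_mul] at e2
        refine (smul_eq_zero.mp e2.symm).resolve_left ?_
        have : ((Fintype.card I : ℝ) * J - ((Fintype.card I : ℝ) - 1) * J) = J := by ring
        rw [this]; linarith
      have h3 := hrest f (hkz f h1) hQf
      rw [h2, inner_zero_left] at h3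
      have h4 : ‖f‖ ^ 2 = 0 := by nlinarith [sq_nonneg ‖f‖]
      simpa using h4
  refine ⟨_, r4, ?_⟩
  have mR : ∀ f, f ∈ LinearMap.range (Q : E →ₗ[ℝ] E) ↔ Q f = f := by
    intro f
    constructor
    · rintro ⟨g, rfl⟩
      exact app hQQ g
    · intro hf; exact ⟨f, hf⟩
  obtain ⟨EA, hEA, hc⟩ := flip_count (LinearMap.range (Q : E →ₗ[ℝ] E)) (fun i => C i * S.Γ i) τ
    (s_sq h) hτ (s_comm h) hτs hτs' (by
      intro i f hf
      rw [mR] at hf ⊢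
      rw [← mul_apply_eq_comp Q, hQs, mul_apply_eq_comp _ Q, hf]) (by
      intro i f hf
      rw [mR] at hf ⊢
      rw [← mul_apply_eq_comp Q, ← hτQ, mul_apply_eq_comp, hf]) Finset.univ
  have : EA = N₁ := by
    ext f
    rw [hEA, mR, mN₁, ker_D h hIS hJ]
    constructor
    · rintro ⟨h1, h2⟩
      refine ⟨fun i => ?_, h1⟩
      rw [h2 i (Finset.mem_univ i), map_neg, hzf f h1, neg_smul]
    · rintro ⟨h1, h2⟩
      refine ⟨h2, fun i _ => ?_⟩
      have e := h1 i
      rw [← mul_apply_eq_comp (S.z i), ← s_z h, mul_apply_eq_comp _ (S.z i), hzf f h2, map_smul,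
        neg_smul, ← smul_neg] at e
      exact smul_right_injective E (by linarith : (J:ℝ) ≠ 0) e
  rw [← this, ← Finset.card_univ]
  exact hc

end Sys
end Model
end AdamsProof

namespace AdamsProof

section Build
variable {I : Type} [Fintype I] [DecidableEq I]
variable {R₁ : Type} [Ring R₁] [StarRing R₁] [Algebra ℝ R₁]
variable {R₀ : Type} [Ring R₀] [StarRing R₀] [Algebra ℝ R₀]
variable {R : Type} [Ring R] [StarRing R] [Algebra ℝ R]

/-- Spin operators on the sites `I`. -/
structure Spin (I : Type) (R : Type) [Ring R] [StarRing R] [Algebra ℝ R] (j : ℝ) where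
  x : I → R
  z : I → R
  p : I → R
  Pi : R
  sx : ∀ i, star (x i) = x i
  sz : ∀ i, star (z i) = z i
  sp : ∀ i, star (p i) = -p i
  sPi : star Pi = Pi
  xx : ∀ i l, x i * x l = x l * x i
  zz : ∀ i l, z i * z l = z l * z i
  pp : ∀ i l, p i * p l = p l * p i
  xz : ∀ i l, i ≠ l → x i * z l = z l * x i
  pz : ∀ i l, i ≠ l → p i * z l = z l * p i
  xp : ∀ i l, i ≠ l → x i * p l = p l * x i
  xz' : ∀ i, x i * z i - z i * x i = p i
  pz' : ∀ i, p i * z i - z i * p i = x i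
  xp' : ∀ i, x i * p i - p i * x i = z i
  cas : ∀ i, x i * x i + z i * z i - p i * p i = (j * (j + 1)) • (1 : R)
  PiPi : Pi * Pi = 1
  Piz : ∀ i, Pi * z i = z i * Pi
  Pix : ∀ i, Pi * x i = -(x i * Pi)
  Pip : ∀ i, Pi * p i = -(p i * Pi)

/-- Generators with signs. -/
structure Gen (I : Type) (R : Type) [Ring R] [StarRing R] [Algebra ℝ R] where
  γ : I → R
  η : I → ℝ
  hη : ∀ i, η i = 1 ∨ η i = -1
  sγ : ∀ i, star (γ i) = η i • γ i
  γγ : ∀ i l, i ≠ l → γ i * γ l = -((η i * η l) • (γ l * γ i))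
  γsq : ∀ i, γ i * γ i = η i • (1 : R)

open Classical in
/-- The parity factor attached to a sign. -/
noncomputable def Spin.tw {j : ℝ} (B : Spin I R₁ j) (η : ℝ) : R₁ := if η = 1 then B.Pi else 1

variable {j : ℝ} (B : Spin I R₁ j)

theorem tw_one : B.tw 1 = B.Pi := by simp [Spin.tw]
theorem tw_neg : B.tw (-1) = 1 := by
  have : ¬ ((-1 : ℝ) = 1) := by norm_num
  simp [Spin.tw, this]

theorem swap4 {a₁ b₁ a₂ b₂ : R} (h : b₁ * a₂ = a₂ * b₁) :
    (a₁ * b₁) * (a₂ * b₂) = (a₁ * a₂) * (b₁ * b₂) := by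
  rw [mul_assoc, ← mul_assoc b₁, h, mul_assoc, mul_assoc]

/-- The coupled system. -/
noncomputable def Spin.toSys (g : Gen I R₀) (a : R₁ →⋆ₐ[ℝ] R) (b : R₀ →⋆ₐ[ℝ] R)
    (hab : ∀ u v, a u * b v = b v * a u) : Sys I R j where
  x i := a (B.x i)
  z i := a (B.z i)
  p i := a (B.p i)
  Pi := a B.Pi
  Γ i := a (B.tw (g.η i)) * b (g.γ i)
  η := g.η
  sx i := by rw [← map_star, B.sx]
  sz i := by rw [← map_star, B.sz]
  sp i := by rw [← map_star, B.sp, map_neg]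
  sPi := by rw [← map_star, B.sPi]
  hη := g.hη
  sΓ i := by
    rw [star_mul, ← map_star, ← map_star, g.sγ, ← hab, map_smul, mul_smul_comm]
    rcases g.hη i with h | h <;> rw [h]
    · rw [tw_one, B.sPi]
    · rw [tw_neg, star_one]
  xx i l := by rw [← map_mul, B.xx, map_mul]
  zz i l := by rw [← map_mul, B.zz, map_mul]
  pp i l := by rw [← map_mul, B.pp, map_mul]
  xz i l h := by rw [← map_mul, B.xz i l h, map_mul]
  pz i l h := by rw [← map_mul, B.pz i l h, map_mul]
  xp i l h := by rw [← map_mul, B.xp i l h, map_mul]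
  xz' i := by rw [← map_mul, ← map_mul, ← map_sub, B.xz']
  pz' i := by rw [← map_mul, ← map_mul, ← map_sub, B.pz']
  xp' i := by rw [← map_mul, ← map_mul, ← map_sub, B.xp']
  cas i := by
    rw [← map_mul, ← map_mul, ← map_mul, ← map_add, ← map_sub, B.cas, map_smul, map_one]
  PiPi := by rw [← map_mul, B.PiPi, map_one]
  Piz i := by rw [← map_mul, B.Piz, map_mul]
  Pix i := by rw [← map_mul, B.Pix, map_neg, map_mul]
  Pip i := by rw [← map_mul, B.Pip, map_neg, map_mul]
  PiΓ i := by
    rw [mul_assoc, ← hab, ← mul_assoc, ← mul_assoc, ← map_mul, ← map_mul]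
    rcases g.hη i with h | h <;> rw [h]
    · rw [tw_one]
    · rw [tw_neg, one_mul, mul_one]
  zΓ i l := by
    rw [mul_assoc, ← hab, ← mul_assoc, ← mul_assoc, ← map_mul, ← map_mul]
    rcases g.hη l with h | h <;> rw [h]
    · rw [tw_one, B.Piz]
    · rw [tw_neg, one_mul, mul_one]
  xΓ i l := by
    rw [mul_assoc, ← hab, ← mul_assoc, ← mul_assoc, ← map_mul, ← map_mul]
    rcases g.hη l with h | h <;> rw [h]
    · rw [tw_one, B.Pix, map_neg, one_smul, neg_mul]
    · rw [tw_neg, one_mul, mul_one, neg_smul, one_smul, neg_neg]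
  pΓ i l := by
    rw [mul_assoc, ← hab, ← mul_assoc, ← mul_assoc, ← map_mul, ← map_mul]
    rcases g.hη l with h | h <;> rw [h]
    · rw [tw_one, B.Pip, map_neg, one_smul, neg_mul]
    · rw [tw_neg, one_mul, mul_one, neg_smul, one_smul, neg_neg]
  ΓΓ i l hil := by
    rw [swap4 (hab _ _).symm, swap4 (hab _ _).symm, ← map_mul, ← map_mul b, g.γγ i l hil, map_neg,
      map_smul, map_mul b, ← map_mul a, mul_neg, mul_smul_comm]
    have : B.tw (g.η i) * B.tw (g.η l) = B.tw (g.η l) * B.tw (g.η i) := by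
      rcases g.hη i with h | h <;> rcases g.hη l with h' | h' <;> rw [h, h']
      · rw [tw_neg, one_mul, mul_one]
      · rw [tw_neg, one_mul, mul_one]
    rw [this]
  Γsq i := by
    rw [swap4 (hab _ _).symm, ← map_mul, ← map_mul b, g.γsq, map_smul, map_one, mul_smul_comm, mul_one]
    have : B.tw (g.η i) * B.tw (g.η i) = 1 := by
      rcases g.hη i with h | h <;> rw [h]
      · rw [tw_one, B.PiPi]
      · rw [tw_neg, one_mul]
    rw [this, map_one]

theorem toSys_cpl (g : Gen I R₀) (a : R₁ →⋆ₐ[ℝ] R) (b : R₀ →⋆ₐ[ℝ] R)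
    (hab : ∀ u v, a u * b v = b v * a u) (G : I → R) (sG : ∀ i, star (G i) = G i)
    (haG : ∀ i u, a u * G i = G i * a u)
    (hbG : ∀ i l, b (g.γ l) * G i = g.η l • (G i * b (g.γ l))) :
    (B.toSys g a b hab).Cpl G where
  sG := sG
  xG i l := haG l _
  zG i l := haG l _
  pG i l := haG l _
  PiG i := haG i _
  ΓG i l := by
    show a _ * b _ * G i = g.η l • (G i * (a _ * b _))
    rw [mul_assoc, hbG, mul_smul_comm, ← mul_assoc, haG, mul_assoc]

end Build

section Sites
open Matrix
variable {I : Type} [Fintype I] [DecidableEq I] {r : Type} [Fintype r] [DecidableEq r]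

/-- One-site operators. -/
def site (i : I) (M : Matrix r r ℝ) : Matrix (I → r) (I → r) ℝ :=
  fun α β => if β = Function.update α i (β i) then M (α i) (β i) else 0

theorem site_mulVec (i : I) (M : Matrix r r ℝ) (f : (I → r) → ℝ) (α : I → r) :
    (site i M *ᵥ f) α = ∑ c, M (α i) c * f (Function.update α i c) := by
  unfold Matrix.mulVec dotProduct
  symm
  refine Finset.sum_of_injOn (fun c => Function.update α i c) ?_ ?_ ?_ ?_
  · intro c _ d _ h
    exact Function.update_injective α i h
  · intro c _; simp
  · intro β _ hβ
    have : ¬ β = Function.update α i (β i) := by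
      intro h
      apply hβ
      exact ⟨β i, by simp, h.symm⟩
    simp [site, this]
  · intro c _
    simp [site]

theorem mat_ext {X : Type} [Fintype X] [DecidableEq X] {A B : Matrix X X ℝ}
    (h : ∀ f, A *ᵥ f = B *ᵥ f) : A = B :=
  Matrix.mulVec_injective (funext h)

theorem site_mul (i : I) (M N : Matrix r r ℝ) : site i (M * N) = site i M * site i N := by
  refine mat_ext fun f => funext fun α => ?_
  rw [← Matrix.mulVec_mulVec, site_mulVec, site_mulVec]
  simp only [site_mulVec, Function.update_self, Function.update_idem, Matrix.mul_apply, Finset.sum_mul,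
    Finset.mul_sum, mul_assoc]
  rw [Finset.sum_comm]

theorem site_comm (i l : I) (h : i ≠ l) (M N : Matrix r r ℝ) :
    site i M * site l N = site l N * site i M := by
  refine mat_ext fun f => funext fun α => ?_
  rw [← Matrix.mulVec_mulVec, ← Matrix.mulVec_mulVec, site_mulVec, site_mulVec]
  simp only [site_mulVec, Function.update_of_ne h, Function.update_of_ne h.symm, Finset.mul_sum]
  rw [Finset.sum_comm]
  refine Finset.sum_congr rfl fun c _ => Finset.sum_congr rfl fun d _ => ?_
  rw [Function.update_comm h]; ring

theorem site_add (i : I) (M N : Matrix r r ℝ) : site i (M + N) = site i M + site i N := by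
  ext α β; simp only [site, Matrix.add_apply]; split_ifs <;> simp
theorem site_sub (i : I) (M N : Matrix r r ℝ) : site i (M - N) = site i M - site i N := by
  ext α β; simp only [site, Matrix.sub_apply]; split_ifs <;> simp
theorem site_neg (i : I) (M : Matrix r r ℝ) : site i (-M) = -site i M := by
  ext α β; simp only [site, Matrix.neg_apply]; split_ifs <;> simp
theorem site_smul (i : I) (c : ℝ) (M : Matrix r r ℝ) : site i (c • M) = c • site i M := by
  ext α β; simp only [site, Matrix.smul_apply]; split_ifs <;> simp
theorem site_transpose (i : I) (M : Matrix r r ℝ) : (site i M)ᵀ = site i Mᵀ := by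
  ext α β
  simp only [site, Matrix.transpose_apply]
  have : α = Function.update β i (α i) ↔ β = Function.update α i (β i) := by
    constructor <;> intro h <;> (rw [h]; simp)
  simp only [this]
theorem site_diagonal (i : I) (d : r → ℝ) :
    site i (Matrix.diagonal d) = Matrix.diagonal (fun α : I → r => d (α i)) := by
  ext α β
  simp only [site, Matrix.diagonal_apply]
  by_cases h : α = β
  · subst h; simp
  · rw [if_neg h]
    split_ifs with h1 h2
    · exfalso; apply h; rw [h1, ← h2]; simp
    · rfl
    · rfl
theorem site_one (i : I) : site i (1 : Matrix r r ℝ) = 1 := by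
  rw [← Matrix.diagonal_one, site_diagonal]; rfl

end Sites
end AdamsProof

namespace AdamsProof

section OneSite
open Matrix
variable (J : ℕ)

/-- The raising operator of the spin `J` representation. -/
noncomputable def rai : Matrix (Fin (2 * J + 1)) (Fin (2 * J + 1)) ℝ :=
  fun b a => if (b : ℕ) = a + 1 then Real.sqrt ((2 * J - a) * (a + 1)) else 0

noncomputable def zm : Matrix (Fin (2 * J + 1)) (Fin (2 * J + 1)) ℝ :=
  Matrix.diagonal fun a => (J : ℝ) - a

noncomputable def par : Matrix (Fin (2 * J + 1)) (Fin (2 * J + 1)) ℝ :=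
  Matrix.diagonal fun a => (-1 : ℝ) ^ (a : ℕ)

theorem rai_z : rai J * zm J - zm J * rai J = rai J := by
  ext b a
  simp only [zm, Matrix.sub_apply, Matrix.mul_diagonal, Matrix.diagonal_mul, rai]
  split_ifs with h
  · rw [h]; push_cast; ring
  · simp

theorem par_rai : par J * rai J = -(rai J * par J) := by
  ext b a
  simp only [par, Matrix.neg_apply, Matrix.mul_diagonal, Matrix.diagonal_mul, rai]
  split_ifs with h
  · rw [h]; ring
  · simp

theorem par_par : par J * par J = 1 := by
  rw [par, Matrix.diagonal_mul_diagonal, ← Matrix.diagonal_one]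
  congr 1; ext a
  rw [← mul_pow]; simp

theorem rai_tr : (rai J)ᵀ * rai J = Matrix.diagonal fun a : Fin (2 * J + 1) => ((2 * J - (a : ℕ)) * ((a : ℕ) + 1) : ℝ) := by
  ext a a'
  rw [Matrix.mul_apply, Matrix.diagonal_apply]
  simp only [Matrix.transpose_apply, rai]
  have hle : ∀ a : Fin (2 * J + 1), (0:ℝ) ≤ (2 * J - a) * (a + 1) := by
    intro a
    have : ((a : ℕ) : ℝ) ≤ 2 * J := by exact_mod_cast Nat.lt_succ_iff.mp a.2
    have h2 : (0:ℝ) ≤ ((a:ℕ):ℝ) := Nat.cast_nonneg _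
    nlinarith
  split_ifs with h
  · subst h
    by_cases hlt : (a : ℕ) + 1 < 2 * J + 1
    · rw [Finset.sum_eq_single ⟨a + 1, hlt⟩]
      · simp [Real.mul_self_sqrt (hle a)]
      · intro b _ hb
        have : ¬ ((b : ℕ) = a + 1) := fun h => hb (Fin.ext h)
        simp [this]
      · simp
    · rw [Finset.sum_eq_zero]
      · have : (a : ℕ) = 2 * J := by omega
        rw [this]; push_cast; ring
      · intro b _
        have : ¬ ((b : ℕ) = a + 1) := by omega
        simp [this]
  · refine Finset.sum_eq_zero fun b _ => ?_
    by_cases h1 : (b : ℕ) = a + 1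
    · have : ¬ ((b : ℕ) = a' + 1) := fun h2 => h (Fin.ext (by omega))
      simp [this]
    · simp [h1]

theorem tr_rai : rai J * (rai J)ᵀ = Matrix.diagonal fun a : Fin (2 * J + 1) => ((2 * J + 1 - (a : ℕ)) * (a : ℕ) : ℝ) := by
  ext a a'
  rw [Matrix.mul_apply, Matrix.diagonal_apply]
  simp only [Matrix.transpose_apply, rai]
  split_ifs with h
  · subst h
    by_cases hlt : 1 ≤ (a : ℕ)
    · have ha := a.2
      rw [Finset.sum_eq_single ⟨a - 1, by omega⟩]
      · have e : (a : ℕ) = a - 1 + 1 := by omega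
        have e2 : (((a : ℕ) - 1 : ℕ) : ℝ) = (a : ℕ) - 1 := by push_cast [hlt]; ring
        simp only [← e, if_true]
        rw [Real.mul_self_sqrt]
        · rw [e2]; ring
        · rw [e2]
          have : ((a : ℕ) : ℝ) ≤ 2 * J := by exact_mod_cast Nat.lt_succ_iff.mp a.2
          have h2 : (1:ℝ) ≤ ((a:ℕ):ℝ) := by exact_mod_cast hlt
          nlinarith
      · intro b _ hb
        have : ¬ ((a : ℕ) = b + 1) := fun h => hb (Fin.ext (by simp; omega))
        simp [this]
      · simp
    · rw [Finset.sum_eq_zero]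
      · have : (a : ℕ) = 0 := by omega
        rw [this]; push_cast; ring
      · intro b _
        have : ¬ ((a : ℕ) = b + 1) := by omega
        simp [this]
  · refine Finset.sum_eq_zero fun b _ => ?_
    by_cases h1 : (a : ℕ) = b + 1
    · have : ¬ ((a' : ℕ) = b + 1) := fun h2 => h (Fin.ext (by omega))
      simp [this]
    · simp [h1]

noncomputable def xm : Matrix (Fin (2 * J + 1)) (Fin (2 * J + 1)) ℝ := (1 / 2 : ℝ) • (rai J + (rai J)ᵀ)
noncomputable def pm : Matrix (Fin (2 * J + 1)) (Fin (2 * J + 1)) ℝ := (1 / 2 : ℝ) • (rai J - (rai J)ᵀ)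

theorem rai_z' : (rai J)ᵀ * zm J - zm J * (rai J)ᵀ = -(rai J)ᵀ := by
  have h := congrArg Matrix.transpose (rai_z J)
  rw [Matrix.transpose_sub, Matrix.transpose_mul, Matrix.transpose_mul] at h
  have hz : (zm J)ᵀ = zm J := Matrix.diagonal_transpose _
  rw [hz] at h
  rw [← neg_sub, h]

theorem par_rai' : par J * (rai J)ᵀ = -((rai J)ᵀ * par J) := by
  have h := congrArg Matrix.transpose (par_rai J)
  rw [Matrix.transpose_neg, Matrix.transpose_mul, Matrix.transpose_mul] at h
  have hz : (par J)ᵀ = par J := Matrix.diagonal_transpose _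
  rw [hz] at h
  rw [h]; abel

theorem xm_z : xm J * zm J - zm J * xm J = pm J := by
  have h1 := rai_z J
  have h2 := rai_z' J
  unfold xm pm
  simp only [smul_mul_assoc, mul_smul_comm, ← smul_sub]
  congr 1
  have : (rai J + (rai J)ᵀ) * zm J - zm J * (rai J + (rai J)ᵀ) =
    (rai J * zm J - zm J * rai J) + ((rai J)ᵀ * zm J - zm J * (rai J)ᵀ) := by noncomm_ring
  rw [this, h1, h2]; abel

theorem pm_z : pm J * zm J - zm J * pm J = xm J := by
  have h1 := rai_z J
  have h2 := rai_z' J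
  unfold xm pm
  simp only [smul_mul_assoc, mul_smul_comm, ← smul_sub]
  congr 1
  have : (rai J - (rai J)ᵀ) * zm J - zm J * (rai J - (rai J)ᵀ) =
    (rai J * zm J - zm J * rai J) - ((rai J)ᵀ * zm J - zm J * (rai J)ᵀ) := by noncomm_ring
  rw [this, h1, h2]; abel

theorem xm_pm : xm J * pm J - pm J * xm J = zm J := by
  have h1 := rai_tr J
  have h2 := tr_rai J
  unfold xm pm
  have : (1 / 2 : ℝ) • (rai J + (rai J)ᵀ) * (1 / 2 : ℝ) • (rai J - (rai J)ᵀ) -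
    (1 / 2 : ℝ) • (rai J - (rai J)ᵀ) * (1 / 2 : ℝ) • (rai J + (rai J)ᵀ) =
    (1 / 2 : ℝ) • ((rai J)ᵀ * rai J - rai J * (rai J)ᵀ) := by
    simp only [smul_mul_assoc, mul_smul_comm, mul_add, add_mul, mul_sub, sub_mul]
    module
  rw [this, h1, h2, Matrix.diagonal_sub, ← Matrix.diagonal_smul, zm]
  congr 1; ext a
  simp only [Pi.smul_apply, smul_eq_mul]; ring

theorem casm : xm J * xm J + zm J * zm J - pm J * pm J =
    ((J : ℝ) * (J + 1)) • (1 : Matrix (Fin (2 * J + 1)) (Fin (2 * J + 1)) ℝ) := by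
  have h1 := rai_tr J
  have h2 := tr_rai J
  unfold xm pm
  have : (1 / 2 : ℝ) • (rai J + (rai J)ᵀ) * (1 / 2 : ℝ) • (rai J + (rai J)ᵀ) + zm J * zm J -
    (1 / 2 : ℝ) • (rai J - (rai J)ᵀ) * (1 / 2 : ℝ) • (rai J - (rai J)ᵀ) =
    (1 / 2 : ℝ) • ((rai J)ᵀ * rai J + rai J * (rai J)ᵀ) + zm J * zm J := by
    simp only [smul_mul_assoc, mul_smul_comm, mul_add, add_mul, mul_sub, sub_mul]
    module
  rw [this, h1, h2, Matrix.diagonal_add, ← Matrix.diagonal_smul, zm, Matrix.diagonal_mul_diagonal,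
    Matrix.diagonal_add, ← Matrix.diagonal_one, ← Matrix.diagonal_smul]
  congr 1; ext a
  simp only [Pi.smul_apply, smul_eq_mul, mul_one]; ring

theorem par_xm : par J * xm J = -(xm J * par J) := by
  rw [xm, mul_smul_comm, smul_mul_assoc, mul_add, add_mul, par_rai, par_rai', ← neg_add, smul_neg]

theorem par_pm : par J * pm J = -(pm J * par J) := by
  rw [pm, mul_smul_comm, smul_mul_assoc, mul_sub, sub_mul, par_rai, par_rai', ← neg_sub_neg, ← smul_neg]
  congr 1; abel

variable (I : Type) [Fintype I] [DecidableEq I]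

variable {I} in
theorem parity_site (i : I) (M : Matrix (Fin (2 * J + 1)) (Fin (2 * J + 1)) ℝ)
    (h : par J * M = -(M * par J)) :
    (Matrix.diagonal fun α : I → Fin (2 * J + 1) => ∏ i, (-1 : ℝ) ^ (α i : ℕ)) * site i M =
      -(site i M * (Matrix.diagonal fun α : I → Fin (2 * J + 1) => ∏ i, (-1 : ℝ) ^ (α i : ℕ))) := by
  ext α β
  rw [Matrix.neg_apply, Matrix.diagonal_mul, Matrix.mul_diagonal]
  simp only [site]
  split_ifs with hβ
  · have h1 : ∏ l, (-1 : ℝ) ^ (α l : ℕ) = (-1 : ℝ) ^ (α i : ℕ) * ∏ l ∈ Finset.univ.erase i, (-1 : ℝ) ^ (α l : ℕ) :=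
      (Finset.mul_prod_erase _ _ (Finset.mem_univ i)).symm
    have h2 : ∏ l, (-1 : ℝ) ^ (β l : ℕ) = (-1 : ℝ) ^ (β i : ℕ) * ∏ l ∈ Finset.univ.erase i, (-1 : ℝ) ^ (α l : ℕ) := by
      rw [← Finset.mul_prod_erase _ _ (Finset.mem_univ i)]
      congr 1
      refine Finset.prod_congr rfl fun l hl => ?_
      have hne := (Finset.mem_erase.mp hl).1
      rw [hβ, Function.update_of_ne hne]
    have h3 := congrFun (congrFun h (α i)) (β i)
    rw [Matrix.neg_apply, par, Matrix.diagonal_mul, Matrix.mul_diagonal] at h3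
    rw [h1, h2, mul_right_comm, h3]; ring
  · simp

/-- The spin operators on many sites. -/
noncomputable def spin : Spin I (Matrix (I → Fin (2 * J + 1)) (I → Fin (2 * J + 1)) ℝ) (J : ℝ) where
  x i := site i (xm J)
  z i := site i (zm J)
  p i := site i (pm J)
  Pi := Matrix.diagonal fun α => ∏ i, (-1 : ℝ) ^ (α i : ℕ)
  sx i := by
    rw [Matrix.star_eq_conjTranspose, Matrix.conjTranspose_eq_transpose_of_trivial, site_transpose]
    congr 1
    simp [xm, add_comm]
  sz i := by
    rw [Matrix.star_eq_conjTranspose, Matrix.conjTranspose_eq_transpose_of_trivial, site_transpose]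
    congr 1
    exact Matrix.diagonal_transpose _
  sp i := by
    rw [Matrix.star_eq_conjTranspose, Matrix.conjTranspose_eq_transpose_of_trivial, site_transpose,
      ← site_neg]
    congr 1
    rw [pm, Matrix.transpose_smul, Matrix.transpose_sub, Matrix.transpose_transpose, ← smul_neg, neg_sub]
  sPi := by
    rw [Matrix.star_eq_conjTranspose, Matrix.conjTranspose_eq_transpose_of_trivial]
    exact Matrix.diagonal_transpose _
  xx i l := by
    by_cases h : i = l
    · rw [h]
    · exact site_comm i l h _ _
  zz i l := by
    by_cases h : i = l
    · rw [h]
    · exact site_comm i l h _ _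
  pp i l := by
    by_cases h : i = l
    · rw [h]
    · exact site_comm i l h _ _
  xz i l h := site_comm i l h _ _
  pz i l h := site_comm i l h _ _
  xp i l h := site_comm i l h _ _
  xz' i := by rw [← site_mul, ← site_mul, ← site_sub, xm_z]
  pz' i := by rw [← site_mul, ← site_mul, ← site_sub, pm_z]
  xp' i := by rw [← site_mul, ← site_mul, ← site_sub, xm_pm]
  cas i := by rw [← site_mul, ← site_mul, ← site_mul, ← site_add, ← site_sub, casm, site_smul, site_one]
  PiPi := by
    rw [Matrix.diagonal_mul_diagonal, ← Matrix.diagonal_one]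
    congr 1; ext α
    rw [← Finset.prod_mul_distrib]
    exact Finset.prod_eq_one fun i _ => by rw [← mul_pow]; simp
  Piz i := by
    rw [zm, site_diagonal, Matrix.diagonal_mul_diagonal, Matrix.diagonal_mul_diagonal]
    congr 1; ext α; ring
  Pix i := parity_site J i _ (par_xm J)
  Pip i := parity_site J i _ (par_pm J)

end OneSite
end AdamsProof

namespace AdamsProof

section Kron
open Matrix Kronecker
variable (A B : Type) [Fintype A] [DecidableEq A] [Fintype B] [DecidableEq B]

/-- Left Kronecker embedding. -/
def kL : Matrix A A ℝ →⋆ₐ[ℝ] Matrix (A × B) (A × B) ℝ where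
  toFun M := M ⊗ₖ (1 : Matrix B B ℝ)
  map_one' := Matrix.one_kronecker_one
  map_mul' M N := by rw [← Matrix.mul_kronecker_mul, mul_one]
  map_zero' := Matrix.zero_kronecker _
  map_add' M N := Matrix.add_kronecker _ _ _
  commutes' r := by
    rw [Algebra.algebraMap_eq_smul_one, Algebra.algebraMap_eq_smul_one, Matrix.smul_kronecker,
      Matrix.one_kronecker_one]
  map_star' M := by
    rw [Matrix.star_eq_conjTranspose, Matrix.star_eq_conjTranspose, Matrix.conjTranspose_kronecker,
      Matrix.conjTranspose_one]

/-- Right Kronecker embedding. -/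
def kR : Matrix B B ℝ →⋆ₐ[ℝ] Matrix (A × B) (A × B) ℝ where
  toFun M := (1 : Matrix A A ℝ) ⊗ₖ M
  map_one' := Matrix.one_kronecker_one
  map_mul' M N := by rw [← Matrix.mul_kronecker_mul, mul_one]
  map_zero' := Matrix.kronecker_zero _
  map_add' M N := Matrix.kronecker_add _ _ _
  commutes' r := by
    rw [Algebra.algebraMap_eq_smul_one, Algebra.algebraMap_eq_smul_one, Matrix.kronecker_smul,
      Matrix.one_kronecker_one]
  map_star' M := by
    rw [Matrix.star_eq_conjTranspose, Matrix.star_eq_conjTranspose, Matrix.conjTranspose_kronecker,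
      Matrix.conjTranspose_one]

variable {A B}

theorem kL_kR (M : Matrix A A ℝ) (N : Matrix B B ℝ) : kL A B M * kR A B N = kR A B N * kL A B M := by
  show (M ⊗ₖ (1 : Matrix B B ℝ)) * ((1 : Matrix A A ℝ) ⊗ₖ N) =
    ((1 : Matrix A A ℝ) ⊗ₖ N) * (M ⊗ₖ (1 : Matrix B B ℝ))
  rw [← Matrix.mul_kronecker_mul, ← Matrix.mul_kronecker_mul, mul_one, one_mul, mul_one, one_mul]

theorem kL_diag (d : A → ℝ) : kL A B (Matrix.diagonal d) = Matrix.diagonal fun x => d x.1 := by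
  show (Matrix.diagonal d) ⊗ₖ (1 : Matrix B B ℝ) = _
  rw [← Matrix.diagonal_one, Matrix.diagonal_kronecker_diagonal]
  simp

variable (A) in
/-- Matrices as operators on Euclidean space. -/
noncomputable def tC : Matrix A A ℝ →⋆ₐ[ℝ] (EuclideanSpace ℝ A →L[ℝ] EuclideanSpace ℝ A) :=
  ((Matrix.toEuclideanCLM (n := A) (𝕜 := ℝ) : Matrix A A ℝ ≃⋆ₐ[ℝ] _) :
    Matrix A A ℝ →⋆ₐ[ℝ] (EuclideanSpace ℝ A →L[ℝ] EuclideanSpace ℝ A))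

theorem tC_apply (M : Matrix A A ℝ) (f : EuclideanSpace ℝ A) (x : A) :
    tC A M f x = (M *ᵥ (fun y => f y)) x := rfl

theorem tC_diag (d : A → ℝ) (f : EuclideanSpace ℝ A) (x : A) :
    tC A (Matrix.diagonal d) f x = d x * f x := by
  rw [tC_apply, Matrix.mulVec_diagonal]

variable (A B) in
noncomputable def aH : Matrix A A ℝ →⋆ₐ[ℝ] (EuclideanSpace ℝ (A × B) →L[ℝ] EuclideanSpace ℝ (A × B)) :=
  (tC (A × B)).comp (kL A B)

variable (A B) in
noncomputable def bH : Matrix B B ℝ →⋆ₐ[ℝ] (EuclideanSpace ℝ (A × B) →L[ℝ] EuclideanSpace ℝ (A × B)) :=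
  (tC (A × B)).comp (kR A B)

theorem aH_bH (M : Matrix A A ℝ) (N : Matrix B B ℝ) : aH A B M * bH A B N = bH A B N * aH A B M := by
  show tC (A × B) (kL A B M) * tC (A × B) (kR A B N) = tC (A × B) (kR A B N) * tC (A × B) (kL A B M)
  rw [← map_mul, kL_kR, map_mul]

theorem aH_diag (d : A → ℝ) (f : EuclideanSpace ℝ (A × B)) (x : A × B) :
    aH A B (Matrix.diagonal d) f x = d x.1 * f x := by
  show tC (A × B) (kL A B (Matrix.diagonal d)) f x = _
  rw [kL_diag, tC_diag]

theorem bH_apply (N : Matrix B B ℝ) (f : EuclideanSpace ℝ (A × B)) (x : A × B) :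
    bH A B N f x = ∑ y, N x.2 y * f (x.1, y) := by
  show ((((1 : Matrix A A ℝ) ⊗ₖ N)) *ᵥ (fun y => f y)) x = _
  unfold Matrix.mulVec dotProduct
  rw [Fintype.sum_prod_type, Finset.sum_eq_single x.1]
  · simp [Matrix.kroneckerMap_apply]
  · intro b _ hb
    simp [Matrix.kroneckerMap_apply, Matrix.one_apply_ne hb.symm]
  · simp

theorem diag_inner (d : A → ℝ) (f : EuclideanSpace ℝ A) :
    ⟪tC A (Matrix.diagonal d) f, f⟫ = ∑ x, d x * f x ^ 2 := by
  rw [PiLp.inner_apply]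
  refine Finset.sum_congr rfl fun x _ => ?_
  rw [tC_diag]; simp; ring

theorem hasPos_diag (d : A → ℝ) (hd : ∀ x, d x ≠ 0) :
    HasPos (tC A (Matrix.diagonal d)) (Nat.card {x // 0 < d x}) := by
  classical
  have hb : ∀ (f : EuclideanSpace ℝ A) x, ⟪EuclideanSpace.basisFun A ℝ x, f⟫ = f x := by
    intro f x
    simp [EuclideanSpace.inner_single_left]
  refine ⟨coordSub (EuclideanSpace.basisFun A ℝ) fun x => ¬ 0 < d x,
    coordSub (EuclideanSpace.basisFun A ℝ) fun x => 0 < d x, ?_, ?_, ?_, ?_⟩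
  · intro f hf hf0
    have hf' : ∀ x, ¬ 0 < d x → f x = 0 := fun x hx => by rw [← hb]; exact hf x hx
    rw [diag_inner]
    have : ∃ x, f x ≠ 0 := by
      by_contra hcon; push Not at hcon; exact hf0 (by ext x; exact hcon x)
    obtain ⟨x, hx⟩ := this
    have hdx : 0 < d x := by by_contra h; exact hx (hf' x h)
    refine Finset.sum_pos' (fun y _ => ?_) ⟨x, Finset.mem_univ _, by positivity⟩
    by_cases hy : 0 < d y
    · positivity
    · rw [hf' y hy]; simp
  · intro f hf hf0
    have hf' : ∀ x, 0 < d x → f x = 0 := fun x hx => by rw [← hb]; exact hf x hx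
    rw [diag_inner]
    have : ∃ x, f x ≠ 0 := by
      by_contra hcon; push Not at hcon; exact hf0 (by ext x; exact hcon x)
    obtain ⟨x, hx⟩ := this
    have hneg : ∀ y, ¬ 0 < d y → d y < 0 := fun y hy => lt_of_le_of_ne (not_lt.mp hy) (hd y)
    have hdx : d x < 0 := hneg x fun h => hx (hf' x h)
    rw [← neg_pos, ← Finset.sum_neg_distrib]
    refine Finset.sum_pos' (fun y _ => ?_) ⟨x, Finset.mem_univ _, ?_⟩
    · by_cases hy : 0 < d y
      · rw [hf' y hy]; simp
      · nlinarith [hneg y hy, sq_nonneg (f y)]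
    · have : 0 < f x ^ 2 := by positivity
      nlinarith
  · rw [finrank_coordSub]; simp
  · rw [finrank_coordSub, finrank_coordSub, finrank_euclideanSpace]
    simp only [not_not, Nat.card_eq_fintype_card]
    rw [Fintype.card_subtype_compl]
    have := Fintype.card_subtype_le (fun x => 0 < d x)
    omega

theorem finrank_range_diag (d : A → ℝ) :
    Module.finrank ℝ (LinearMap.range (tC A (Matrix.diagonal d) : EuclideanSpace ℝ A →ₗ[ℝ] EuclideanSpace ℝ A))
      = Nat.card {x // d x ≠ 0} := by
  classical
  rw [Nat.card_eq_fintype_card, ← Matrix.rank_diagonal, Matrix.rank_eq_finrank_range_toLin _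
    (EuclideanSpace.basisFun A ℝ).toBasis (EuclideanSpace.basisFun A ℝ).toBasis]
  congr 2

end Kron
end AdamsProof

namespace AdamsProof

section Concrete
open Matrix
variable {I F : Type} [Fintype I] [DecidableEq I] [Fintype F] [DecidableEq F] (J : ℕ)
variable (g : Gen I (Matrix F F ℝ))

/-- The concrete system. -/
noncomputable def SB : Sys I (EuclideanSpace ℝ ((I → Fin (2 * J + 1)) × F) →L[ℝ]
    EuclideanSpace ℝ ((I → Fin (2 * J + 1)) × F)) (J : ℝ) :=
  (spin J I).toSys g (aH _ F) (bH _ F) aH_bH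

theorem SB_z (i : I) (f : EuclideanSpace ℝ ((I → Fin (2 * J + 1)) × F)) (x) :
    (SB J g).z i f x = ((J : ℝ) - (x.1 i : ℕ)) * f x := by
  show aH _ F (site i (zm J)) f x = _
  rw [zm, site_diagonal, aH_diag]

theorem SB_Pi (f : EuclideanSpace ℝ ((I → Fin (2 * J + 1)) × F)) (x) :
    (SB J g).Pi f x = (∏ i, (-1 : ℝ) ^ (x.1 i : ℕ)) * f x := by
  show aH _ F (Matrix.diagonal _) f x = _
  rw [aH_diag]

theorem SB_lam (f : EuclideanSpace ℝ ((I → Fin (2 * J + 1)) × F)) (x) :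
    (SB J g).lam f x = (∑ i, ((J : ℝ) - (x.1 i : ℕ)) - ((Fintype.card I : ℝ) - 1) * J) * f x := by
  unfold Sys.lam
  rw [_root_.sub_apply, clm_sum_apply]
  rw [PiLp.sub_apply, _root_.smul_apply, PiLp.smul_apply, one_apply_eq_self, sub_mul (∑ i, _), Finset.sum_mul]
  congr 1
  rw [WithLp.ofLp_sum, Finset.sum_apply]
  exact Finset.sum_congr rfl fun i _ => SB_z J g i f x

theorem exists_ne {X : Type} (f : EuclideanSpace ℝ X) (hf : f ≠ 0) : ∃ x, f x ≠ 0 := by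
  by_contra hcon; push Not at hcon; exact hf (by ext x; exact hcon x)

theorem SB_int : (SB J g).IntSpec := by
  intro i χ f hf h
  obtain ⟨x, hx⟩ := exists_ne f hf
  have h1 := SB_z J g i f x
  rw [h, PiLp.smul_apply, smul_eq_mul] at h1
  have h2 := mul_right_cancel₀ hx h1
  refine ⟨(J : ℤ) - (x.1 i : ℕ), by rw [h2]; push_cast; ring, ?_, ?_⟩
  · have := (x.1 i).2
    omega
  · omega

theorem SB_hz (i : I) (χ : ℝ) (f) (hf : f ≠ 0) (h : (SB J g).z i f = χ • f) : χ ≤ J := by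
  obtain ⟨w, h1, -, h3⟩ := SB_int J g i χ f hf h
  rw [h1]; exact_mod_cast h3

theorem corner_val (f : EuclideanSpace ℝ ((I → Fin (2 * J + 1)) × F))
    (h : ∀ i, (SB J g).z i ((SB J g).z i f) = ((J : ℝ) ^ 2) • f) (x) (hx : f x ≠ 0) (i : I) :
    (x.1 i : ℕ) = 0 ∨ (x.1 i : ℕ) = 2 * J := by
  have h1 := congrArg (fun u : EuclideanSpace ℝ ((I → Fin (2 * J + 1)) × F) => u x) (h i)
  simp only [SB_z, PiLp.smul_apply, smul_eq_mul] at h1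
  rw [← mul_assoc] at h1
  have h2 := mul_right_cancel₀ hx h1
  have h3 : ((x.1 i : ℕ) : ℝ) * (((x.1 i : ℕ) : ℝ) - 2 * J) = 0 := by linarith
  rcases mul_eq_zero.mp h3 with h4 | h4
  · left; exact_mod_cast h4
  · right
    have : ((x.1 i : ℕ) : ℝ) = 2 * J := by linarith
    exact_mod_cast this

theorem SB_corner (f : EuclideanSpace ℝ ((I → Fin (2 * J + 1)) × F))
    (h : ∀ i, (SB J g).z i ((SB J g).z i f) = ((J : ℝ) ^ 2) • f) : (SB J g).Pi f = f := by
  ext x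
  rw [SB_Pi]
  by_cases hx : f x = 0
  · rw [hx, mul_zero]
  · rw [Finset.prod_eq_one, one_mul]
    intro i _
    rcases corner_val J g f h x hx i with h1 | h1 <;> rw [h1]
    · simp
    · rw [pow_mul]; simp

variable (I) in
/-- Projection on the top state. -/
noncomputable def topP : Matrix (I → Fin (2 * J + 1)) (I → Fin (2 * J + 1)) ℝ :=
  Matrix.diagonal fun α => if α = 0 then 1 else 0

theorem SB_rest (f : EuclideanSpace ℝ ((I → Fin (2 * J + 1)) × F))
    (h : ∀ i, (SB J g).z i ((SB J g).z i f) = ((J : ℝ) ^ 2) • f)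
    (hQ : aH _ F (topP I J) f = 0) : ⟪(SB J g).lam f, f⟫ ≤ -(J : ℝ) * ‖f‖ ^ 2 := by
  rw [PiLp.inner_apply, EuclideanSpace.norm_sq_eq, Finset.mul_sum]
  refine Finset.sum_le_sum fun x _ => ?_
  rw [SB_lam]
  by_cases hx : f x = 0
  · simp [hx]
  have hx0 : x.1 ≠ 0 := by
    intro h0
    have := congrArg (fun u : EuclideanSpace ℝ ((I → Fin (2 * J + 1)) × F) => u x) hQ
    simp only [topP, aH_diag, h0, if_true, one_mul] at this
    exact hx (by simpa using this)
  have : ∃ l, x.1 l ≠ 0 := by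
    by_contra hcon; push Not at hcon; exact hx0 (funext hcon)
  obtain ⟨l, hl⟩ := this
  have hl2 : (x.1 l : ℕ) = 2 * J := by
    rcases corner_val J g f h x hx l with h1 | h1
    · exact absurd (Fin.ext h1) hl
    · exact h1
  have h1 : ∑ i, ((J : ℝ) - (x.1 i : ℕ)) ≤ ((Fintype.card I : ℝ) - 1) * J - J := by
    rw [← Finset.add_sum_erase _ _ (Finset.mem_univ l), hl2]
    have h2 : ∑ i ∈ Finset.univ.erase l, ((J : ℝ) - (x.1 i : ℕ)) ≤ ∑ i ∈ Finset.univ.erase l, (J : ℝ) :=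
      Finset.sum_le_sum fun i _ => by
        have : (0:ℝ) ≤ ((x.1 i : ℕ) : ℝ) := Nat.cast_nonneg _
        linarith
    rw [Finset.sum_const, Finset.card_erase_of_mem (Finset.mem_univ l), Finset.card_univ, nsmul_eq_mul,
      Nat.cast_sub (Fintype.card_pos_iff.mpr ⟨l⟩)] at h2
    push_cast at h2 ⊢
    linarith
  have h3 : 0 ≤ f x ^ 2 := sq_nonneg _
  simp only [Real.inner_apply, Real.norm_eq_abs, sq_abs]
  nlinarith

theorem topP_sq : topP I J * topP I J = topP I J := by
  rw [topP, Matrix.diagonal_mul_diagonal]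
  congr 1; ext α; split_ifs <;> simp

theorem topP_z (i : I) : topP I J * site i (zm J) = site i (zm J) * topP I J := by
  rw [topP, zm, site_diagonal, Matrix.diagonal_mul_diagonal, Matrix.diagonal_mul_diagonal]
  congr 1; ext α; ring

theorem z_topP (i : I) : site i (zm J) * topP I J = (J : ℝ) • topP I J := by
  rw [topP, zm, site_diagonal, Matrix.diagonal_mul_diagonal, ← Matrix.diagonal_smul]
  congr 1; ext α
  simp only [Pi.smul_apply, smul_eq_mul]
  split_ifs with h
  · simp [h]
  · simp

theorem topP_tw (η : ℝ) : topP I J * (spin J I).tw η = (spin J I).tw η * topP I J := by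
  unfold Spin.tw
  split_ifs
  · show topP I J * Matrix.diagonal _ = Matrix.diagonal _ * topP I J
    rw [topP, Matrix.diagonal_mul_diagonal, Matrix.diagonal_mul_diagonal]
    congr 1; ext α; ring
  · rw [mul_one, one_mul]

theorem finrank_topP : Module.finrank ℝ (LinearMap.range (aH (I → Fin (2 * J + 1)) F (topP I J) :
    EuclideanSpace ℝ ((I → Fin (2 * J + 1)) × F) →ₗ[ℝ] EuclideanSpace ℝ ((I → Fin (2 * J + 1)) × F)))
    = Fintype.card F := by
  have : aH (I → Fin (2 * J + 1)) F (topP I J) =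
    tC _ (Matrix.diagonal fun x => (if x.1 = 0 then 1 else 0 : ℝ)) := by
    show tC _ (kL _ F (topP I J)) = _
    rw [topP, kL_diag]
  rw [this, finrank_range_diag, ← Nat.card_eq_fintype_card]
  refine Nat.card_congr ⟨fun x => x.1.2, fun y => ⟨(0, y), by simp⟩, ?_, ?_⟩
  · rintro ⟨⟨α, y⟩, h⟩
    have : α = 0 := by by_contra h'; simp [h'] at h
    subst this; rfl
  · intro y; rfl

theorem hasPos_Pi (hJ : 0 < J) : ∃ w : ℕ, HasPos (-(J : ℝ) • (SB J g).Pi) (w * Fintype.card F) := by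
  have e : -(J : ℝ) • (SB J g).Pi = tC _ (Matrix.diagonal fun x : (I → Fin (2 * J + 1)) × F =>
      -(J : ℝ) * ∏ i, (-1 : ℝ) ^ (x.1 i : ℕ)) := by
    show -(J : ℝ) • aH _ F (Matrix.diagonal _) = _
    rw [← map_smul]
    show tC _ (kL _ F _) = _
    rw [← Matrix.diagonal_smul, kL_diag]
    rfl
  rw [e]
  refine ⟨Nat.card {α : I → Fin (2 * J + 1) // 0 < -(J : ℝ) * ∏ i, (-1 : ℝ) ^ (α i : ℕ)}, ?_⟩
  convert hasPos_diag (fun x : (I → Fin (2 * J + 1)) × F => -(J : ℝ) * ∏ i, (-1 : ℝ) ^ (x.1 i : ℕ)) ?_ using 1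
  · rw [← Nat.card_eq_fintype_card, ← Nat.card_prod]
    exact Nat.card_congr ⟨fun x => ⟨(x.1.1, x.2), x.1.2⟩, fun x => (⟨x.1.1, x.2⟩, x.1.2),
      fun x => rfl, fun x => rfl⟩
  · intro x
    have : (J : ℝ) ≠ 0 := by exact_mod_cast hJ.ne'
    refine mul_ne_zero (neg_ne_zero.mpr this) (Finset.prod_ne_zero_iff.mpr fun i _ => ?_)
    exact pow_ne_zero _ (by norm_num)

end Concrete
end AdamsProof

namespace AdamsProof

theorem Sys.L_line {I : Type*} [Fintype I] [DecidableEq I] {R : Type*} [Ring R] [StarRing R] [Algebra ℝ R]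
    {j : ℝ} (S : Sys I R j) (G C : I → R) (t : ℝ) :
    S.L (fun i => (1 - t) • G i + t • C i) = (1 - t) • S.L G + t • S.L C := by
  unfold Sys.L Sys.D
  have : ∑ i, S.x i * ((1 - t) • G i + t • C i) =
      (1 - t) • ∑ i, S.x i * G i + t • ∑ i, S.x i * C i := by
    rw [Finset.smul_sum, Finset.smul_sum, ← Finset.sum_add_distrib]
    refine Finset.sum_congr rfl fun i _ => ?_
    rw [mul_add, mul_smul_comm, mul_smul_comm]
  rw [this]
  module

theorem Sys.L_commutes {I : Type*} [Fintype I] [DecidableEq I] {R : Type*} [Ring R] [StarRing R] [Algebra ℝ R]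
    {j : ℝ} (S : Sys I R j) (G : I → R) (k : R) (e1 : ∀ i, k * (S.x i * G i) = (S.x i * G i) * k)
    (e2 : ∀ i, k * (S.p i * S.Γ i) = (S.p i * S.Γ i) * k) (ez : ∀ i, k * S.z i = S.z i * k)
    (ePi : k * S.Pi = S.Pi * k) : k * S.L G = S.L G * k := by
  unfold Sys.L Sys.D
  have elam : k * S.lam = S.lam * k := by
    unfold Sys.lam
    rw [mul_sub, sub_mul _ _ k, Finset.mul_sum, Finset.sum_mul, mul_smul_comm, smul_mul_assoc, mul_one, one_mul]
    simp only [ez]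
  rw [mul_add, add_mul, mul_add, add_mul, Finset.mul_sum, Finset.sum_mul, Finset.mul_sum, Finset.sum_mul,
    ← mul_assoc _ S.lam, elam, mul_assoc, mul_assoc, ePi]
  simp only [e1, e2]

section Core
open Matrix
variable {I F : Type} [Fintype I] [DecidableEq I] [Fintype F] [DecidableEq F]

theorem exists_J (k : ℕ) (c M : ℝ) (hc : 0 < c) (hM : 0 ≤ M) :
    ∃ J : ℕ, 2 ≤ J ∧ (k : ℝ) * ((J + 1) * (2 * M + 1)) < c * (J : ℝ) ^ 2 := by
  obtain ⟨J₀, hJ₀⟩ := exists_nat_gt ((k : ℝ) * 2 * (2 * M + 1) / c)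
  refine ⟨J₀ + 2, by omega, ?_⟩
  have h1 : (k : ℝ) * 2 * (2 * M + 1) / c < ((J₀ + 2 : ℕ) : ℝ) := by push_cast; linarith
  rw [div_lt_iff₀ hc] at h1
  set J : ℝ := ((J₀ + 2 : ℕ) : ℝ)
  have hJ : (2:ℝ) ≤ J := by simp only [J]; push_cast; linarith [(Nat.cast_nonneg J₀ : (0:ℝ) ≤ J₀)]
  have hk : (0:ℝ) ≤ k := Nat.cast_nonneg _
  have h2 : (k : ℝ) * ((J + 1) * (2 * M + 1)) ≤ (k * 2 * (2 * M + 1)) * J := by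
    have : 0 ≤ (k : ℝ) * (2 * M + 1) := by positivity
    nlinarith
  nlinarith

theorem norm_sq_of_sq {X A : Type} [Fintype X] [DecidableEq X] [Fintype A] [DecidableEq A]
    {T B : Matrix X X ℝ} {r : ℝ} (hT : star T = T) (h : T * T = r • 1 + star B * B)
    (f : EuclideanSpace ℝ (A × X)) : ‖bH A X T f‖ ^ 2 = r * ‖f‖ ^ 2 + ‖bH A X B f‖ ^ 2 := by
  have hs : star (bH A X T) = bH A X T := by rw [← map_star, hT]
  have h1 := inner_sq hs f
  rw [← h1, ← map_mul, h, map_add, map_smul, map_one, map_mul, map_star, _root_.add_apply, inner_add_left,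
    _root_.smul_apply, one_apply_eq_self, inner_smul_left, real_inner_self_eq_norm_sq, mul_apply_eq_comp,
    inner_star, star_star, real_inner_self_eq_norm_sq]
  simp

theorem path_pos {A : Type} [Fintype A] [DecidableEq A] {G C : I → Matrix F F ℝ}
    (sG : ∀ i, star (G i) = G i) (sC : ∀ i, star (C i) = C i)
    (CC : ∀ i l, i ≠ l → C i * C l = -(C l * C i)) (C2 : ∀ i, C i * C i = 1)
    (GC : ∀ i l, G i * C l = -(C l * G i)) {c t : ℝ} (hc0 : 0 < c) (hc1 : c ≤ 1)
    (ht0 : 0 ≤ t) (ht1 : t ≤ 1) (ξ : I → ℝ) (hc : ∃ B, (∑ i, ξ i • G i) * (∑ i, ξ i • G i) =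
      (c * ∑ i, ξ i ^ 2) • (1 : Matrix F F ℝ) + star B * B) (f : EuclideanSpace ℝ (A × F)) :
    c / 2 * (∑ i, ξ i ^ 2) * ‖f‖ ^ 2 ≤ ‖(∑ i, ξ i • bH A F ((1 - t) • G i + t • C i)) f‖ ^ 2 := by
  obtain ⟨B, hB⟩ := hc
  set X := ∑ i, ξ i • G i with hX
  set Y := ∑ i, ξ i • C i with hY
  have hYY : Y * Y = (∑ i, ξ i ^ 2) • 1 := by
    rw [hY, sq_sum_anti]
    · rw [Finset.sum_smul]
      refine Finset.sum_congr rfl fun i _ => ?_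
      rw [smul_mul_smul_comm, C2, sq]
    · intro i l h
      rw [smul_mul_smul_comm, smul_mul_smul_comm, CC i l h, mul_comm (ξ l), smul_neg, neg_add_cancel]
  have hXY : X * Y = -(Y * X) := by
    rw [hX, hY, Finset.sum_mul_sum, Finset.sum_mul_sum, Finset.sum_comm, ← Finset.sum_neg_distrib]
    refine Finset.sum_congr rfl fun i _ => ?_
    rw [← Finset.sum_neg_distrib]
    refine Finset.sum_congr rfl fun l _ => ?_
    rw [smul_mul_smul_comm, smul_mul_smul_comm, GC, mul_comm (ξ l), smul_neg]
  have sXY : star ((1 - t) • X + t • Y) = (1 - t) • X + t • Y := by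
    rw [hX, hY]
    simp only [star_add, star_smul, star_sum, sG, sC, star_trivial]
  have e1 : ∑ i, ξ i • bH A F ((1 - t) • G i + t • C i) = bH A F ((1 - t) • X + t • Y) := by
    rw [hX, hY, Finset.smul_sum, Finset.smul_sum, ← Finset.sum_add_distrib, map_sum]
    refine Finset.sum_congr rfl fun i _ => ?_
    rw [← map_smul]; congr 1; module
  rw [e1]
  have e2 : ((1 - t) • X + t • Y) * ((1 - t) • X + t • Y) =
      (((1 - t) ^ 2 * c + t ^ 2) * ∑ i, ξ i ^ 2) • 1 + star ((1 - t) • B) * ((1 - t) • B) := by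
    have : ((1 - t) • X + t • Y) * ((1 - t) • X + t • Y) =
      ((1 - t) ^ 2) • (X * X) + (t ^ 2) • (Y * Y) + ((1 - t) * t) • (X * Y + Y * X) := by
      simp only [add_mul, mul_add, smul_mul_assoc, mul_smul_comm]
      module
    rw [this, hB, hYY, hXY, star_smul, smul_mul_assoc, mul_smul_comm, neg_add_cancel]
    simp only [star_trivial]
    module
  rw [norm_sq_of_sq sXY e2]
  have h1 : 0 ≤ ‖bH A F ((1 - t) • B) f‖ ^ 2 := by positivity
  have h2 : c / 2 ≤ (1 - t) ^ 2 * c + t ^ 2 := by nlinarith [sq_nonneg (2 * t - 1), sq_nonneg t]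
  have h3 : c / 2 * (∑ i, ξ i ^ 2) * ‖f‖ ^ 2 ≤
      ((1 - t) ^ 2 * c + t ^ 2) * (∑ i, ξ i ^ 2) * ‖f‖ ^ 2 := by
    have : 0 ≤ ∑ i, ξ i ^ 2 := Finset.sum_nonneg fun i _ => sq_nonneg _
    gcongr
  linarith

set_option maxHeartbeats 1000000 in
theorem core (g : Gen I (Matrix F F ℝ)) (G C τ : I → Matrix F F ℝ)
    (sG : ∀ i, star (G i) = G i) (γG : ∀ i l, g.γ l * G i = g.η l • (G i * g.γ l))
    (sC : ∀ i, star (C i) = C i) (γC : ∀ i l, g.γ l * C i = g.η l • (C i * g.γ l))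
    (CC : ∀ i l, i ≠ l → C i * C l = -(C l * C i)) (C2 : ∀ i, C i * C i = 1)
    (GC : ∀ i l, G i * C l = -(C l * G i))
    {c M : ℝ} (hc0 : 0 < c) (hc1 : c ≤ 1) (hM0 : 0 ≤ M)
    (hc : ∀ ξ : I → ℝ, ∃ B, (∑ i, ξ i • G i) * (∑ i, ξ i • G i) =
      (c * ∑ i, ξ i ^ 2) • (1 : Matrix F F ℝ) + star B * B)
    (hM : ∀ i, ∃ B, G i * G i + star B * B = (M ^ 2) • (1 : Matrix F F ℝ))
    (τ2 : ∀ i, τ i * τ i = 1) (τC : ∀ i, τ i * C i = -(C i * τ i))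
    (τC' : ∀ i l, i ≠ l → τ i * C l = C l * τ i) (τγ : ∀ i l, τ i * g.γ l = g.γ l * τ i)
    (K : Set (Matrix F F ℝ)) (Kγ : ∀ k ∈ K, ∀ l, k * g.γ l = g.γ l * k)
    (KG : ∀ k ∈ K, ∀ l, k * G l = G l * k) (D : ℕ)
    (hD : ∀ (A : Type) [Fintype A] [DecidableEq A] (U : Submodule ℝ (EuclideanSpace ℝ (A × F))),
      (∀ k ∈ K, ∀ u ∈ U, bH A F k u ∈ U) → D ∣ Module.finrank ℝ U) :
    2 ^ Fintype.card I * D ∣ Fintype.card F := by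
  obtain ⟨J, hJ2, hJ⟩ := exists_J (Fintype.card I) (c / 2) (M + 1) (by positivity) (by positivity)
  let W := I → Fin (2 * J + 1)
  let S := SB J g
  have cplb : ∀ X : I → Matrix F F ℝ, (∀ i, star (X i) = X i) →
      (∀ i l, g.γ l * X i = g.η l • (X i * g.γ l)) → S.Cpl (fun i => bH W F (X i)) := by
    intro X h1 h2
    refine toSys_cpl _ _ _ _ _ _ ?_ ?_ ?_
    · intro i; rw [← map_star, h1]
    · intro i u; exact aH_bH _ _
    · intro i l; rw [← map_mul, h2, map_smul, map_mul]
  -- index of the model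
  have hcl : S.Cl (fun i => bH W F (C i)) := by
    refine ⟨cplb C sC γC, ?_, ?_⟩
    · intro i l h; rw [← map_mul, CC i l h, map_neg, map_mul]
    · intro i; rw [← map_mul, C2, map_one]
  have hQs : ∀ i, aH W F (topP I J) * (bH W F (C i) * S.Γ i) =
      (bH W F (C i) * S.Γ i) * aH W F (topP I J) := by
    intro i
    show aH W F (topP I J) * (bH W F (C i) * (aH W F ((spin J I).tw (g.η i)) * bH W F (g.γ i))) =
      (bH W F (C i) * (aH W F ((spin J I).tw (g.η i)) * bH W F (g.γ i))) * aH W F (topP I J)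
    rw [← mul_assoc, aH_bH, mul_assoc, mul_assoc, ← mul_assoc (aH W F _), ← map_mul, topP_tw, map_mul,
      mul_assoc, mul_assoc, aH_bH]
  have hτc : ∀ i l, bH W F (τ i) * (bH W F (C l) * S.Γ l) =
      bH W F (τ i * C l) * S.Γ l := by
    intro i l; rw [map_mul, mul_assoc]
  have hτc' : ∀ i l, (bH W F (C l) * S.Γ l) * bH W F (τ i) = bH W F (C l * τ i) * S.Γ l := by
    intro i l
    show (bH W F (C l) * (aH W F ((spin J I).tw (g.η l)) * bH W F (g.γ l))) * bH W F (τ i) =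
      bH W F (C l * τ i) * (aH W F ((spin J I).tw (g.η l)) * bH W F (g.γ l))
    rw [mul_assoc, mul_assoc, ← map_mul, ← τγ, map_mul, ← mul_assoc (aH W F _), aH_bH, map_mul, mul_assoc,
      mul_assoc]
  obtain ⟨w, hw⟩ := hasPos_Pi J g (by omega)
  obtain ⟨a, ha, ha2⟩ := Sys.model_index hcl (SB_int J g) hJ2 (aH W F (topP I J))
    (by rw [← map_mul, topP_sq])
    (by
      intro i
      show aH W F (topP I J) * aH W F (site i (zm J)) = aH W F (site i (zm J)) * aH W F (topP I J)
      rw [← map_mul, topP_z, map_mul])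
    hQs
    (by
      intro i
      show aH W F (site i (zm J)) * aH W F (topP I J) = _
      rw [← map_mul, z_topP, map_smul])
    (SB_corner J g) (SB_rest J g) (fun i => bH W F (τ i))
    (by intro i; rw [← map_mul, τ2, map_one])
    (by intro i; rw [hτc, hτc', τC, map_neg]; exact neg_mul _ _)
    (by intro i l h; rw [hτc, hτc', τC' i l h])
    (by intro i; rw [aH_bH]) hw
  rw [finrank_topP] at ha2
  -- bounds
  have hGn : ∀ i f, ‖bH W F (G i) f‖ ≤ M * ‖f‖ := by
    intro i f
    obtain ⟨B, hB⟩ := hM i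
    have hs : star (bH W F (G i)) = bH W F (G i) := by rw [← map_star, sG]
    have h1 := inner_sq hs f
    have h2 : bH W F (G i) * bH W F (G i) = (M ^ 2) • 1 - star (bH W F B) * bH W F B := by
      rw [← map_mul, eq_sub_of_add_eq hB, map_sub, map_smul, map_one, map_mul, map_star]
    rw [h2, _root_.sub_apply, inner_sub_left, mul_apply_eq_comp, inner_star (star _), star_star,
      real_inner_self_eq_norm_sq, _root_.smul_apply, one_apply_eq_self, inner_smul_left,
      real_inner_self_eq_norm_sq] at h1
    simp only [conj_trivial] at h1
    apply le_of_sq_le_sq _ (by positivity)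
    nlinarith [sq_nonneg ‖bH W F B f‖]
  have hCn : ∀ i f, ‖bH W F (C i) f‖ ≤ 1 * ‖f‖ := by
    intro i f
    have h1 := norm_sq_of_sq (A := W) (T := C i) (B := 0) (r := 1) (sC i) (by simp [C2]) f
    rw [map_zero] at h1
    apply le_of_sq_le_sq _ (by positivity)
    rw [h1]; simp
  have hinj : ∀ t : ℝ, 0 ≤ t → t ≤ 1 → ∀ f, ((1 - t) • S.L (fun i => bH W F (G i)) +
      t • S.L (fun i => bH W F (C i))) f = 0 → f = 0 := by
    intro t ht0 ht1 f hf
    rw [← Sys.L_line] at hf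
    have e : (fun i => (1 - t) • bH W F (G i) + t • bH W F (C i)) =
        fun i => bH W F ((1 - t) • G i + t • C i) := by
      funext i; rw [map_add, map_smul, map_smul]
    rw [e] at hf
    have sX : ∀ i, star ((1 - t) • G i + t • C i) = (1 - t) • G i + t • C i := by
      intro i; rw [star_add, star_smul, star_smul, sG, sC]; simp
    refine Sys.L_inj (c := c / 2) (M := M + 1) (by positivity) (cplb _ sX ?_) (SB_hz J g)
      (by positivity) (by linarith) (by positivity) ?_ ?_ hJ f hf
    · intro i l
      rw [mul_add, mul_smul_comm, mul_smul_comm, γG, γC, add_mul, smul_mul_assoc, smul_mul_assoc]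
      module
    · intro i f
      rw [map_add, map_smul, map_smul, _root_.add_apply, _root_.smul_apply, _root_.smul_apply]
      refine (norm_add_le _ _).trans ?_
      rw [norm_smul, norm_smul, Real.norm_of_nonneg ht0, Real.norm_of_nonneg (by linarith)]
      have h1 := hGn i f
      have h2 := hCn i f
      have h3 := norm_nonneg f
      have h4 : (1 - t) * ‖bH W F (G i) f‖ ≤ (1 - t) * (M * ‖f‖) := by gcongr
      have h5 : t * ‖bH W F (C i) f‖ ≤ t * (1 * ‖f‖) := by gcongr
      have h6 : 0 ≤ M * ‖f‖ := by positivity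
      nlinarith
    · exact fun ξ f => path_pos sG sC CC C2 GC hc0 hc1 ht0 ht1 ξ (hc ξ) f
  -- positive space of the given system
  have hLG := symm_of_star (Sys.star_L (cplb G sG γG))
  have hLC := symm_of_star (Sys.star_L (cplb C sC γC))
  obtain ⟨δ, hδ, U, V, hU, hV, hUV, hUK⟩ := exists_hasPos _ hLG (by
    intro f hf
    exact hinj 0 le_rfl zero_le_one f (by simpa using hf))
  have hpG : HasPos (S.L fun i => bH W F (G i)) (Module.finrank ℝ U) :=
    hasPos_of_gap hU hV hUV (by simpa using hδ)
  have hpC := HasPos.homotopy hLG hLC hinj hpG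
  have heq := hpC.unique ha
  have hd1 : D ∣ Module.finrank ℝ U := by
    refine hD W U fun k hk u hu => hUK _ ?_ u hu
    have hx : ∀ (m : Matrix W W ℝ) (n : Matrix F F ℝ), k * n = n * k →
        bH W F k * (aH W F m * bH W F n) = (aH W F m * bH W F n) * bH W F k := by
      intro m n h
      rw [← mul_assoc, ← aH_bH, mul_assoc, mul_assoc, ← map_mul, ← map_mul, h]
    have e1 : ∀ i, bH W F k * (S.x i * bH W F (G i)) = (S.x i * bH W F (G i)) * bH W F k :=
      fun i => hx _ _ (KG k hk i)
    have e2 : ∀ i, bH W F k * (S.p i * S.Γ i) = (S.p i * S.Γ i) * bH W F k := by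
      intro i
      have : S.p i * S.Γ i = aH W F (site i (pm J) * (spin J I).tw (g.η i)) * bH W F (g.γ i) := by
        rw [map_mul, mul_assoc]; rfl
      rw [this]
      exact hx _ _ (Kγ k hk i)
    have ez : ∀ i, bH W F k * S.z i = S.z i * bH W F k := fun i => (aH_bH _ _).symm
    have ePi : bH W F k * S.Pi = S.Pi * bH W F k := (aH_bH _ _).symm
    exact S.L_commutes _ _ e1 e2 ez ePi
  have hd2 : D ∣ Fintype.card F := by
    have := hD Unit ⊤ (fun k _ u _ => Submodule.mem_top)
    rw [finrank_top, finrank_euclideanSpace] at this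
    simpa using this
  have hd3 : D ∣ a := by
    rw [heq] at hd1
    exact (Nat.dvd_add_right (hd2.mul_left w)).mp hd1
  rw [← ha2, mul_comm]
  exact Nat.mul_dvd_mul_right hd3 _

end Core
end AdamsProof

namespace AdamsProof

section Pauli
open Matrix
variable {m : Type} [Fintype m] [DecidableEq m]

/-- The sign character of `ZMod 2`. -/
def sgn (a : ZMod 2) : ℝ := if a = 0 then 1 else -1

theorem sgn_add (a b : ZMod 2) : sgn (a + b) = sgn a * sgn b := by
  have h : ∀ a : ZMod 2, a = 0 ∨ a = 1 := by decide
  have h1 : (1 : ZMod 2) + 1 = 0 := by decide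
  have h2 : ¬ (1 : ZMod 2) = 0 := by decide
  rcases h a with rfl | rfl <;> rcases h b with rfl | rfl <;> simp [sgn, h1, h2]

theorem sgn_sq (a : ZMod 2) : sgn a * sgn a = 1 := by
  unfold sgn; split_ifs <;> norm_num

@[simp] theorem sgn_zero : sgn 0 = 1 := by simp [sgn]
@[simp] theorem sgn_one : sgn 1 = -1 := by
  have h2 : ¬ (1 : ZMod 2) = 0 := by decide
  simp [sgn, h2]

/-- Pauli words. -/
def pw (x z : m → ZMod 2) : Matrix (m → ZMod 2) (m → ZMod 2) ℝ :=
  fun s t => if t = s + x then sgn (z ⬝ᵥ s) else 0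

theorem pw_mulVec (x z : m → ZMod 2) (f : (m → ZMod 2) → ℝ) (s) :
    (pw x z *ᵥ f) s = sgn (z ⬝ᵥ s) * f (s + x) := by
  unfold Matrix.mulVec dotProduct pw
  simp [dotProduct]

theorem pw_mul (x z x' z' : m → ZMod 2) : pw x z * pw x' z' = sgn (z' ⬝ᵥ x) • pw (x + x') (z + z') := by
  refine mat_ext fun f => funext fun s => ?_
  rw [← Matrix.mulVec_mulVec, Matrix.smul_mulVec, Pi.smul_apply, pw_mulVec, pw_mulVec, pw_mulVec,
    dotProduct_add, add_dotProduct, sgn_add, sgn_add, add_assoc, smul_eq_mul]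
  ring

theorem pw_zero : pw (0 : m → ZMod 2) 0 = 1 := by
  refine mat_ext fun f => funext fun s => ?_
  rw [pw_mulVec]; simp

theorem two_zero (x : m → ZMod 2) : x + x = 0 := by
  funext i
  have : ∀ a : ZMod 2, a + a = 0 := by decide
  exact this _

theorem pw_sq (x z : m → ZMod 2) : pw x z * pw x z = sgn (z ⬝ᵥ x) • 1 := by
  rw [pw_mul, two_zero, two_zero, pw_zero]

theorem pw_comm (x z x' z' : m → ZMod 2) :
    pw x z * pw x' z' = sgn (z' ⬝ᵥ x + z ⬝ᵥ x') • (pw x' z' * pw x z) := by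
  rw [pw_mul, pw_mul, smul_smul, sgn_add, mul_assoc, sgn_sq, mul_one, add_comm x, add_comm z]

theorem pw_star (x z : m → ZMod 2) : star (pw x z) = sgn (z ⬝ᵥ x) • pw x z := by
  rw [Matrix.star_eq_conjTranspose, Matrix.conjTranspose_eq_transpose_of_trivial]
  ext s t
  simp only [Matrix.transpose_apply, Matrix.smul_apply, pw, smul_eq_mul]
  have : s = t + x ↔ t = s + x := by
    constructor
    · rintro rfl; rw [add_assoc, two_zero, add_zero]
    · rintro rfl; rw [add_assoc, two_zero, add_zero]
  simp only [this]
  split_ifs with h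
  · rw [h, dotProduct_add, sgn_add]; ring
  · simp

end Pauli

section Div
variable {V : Type} [NormedAddCommGroup V] [InnerProductSpace ℝ V] [FiniteDimensional ℝ V]
variable {𝕂 : Type} [DivisionRing 𝕂] [Algebra ℝ 𝕂] [FiniteDimensional ℝ 𝕂]

theorem div_one (r : 𝕂 →ₐ[ℝ] (V →L[ℝ] V)) (U : Submodule ℝ V) (hU : ∀ k, ∀ u ∈ U, r k u ∈ U) :
    Module.finrank ℝ 𝕂 ∣ Module.finrank ℝ U := by
  let _ : Module 𝕂 U :=
    { smul := fun k u => ⟨r k u, hU k u u.2⟩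
      one_smul := fun u => Subtype.ext (by show r 1 u = u; rw [map_one]; rfl)
      mul_smul := fun k l u => Subtype.ext (by show r (k * l) u = r k (r l u); rw [map_mul]; rfl)
      smul_zero := fun k => Subtype.ext (by show r k 0 = 0; rw [map_zero])
      smul_add := fun k u v => Subtype.ext (by show r k (u + v) = r k u + r k v; rw [map_add])
      add_smul := fun k l u => Subtype.ext (by show r (k + l) u = r k u + r l u; rw [map_add]; rfl)
      zero_smul := fun u => Subtype.ext (by show r 0 u = 0; rw [map_zero]; rfl) }
  have : IsScalarTower ℝ 𝕂 U := ⟨fun c k u => Subtype.ext (by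
    show r (c • k) u = c • r k u
    rw [map_smul]; rfl)⟩
  exact ⟨_, (Module.finrank_mul_finrank ℝ 𝕂 U).symm⟩

variable {N : Type} [Fintype N] [DecidableEq N]

theorem div_two (n₀ : N) (r : 𝕂 →ₐ[ℝ] (V →L[ℝ] V)) (e : Matrix N N ℝ →ₐ[ℝ] (V →L[ℝ] V))
    (hre : ∀ k M, r k * e M = e M * r k) (U : Submodule ℝ V) (hU : ∀ k, ∀ u ∈ U, r k u ∈ U)
    (hU' : ∀ M, ∀ u ∈ U, e M u ∈ U) :
    Module.finrank ℝ 𝕂 * Fintype.card N ∣ Module.finrank ℝ U := by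
  let E : N → N → V →L[ℝ] V := fun a b => e (Matrix.single a b 1)
  have hE : ∀ a b c u, E a b (E b c u) = E a c u := by
    intro a b c u
    rw [← mul_apply_eq_comp]
    simp only [E]
    rw [← map_mul, Matrix.single_mul_single_same, mul_one]
  have hE' : ∀ a b c d u, b ≠ c → E a b (E c d u) = 0 := by
    intro a b c d u h
    rw [← mul_apply_eq_comp]
    simp only [E]
    rw [← map_mul, Matrix.single_mul_single_of_ne _ _ _ _ h, map_zero]; rfl
  have hsum : ∀ u, ∑ a, E a a u = u := by
    intro u
    have h1 : ∑ a, Matrix.single a a (1 : ℝ) = (1 : Matrix N N ℝ) := by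
      ext i j
      rw [Matrix.sum_apply, Matrix.one_apply]
      simp only [Matrix.single_apply]
      by_cases hij : i = j
      · subst hij
        simp
      · rw [if_neg hij]
        refine Finset.sum_eq_zero fun a _ => if_neg ?_
        rintro ⟨rfl, rfl⟩
        exact hij rfl
    have h2 : ∑ a, E a a = 1 := by simp only [E]; rw [← map_sum, h1, map_one]
    rw [← clm_sum_apply, h2]; rfl
  let U₀ : Submodule ℝ V := U ⊓ LinearMap.eqLocus (E n₀ n₀ : V →ₗ[ℝ] V) LinearMap.id
  have memU₀ : ∀ u, u ∈ U₀ ↔ u ∈ U ∧ E n₀ n₀ u = u := fun u => Iff.rfl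
  have h1 : Module.finrank ℝ 𝕂 ∣ Module.finrank ℝ U₀ := by
    refine div_one r U₀ fun k u hu => ?_
    rw [memU₀] at hu ⊢
    refine ⟨hU k u hu.1, ?_⟩
    have := app (hre k (Matrix.single n₀ n₀ 1)) u
    rw [mul_apply_eq_comp, mul_apply_eq_comp] at this
    show e _ (r k u) = _
    rw [← this]
    congr 1
    exact hu.2
  let φ : U ≃ₗ[ℝ] (N → U₀) :=
    { toFun := fun u n => ⟨E n₀ n u, (memU₀ _).mpr ⟨hU' _ _ u.2, hE _ _ _ _⟩⟩
      map_add' := fun u v => by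
        funext n; apply Subtype.ext
        show E n₀ n (u + v) = E n₀ n u + E n₀ n v
        rw [map_add]
      map_smul' := fun c u => by
        funext n; apply Subtype.ext
        show E n₀ n (c • (u : V)) = c • E n₀ n u
        rw [map_smul]
      invFun := fun v => ⟨∑ n, E n n₀ (v n), Submodule.sum_mem _ fun n _ => hU' _ _ (v n).2.1⟩
      left_inv := fun u => by
        apply Subtype.ext
        show ∑ n, E n n₀ (E n₀ n u) = u
        simp only [hE]
        exact hsum u
      right_inv := fun v => by
        funext n; apply Subtype.ext
        show E n₀ n (∑ l, E l n₀ (v l)) = v n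
        rw [map_sum, Finset.sum_eq_single n]
        · rw [hE]; exact ((memU₀ _).mp (v n).2).2
        · intro l _ hl; exact hE' _ _ _ _ _ hl.symm
        · simp }
  rw [φ.finrank_eq, Module.finrank_pi_fintype, Finset.sum_const, Finset.card_univ, smul_eq_mul, mul_comm]
  exact Nat.mul_dvd_mul_left _ h1

end Div

section Cliff
open Matrix

/-- Fermion operators with flips. -/
structure CT (I N : Type) [Fintype N] [DecidableEq N] where
  c : I → Matrix N N ℝ
  τ : I → Matrix N N ℝ
  sc : ∀ i, star (c i) = c i
  c2 : ∀ i, c i * c i = 1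
  cc : ∀ i l, i ≠ l → c i * c l = -(c l * c i)
  τ2 : ∀ i, τ i * τ i = 1
  τc : ∀ i, τ i * c i = -(c i * τ i)
  τc' : ∀ i l, i ≠ l → τ i * c l = c l * τ i

/-- Jordan–Wigner operators. -/
noncomputable def theCT (I : Type) [Fintype I] [DecidableEq I] : CT I (I → ZMod 2) where
  c i := pw (Pi.single i 1) (fun l => if Fintype.equivFin I l < Fintype.equivFin I i then 1 else 0)
  τ i := pw 0 (Pi.single i 1)
  sc i := by rw [pw_star]; simp
  c2 i := by rw [pw_sq]; simp
  cc i l h := by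
    rw [pw_comm]
    have hne : Fintype.equivFin I i ≠ Fintype.equivFin I l := fun h' => h ((Fintype.equivFin I).injective h')
    rcases lt_or_gt_of_ne hne with h1 | h1
    · simp [h1, h1.not_gt]
    · simp [h1, h1.not_gt]
  τ2 i := by rw [pw_sq]; simp
  τc i := by rw [pw_comm]; simp
  τc' i l h := by rw [pw_comm]; simp [h.symm]

/-- Anticommuting symmetric involutions. -/
structure BD (Q S : Type) [Fintype S] [DecidableEq S] where
  b : Q → Matrix S S ℝ
  sb : ∀ i, star (b i) = b i
  b2 : ∀ i, b i * b i = 1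
  bb : ∀ i l, i ≠ l → b i * b l = -(b l * b i)

def bx : Fin 9 → Fin 4 → ZMod 2 :=
  ![![1,0,0,0], ![0,0,0,0], ![1,1,0,0], ![1,1,1,0], ![1,1,1,1], ![1,1,0,1], ![1,0,0,1], ![1,0,1,1], ![1,0,1,0]]
def bz : Fin 9 → Fin 4 → ZMod 2 :=
  ![![0,0,0,0], ![1,0,0,0], ![1,1,0,0], ![1,0,1,0], ![1,0,0,1], ![1,0,1,1], ![1,1,0,1], ![1,1,1,0], ![1,1,1,1]]

theorem b_dot : ∀ i, bz i ⬝ᵥ bx i = 0 := by decide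
theorem b_sym : ∀ i l, i ≠ l → bz l ⬝ᵥ bx i + bz i ⬝ᵥ bx l = 1 := by decide

/-- Nine anticommuting involutions in dimension 16. -/
def nine : BD (Fin 9) (Fin 4 → ZMod 2) where
  b i := pw (bx i) (bz i)
  sb i := by rw [pw_star, b_dot]; simp
  b2 i := by rw [pw_sq, b_dot]; simp
  bb i l h := by rw [pw_comm, b_sym i l h]; simp

theorem exists_BD (e : ℕ) : ∃ (Q S : Type) (_ : Fintype Q) (_ : DecidableEq Q) (_ : Fintype S)
    (_ : DecidableEq S) (_ : BD Q S), Fintype.card Q = 8 * e + 1 ∧ Fintype.card S = 16 ^ e := by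
  induction e with
  | zero =>
    refine ⟨Unit, Unit, inferInstance, inferInstance, inferInstance, inferInstance,
      ⟨fun _ => 1, by simp, by simp, ?_⟩, by simp, by simp⟩
    intro i l h
    exact absurd rfl h
  | succ e ih =>
    obtain ⟨Q, S, i1, i2, i3, i4, D, h1, h2⟩ := ih
    let f := kL (Fin 4 → ZMod 2) S
    let s := kR (Fin 4 → ZMod 2) S
    have fs : ∀ u v, f u * s v = s v * f u := kL_kR
    refine ⟨Fin 8 ⊕ Q, (Fin 4 → ZMod 2) × S, inferInstance, inferInstance, inferInstance, inferInstance,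
      ⟨Sum.elim (fun i => f (nine.b i.succ)) (fun q => f (nine.b 0) * s (D.b q)), ?_, ?_, ?_⟩, ?_, ?_⟩
    · rintro (i | q)
      · show star (f _) = f _
        rw [← map_star, nine.sb]
      · show star (f _ * s _) = f _ * s _
        rw [star_mul, ← map_star, ← map_star, nine.sb, D.sb, fs]
    · rintro (i | q)
      · show f _ * f _ = 1
        rw [← map_mul, nine.b2, map_one]
      · show (f _ * s _) * (f _ * s _) = 1
        rw [swap4 (fs _ _).symm, ← map_mul, ← map_mul, nine.b2, D.b2, map_one, map_one, mul_one]
    · rintro (i | q) (l | t) h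
      · show f _ * f _ = -(f _ * f _)
        rw [← map_mul, nine.bb _ _ (fun h' => h (by rw [Fin.succ_injective _ h'])), map_neg, map_mul]
      · show f _ * (f _ * s _) = -(f _ * s _ * f _)
        rw [mul_assoc, ← fs, ← mul_assoc, ← mul_assoc, ← map_mul, nine.bb _ _ (Fin.succ_ne_zero _), map_neg,
          map_mul, neg_mul]
      · show f _ * s _ * f _ = -(f _ * (f _ * s _))
        rw [mul_assoc, ← fs, ← mul_assoc, ← mul_assoc, ← map_mul, nine.bb _ _ (Fin.succ_ne_zero _).symm, map_neg,
          map_mul, neg_mul]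
      · show (f _ * s _) * (f _ * s _) = -((f _ * s _) * (f _ * s _))
        rw [swap4 (fs _ _).symm, swap4 (fs _ _).symm, ← map_mul s, D.bb q t (fun h' => h (by rw [h'])), map_neg,
          map_mul, mul_neg]
    · rw [Fintype.card_sum, h1, Fintype.card_fin]; ring
    · rw [Fintype.card_prod, h2]; simp [ZMod.card]; ring

end Cliff
end AdamsProof

namespace AdamsProof

section Analytic
open Matrix
variable {I X : Type} [Fintype I] [DecidableEq I] [Fintype X] [DecidableEq X]

open scoped MatrixOrder Matrix.Norms.L2Operator in
theorem psd_of (A : Matrix X X ℝ) (hA : star A = A) (h : ∀ f : EuclideanSpace ℝ X, 0 ≤ ⟪tC X A f, f⟫) :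
    ∃ B, A = star B * B := by
  have : A.PosSemidef := by
    rw [Matrix.posSemidef_iff_dotProduct_mulVec]
    refine ⟨hA, fun x => ?_⟩
    have h1 := h (WithLp.toLp 2 x)
    have h2 := Matrix.inner_toEuclideanCLM A (WithLp.toLp 2 x) (WithLp.toLp 2 x)
    rw [real_inner_comm] at h1
    have h3 := h1.trans_eq h2
    simpa using h3
  exact CStarAlgebra.nonneg_iff_eq_star_mul_self.mp this.nonneg

theorem exists_cM (G : I → Matrix X X ℝ) (sG : ∀ i, star (G i) = G i)
    (hinv : ∀ ξ : I → ℝ, ξ ≠ 0 → IsUnit (∑ i, ξ i • G i)) :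
    ∃ c M : ℝ, 0 < c ∧ c ≤ 1 ∧ 0 ≤ M ∧
    (∀ ξ : I → ℝ, ∃ B, (∑ i, ξ i • G i) * (∑ i, ξ i • G i) =
      (c * ∑ i, ξ i ^ 2) • (1 : Matrix X X ℝ) + star B * B) ∧
    (∀ i, ∃ B, G i * G i + star B * B = (M ^ 2) • (1 : Matrix X X ℝ)) := by
  have sS : ∀ ξ : I → ℝ, star (∑ i, ξ i • G i) = ∑ i, ξ i • G i := by
    intro ξ; simp only [star_sum, star_smul, sG, star_trivial]
  have sT : ∀ A : Matrix X X ℝ, star A = A → star (tC X A) = tC X A := by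
    intro A h; rw [← map_star, h]
  let T : EuclideanSpace ℝ I → EuclideanSpace ℝ X → EuclideanSpace ℝ X :=
    fun ξ f => ∑ i, ξ i • tC X (G i) f
  have hT : ∀ ξ f, T ξ f = tC X (∑ i, ξ i • G i) f := by
    intro ξ f
    simp only [T]
    rw [map_sum, clm_sum_apply]
    refine Finset.sum_congr rfl fun i _ => ?_
    rw [map_smul]; rfl
  have hcont : Continuous fun q : EuclideanSpace ℝ I × EuclideanSpace ℝ X => ‖T q.1 q.2‖ := by
    simp only [T]
    fun_prop
  have hcomp : IsCompact (Metric.sphere (0 : EuclideanSpace ℝ I) 1 ×ˢ Metric.sphere (0 : EuclideanSpace ℝ X) 1) :=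
    (isCompact_sphere _ _).prod (isCompact_sphere _ _)
  obtain ⟨c, hc0, hc⟩ := hcomp.exists_forall_le' hcont.continuousOn (a := 0) (by
    rintro ⟨ξ, f⟩ ⟨h1, h2⟩
    simp only [mem_sphere_zero_iff_norm] at h1 h2
    rw [norm_pos_iff]
    intro h0
    rw [hT] at h0
    have hξ : (fun i => ξ i) ≠ 0 := by
      intro h; have : ξ = 0 := by ext i; exact congrFun h i
      rw [this] at h1; simp at h1
    obtain ⟨u, hu⟩ := hinv _ hξ
    have h3 := congrArg (tC X (u⁻¹ : _)) h0
    rw [map_zero, ← mul_apply_eq_comp, ← map_mul, ← hu, Units.inv_mul, map_one, one_apply_eq_self] at h3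
    have h3' : f = 0 := h3
    rw [h3'] at h2; simp at h2)
  have hc' : ∀ (ξ : EuclideanSpace ℝ I) (f : EuclideanSpace ℝ X), c * (‖ξ‖ * ‖f‖) ≤ ‖T ξ f‖ := by
    intro ξ f
    by_cases hξ : ξ = 0
    · rw [hξ, norm_zero]; simp
    by_cases hf : f = 0
    · rw [hf, norm_zero]; simp
    have hξ' : 0 < ‖ξ‖ := norm_pos_iff.mpr hξ
    have hf' : 0 < ‖f‖ := norm_pos_iff.mpr hf
    have h1 := hc (‖ξ‖⁻¹ • ξ, ‖f‖⁻¹ • f) (by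
      constructor <;> simp [norm_smul, hξ'.ne', hf'.ne'])
    have h2 : T (‖ξ‖⁻¹ • ξ) (‖f‖⁻¹ • f) = (‖ξ‖⁻¹ * ‖f‖⁻¹) • T ξ f := by
      simp only [T, Finset.smul_sum, PiLp.smul_apply, map_smul, smul_smul, smul_eq_mul]
      refine Finset.sum_congr rfl fun i _ => ?_
      congr 1; ring
    simp only [h2, norm_smul, norm_mul, norm_inv, norm_norm] at h1
    calc c * (‖ξ‖ * ‖f‖) ≤ (‖ξ‖⁻¹ * ‖f‖⁻¹ * ‖T ξ f‖) * (‖ξ‖ * ‖f‖) := by gcongr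
      _ = ‖T ξ f‖ := by field_simp
  refine ⟨min (c ^ 2) 1, ∑ i, ‖tC X (G i)‖, by positivity, min_le_right _ _,
    Finset.sum_nonneg fun i _ => norm_nonneg _, ?_, ?_⟩
  · intro ξ
    obtain ⟨B, hB⟩ := psd_of ((∑ i, ξ i • G i) * (∑ i, ξ i • G i) -
      (min (c ^ 2) 1 * ∑ i, ξ i ^ 2) • (1 : Matrix X X ℝ)) (by
        rw [star_sub, star_mul, sS, star_smul, star_one, star_trivial]) (by
        intro f
        rw [map_sub, map_mul, map_smul, map_one, _root_.sub_apply, inner_sub_left, inner_sq (sT _ (sS ξ)),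
          _root_.smul_apply, one_apply_eq_self, inner_smul_left, real_inner_self_eq_norm_sq, conj_trivial]
        have h1 := hc' (WithLp.toLp 2 ξ) f
        rw [hT] at h1
        have h2 : ‖(WithLp.toLp 2 ξ : EuclideanSpace ℝ I)‖ ^ 2 = ∑ i, ξ i ^ 2 := by
          rw [EuclideanSpace.norm_sq_eq]; simp
        rw [← h2]
        have h3 : (c * (‖(WithLp.toLp 2 ξ : EuclideanSpace ℝ I)‖ * ‖f‖)) ^ 2 ≤
            ‖tC X (∑ i, ξ i • G i) f‖ ^ 2 := by
          refine pow_le_pow_left₀ (by positivity) h1 2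
        have h4 : min (c ^ 2) 1 ≤ c ^ 2 := min_le_left _ _
        have h5 : min (c ^ 2) 1 * ‖(WithLp.toLp 2 ξ : EuclideanSpace ℝ I)‖ ^ 2 * ‖f‖ ^ 2 ≤
            c ^ 2 * ‖(WithLp.toLp 2 ξ : EuclideanSpace ℝ I)‖ ^ 2 * ‖f‖ ^ 2 := by gcongr
        nlinarith)
    exact ⟨B, by rw [← hB]; abel⟩
  · intro i
    obtain ⟨B, hB⟩ := psd_of (((∑ i, ‖tC X (G i)‖) ^ 2) • (1 : Matrix X X ℝ) - G i * G i) (by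
        rw [star_sub, star_mul, sG, star_smul, star_one, star_trivial]) (by
        intro f
        rw [map_sub, map_mul, map_smul, map_one, _root_.sub_apply, inner_sub_left, inner_sq (sT _ (sG i)),
          _root_.smul_apply, one_apply_eq_self, inner_smul_left, real_inner_self_eq_norm_sq, conj_trivial]
        have h1 := (tC X (G i)).le_opNorm f
        have h2 : ‖tC X (G i)‖ ≤ ∑ i, ‖tC X (G i)‖ :=
          Finset.single_le_sum (f := fun i => ‖tC X (G i)‖) (fun i _ => norm_nonneg _) (Finset.mem_univ i)
        have h3 : ‖tC X (G i) f‖ ^ 2 ≤ ((∑ i, ‖tC X (G i)‖) * ‖f‖) ^ 2 := by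
          refine pow_le_pow_left₀ (by positivity) (h1.trans ?_) 2
          gcongr
        nlinarith)
    exact ⟨B, by rw [← hB]; abel⟩

end Analytic
end AdamsProof

namespace AdamsProof

section Assemble
open Matrix

/-- Anticommuting skew matrices together with a commuting division algebra. -/
structure AD (P S 𝕂 : Type) [Fintype S] [DecidableEq S] [DivisionRing 𝕂] [Algebra ℝ 𝕂] where
  a : P → Matrix S S ℝ
  u : Matrix S S ℝ
  ρ : 𝕂 →ₐ[ℝ] Matrix S S ℝ
  sa : ∀ i, star (a i) = -a i
  a2 : ∀ i, a i * a i = -1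
  aa : ∀ i l, i ≠ l → a i * a l = -(a l * a i)
  su : star u = u
  u2 : u * u = 1
  ua : ∀ i, u * a i = -(a i * u)
  ρa : ∀ k i, ρ k * a i = a i * ρ k

variable {P Q Sa Sb 𝕂 n : Type} [Fintype P] [DecidableEq P] [Fintype Q] [DecidableEq Q]
  [Fintype Sa] [DecidableEq Sa] [Fintype Sb] [DecidableEq Sb] [Fintype n] [DecidableEq n]
  [DivisionRing 𝕂] [Algebra ℝ 𝕂] [FiniteDimensional ℝ 𝕂]

/-- Symmetrisation of a matrix. -/
def dbl (g : Matrix n n ℝ) : Matrix (n ⊕ n) (n ⊕ n) ℝ := fromBlocks 0 gᵀ g 0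

variable (n) in
/-- The grading. -/
def eps : Matrix (n ⊕ n) (n ⊕ n) ℝ := fromBlocks 1 0 0 (-1)

theorem star_dbl (g : Matrix n n ℝ) : star (dbl g) = dbl g := by
  rw [Matrix.star_eq_conjTranspose, dbl, fromBlocks_conjTranspose]
  simp

theorem star_eps : star (eps n) = eps n := by
  rw [Matrix.star_eq_conjTranspose, eps, fromBlocks_conjTranspose]
  simp

theorem eps_sq : eps n * eps n = 1 := by
  rw [eps, fromBlocks_multiply]; simp

theorem eps_dbl (g : Matrix n n ℝ) : eps n * dbl g = -(dbl g * eps n) := by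
  rw [eps, dbl, fromBlocks_multiply, fromBlocks_multiply, fromBlocks_neg]; simp

theorem sum_dbl {I : Type} [Fintype I] (g : I → Matrix n n ℝ) (ξ : I → ℝ) :
    ∑ i, ξ i • dbl (g i) = dbl (∑ i, ξ i • g i) := by
  ext x y
  rw [Matrix.sum_apply]
  rcases x with x | x <;> rcases y with y | y <;> simp [dbl, Matrix.sum_apply]

theorem isUnit_dbl {g : Matrix n n ℝ} (h : IsUnit g) : IsUnit (dbl g) := by
  obtain ⟨v, rfl⟩ := h
  have h1 : (v : Matrix n n ℝ) * ((v⁻¹ : (Matrix n n ℝ)ˣ) : Matrix n n ℝ) = 1 := Units.mul_inv v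
  have h2 : ((v⁻¹ : (Matrix n n ℝ)ˣ) : Matrix n n ℝ) * (v : Matrix n n ℝ) = 1 := Units.inv_mul v
  have h3 : (v : Matrix n n ℝ)ᵀ * ((v⁻¹ : (Matrix n n ℝ)ˣ) : Matrix n n ℝ)ᵀ = 1 := by
    rw [← Matrix.transpose_mul, h2, Matrix.transpose_one]
  have h : dbl (v : Matrix n n ℝ) * fromBlocks 0 ((v⁻¹ : (Matrix n n ℝ)ˣ) : Matrix n n ℝ)
      ((v⁻¹ : (Matrix n n ℝ)ˣ) : Matrix n n ℝ)ᵀ 0 = 1 := by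
    rw [dbl, fromBlocks_multiply]
    simp only [h1, h3]
    simp
  exact IsUnit.of_mul_eq_one _ h

theorem assemble (A : AD P Sa 𝕂) (B : BD Q Sb) (gm : P ⊕ Q → Matrix n n ℝ)
    (hg : ∀ ξ : P ⊕ Q → ℝ, ξ ≠ 0 → IsUnit (∑ i, ξ i • gm i)) :
    2 ^ (Fintype.card P + Fintype.card Q) * Module.finrank ℝ 𝕂 ∣
      Fintype.card Sa * (Fintype.card Sb * (2 * Fintype.card n)) := by
  obtain ⟨c, M, hc0, hc1, hM0, hc, hM⟩ := exists_cM (fun i => dbl (gm i)) (fun i => star_dbl _)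
    (fun ξ hξ => by rw [sum_dbl]; exact isUnit_dbl (hg ξ hξ))
  let N := P ⊕ Q → ZMod 2
  let T : CT (P ⊕ Q) N := theCT (P ⊕ Q)
  let F := Sa × (Sb × ((n ⊕ n) × N))
  let α : Matrix Sa Sa ℝ →⋆ₐ[ℝ] Matrix F F ℝ := kL Sa (Sb × ((n ⊕ n) × N))
  let β : Matrix Sb Sb ℝ →⋆ₐ[ℝ] Matrix F F ℝ :=
    (kR Sa (Sb × ((n ⊕ n) × N))).comp (kL Sb ((n ⊕ n) × N))
  let ν : Matrix (n ⊕ n) (n ⊕ n) ℝ →⋆ₐ[ℝ] Matrix F F ℝ :=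
    (kR Sa (Sb × ((n ⊕ n) × N))).comp ((kR Sb ((n ⊕ n) × N)).comp (kL (n ⊕ n) N))
  let σ : Matrix N N ℝ →⋆ₐ[ℝ] Matrix F F ℝ :=
    (kR Sa (Sb × ((n ⊕ n) × N))).comp ((kR Sb ((n ⊕ n) × N)).comp (kR (n ⊕ n) N))
  have βα : ∀ y x, β y * α x = α x * β y := fun y x => (kL_kR _ _).symm
  have να : ∀ y x, ν y * α x = α x * ν y := fun y x => (kL_kR _ _).symm
  have σα : ∀ y x, σ y * α x = α x * σ y := fun y x => (kL_kR _ _).symm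
  have νβ : ∀ y x, ν y * β x = β x * ν y := fun y x => by
    show kR _ _ (kR _ _ _) * kR _ _ (kL _ _ _) = kR _ _ (kL _ _ _) * kR _ _ (kR _ _ _)
    rw [← map_mul, ← map_mul, kL_kR]
  have σβ : ∀ y x, σ y * β x = β x * σ y := fun y x => by
    show kR _ _ (kR _ _ _) * kR _ _ (kL _ _ _) = kR _ _ (kL _ _ _) * kR _ _ (kR _ _ _)
    rw [← map_mul, ← map_mul, kL_kR]
  have σν : ∀ y x, σ y * ν x = ν x * σ y := fun y x => by
    show kR _ _ (kR _ _ (kR _ _ _)) * kR _ _ (kR _ _ (kL _ _ _)) =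
      kR _ _ (kR _ _ (kL _ _ _)) * kR _ _ (kR _ _ (kR _ _ _))
    rw [← map_mul, ← map_mul, ← map_mul, ← map_mul, kL_kR]
  clear_value α β ν σ
  have ass : ∀ {x y z w : Matrix F F ℝ}, x * y = z * w → ∀ t, x * (y * t) = z * (w * t) := by
    intro x y z w h t; rw [← mul_assoc, h, mul_assoc]
  have ass' : ∀ {x y z : Matrix F F ℝ}, x * y = z → ∀ t, x * (y * t) = z * t := by
    intro x y z h t; rw [← mul_assoc, h]
  have βα' := fun y x => ass (βα y x)
  have να' := fun y x => ass (να y x)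
  have σα' := fun y x => ass (σα y x)
  have νβ' := fun y x => ass (νβ y x)
  have σβ' := fun y x => ass (σβ y x)
  have σν' := fun y x => ass (σν y x)
  have αα : ∀ x y, α x * α y = α (x * y) := fun x y => (map_mul α x y).symm
  have ββ : ∀ x y, β x * β y = β (x * y) := fun x y => (map_mul β x y).symm
  have νν : ∀ x y, ν x * ν y = ν (x * y) := fun x y => (map_mul ν x y).symm
  have σσ : ∀ x y, σ x * σ y = σ (x * y) := fun x y => (map_mul σ x y).symm
  have αα' := fun x y => ass' (αα x y)
  have ββ' := fun x y => ass' (ββ x y)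
  have νν' := fun x y => ass' (νν x y)
  have σσ' := fun x y => ass' (σσ x y)
  let g : Gen (P ⊕ Q) (Matrix F F ℝ) :=
    { γ := Sum.elim (fun i => α (A.a i) * ν (eps n)) (fun q => β (B.b q))
      η := Sum.elim (fun _ => -1) (fun _ => 1)
      hη := by rintro (i | q) <;> simp
      sγ := by
        rintro (i | q)
        · rw [Sum.elim_inl, Sum.elim_inl, star_mul, ← map_star, ← map_star, A.sa, star_eps, map_neg]
          have : ν (eps n) * -α (A.a i) = (-1 : ℝ) • (α (A.a i) * ν (eps n)) := by
            rw [mul_neg, να, neg_one_smul]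
          exact this
        · simp only [Sum.elim_inr, ← map_star, B.sb, one_smul]
      γγ := by
        rintro (i | q) (l | t) h
        · simp only [Sum.elim_inl, mul_assoc, να', αα', νν, eps_sq]
          rw [A.aa i l (fun h' => h (by rw [h']))]
          simp
        · simp only [Sum.elim_inl, Sum.elim_inr, mul_assoc, νβ, βα']
          simp
        · simp only [Sum.elim_inl, Sum.elim_inr, mul_assoc, νβ, βα']
          simp
        · simp only [Sum.elim_inr, ββ]
          rw [B.bb q t (fun h' => h (by rw [h']))]
          simp
      γsq := by
        rintro (i | q)
        · simp only [Sum.elim_inl, mul_assoc, να', αα', νν, eps_sq, A.a2]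
          simp
        · simp only [Sum.elim_inr, ββ, B.b2]
          simp }
  have gl : ∀ i, g.γ (Sum.inl i) = α (A.a i) * ν (eps n) := fun _ => rfl
  have gr : ∀ i, g.γ (Sum.inr i) = β (B.b i) := fun _ => rfl
  have el : ∀ i, g.η (Sum.inl i) = -1 := fun _ => rfl
  have er : ∀ i, g.η (Sum.inr i) = 1 := fun _ => rfl
  clear_value g
  have key := core g (fun i => ν (dbl (gm i))) (fun i => α A.u * (ν (eps n) * σ (T.c i))) (fun i => σ (T.τ i))
    (by intro i; rw [← map_star, star_dbl])
    (by
      rintro i (l | t)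
      · simp only [gl, el, mul_assoc, να', νν, eps_dbl]; simp
      · simp only [gr, er, νβ, one_smul])
    (by
      intro i
      rw [star_mul, star_mul, ← map_star, ← map_star, ← map_star, T.sc, star_eps, A.su]
      have : σ (T.c i) * ν (eps n) * α A.u = α A.u * (ν (eps n) * σ (T.c i)) := by
        rw [σν, mul_assoc, σα, ← mul_assoc, να, mul_assoc]
      exact this)
    (by
      rintro i (l | t)
      · simp only [gl, el, mul_assoc, να', νν', αα', σα', σν, eps_sq, A.ua]; simp
      · simp only [gr, er, mul_assoc, σβ, νβ', βα', one_smul])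
    (by
      intro i l h
      simp only [mul_assoc, να', νν', αα', σα', σν', σσ, eps_sq, A.u2]
      rw [T.cc i l h]; simp)
    (by
      intro i
      simp only [mul_assoc, να', νν', αα', σα', σν', σσ, eps_sq, A.u2, T.c2]
      simp)
    (by
      intro i l
      simp only [mul_assoc, να', νν', σν, eps_dbl]
      simp)
    hc0 hc1 hM0
    (by
      intro ξ
      obtain ⟨X, hX⟩ := hc ξ
      refine ⟨ν X, ?_⟩
      have h1 : ∑ i, ξ i • ν (dbl (gm i)) = ν (∑ i, ξ i • dbl (gm i)) := by
        rw [map_sum]; simp only [map_smul]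
      rw [h1, ← map_mul, hX, map_add, map_smul, map_one, map_mul, map_star])
    (by
      intro i
      obtain ⟨X, hX⟩ := hM i
      refine ⟨ν X, ?_⟩
      rw [← map_star, ← map_mul, ← map_mul, ← map_add, hX, map_smul, map_one])
    (by intro i; rw [← map_mul, T.τ2, map_one])
    (by
      intro i
      simp only [mul_assoc, σα', σν', σσ, T.τc]; simp)
    (by
      intro i l h
      simp only [mul_assoc, σα', σν', σσ, T.τc' i l h])
    (by
      rintro i (l | t)
      · simp only [gl, mul_assoc, σα', σν]
      · simp only [gr, σβ])
    (Set.range (fun k => α (A.ρ k)) ∪ Set.range σ)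
    (by
      rintro _ (⟨k, rfl⟩ | ⟨X, rfl⟩) (l | t)
      · simp only [gl, mul_assoc, να, αα', A.ρa]
      · simp only [gr, βα]
      · simp only [gl, mul_assoc, σα', σν]
      · simp only [gr, σβ])
    (by
      rintro _ (⟨k, rfl⟩ | ⟨X, rfl⟩) l
      · simp only [να]
      · simp only [σν])
    (Module.finrank ℝ 𝕂 * Fintype.card N)
    (by
      intro Y _ _ U hU
      refine div_two (fun _ => 0 : N) (((bH Y F).toAlgHom.comp α.toAlgHom).comp A.ρ)
        ((bH Y F).toAlgHom.comp σ.toAlgHom) ?_ U ?_ ?_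
      · intro k X
        show bH Y F (α (A.ρ k)) * bH Y F (σ X) = bH Y F (σ X) * bH Y F (α (A.ρ k))
        rw [← map_mul, ← map_mul, σα]
      · intro k u hu
        exact hU _ (Or.inl ⟨k, rfl⟩) u hu
      · intro X u hu
        exact hU _ (Or.inr ⟨X, rfl⟩) u hu)
  have hN : 0 < Fintype.card N := Fintype.card_pos
  have hF : Fintype.card F = Fintype.card Sa * (Fintype.card Sb * (2 * Fintype.card n)) * Fintype.card N := by
    simp only [F, Fintype.card_prod, Fintype.card_sum]; ring
  rw [hF, Fintype.card_sum, ← mul_assoc] at key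
  exact Nat.dvd_of_mul_dvd_mul_right hN key

end Assemble
end AdamsProof

namespace AdamsProof

section Instances
open Matrix Quaternion

/-- No skew generators. -/
def ad0 : AD Empty Unit ℝ where
  a := Empty.elim
  u := 1
  ρ := Algebra.ofId ℝ _
  sa := by rintro ⟨⟩
  a2 := by rintro ⟨⟩
  aa := by rintro ⟨⟩
  su := star_one _
  u2 := mul_one _
  ua := by rintro ⟨⟩
  ρa := by rintro _ ⟨⟩

theorem comm_of {m : Type} [Fintype m] [DecidableEq m] {x z x' z' : m → ZMod 2}
    (h : z' ⬝ᵥ x + z ⬝ᵥ x' = 0) : pw x z * pw x' z' = pw x' z' * pw x z := by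
  rw [pw_comm, h, sgn_zero, one_smul]

theorem anti_of {m : Type} [Fintype m] [DecidableEq m] {x z x' z' : m → ZMod 2}
    (h : z' ⬝ᵥ x + z ⬝ᵥ x' = 1) : pw x z * pw x' z' = -(pw x' z' * pw x z) := by
  rw [pw_comm, h, sgn_one, neg_one_smul]

theorem sq_neg {m : Type} [Fintype m] [DecidableEq m] {x z : m → ZMod 2}
    (h : z ⬝ᵥ x = 1) : pw x z * pw x z = -1 := by
  rw [pw_sq, h, sgn_one, neg_one_smul]

theorem sq_pos' {m : Type} [Fintype m] [DecidableEq m] {x z : m → ZMod 2}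
    (h : z ⬝ᵥ x = 0) : pw x z * pw x z = 1 := by
  rw [pw_sq, h, sgn_zero, one_smul]

theorem star_neg_of {m : Type} [Fintype m] [DecidableEq m] {x z : m → ZMod 2}
    (h : z ⬝ᵥ x = 1) : star (pw x z) = -pw x z := by
  rw [pw_star, h, sgn_one, neg_one_smul]

theorem star_pos_of {m : Type} [Fintype m] [DecidableEq m] {x z : m → ZMod 2}
    (h : z ⬝ᵥ x = 0) : star (pw x z) = pw x z := by
  rw [pw_star, h, sgn_zero, one_smul]

/-- One skew generator. -/
noncomputable def ad1 : AD Unit (Fin 1 → ZMod 2) ℂ where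
  a _ := pw 1 1
  u := pw 0 1
  ρ := Complex.lift ⟨pw 1 1, sq_neg (by decide)⟩
  sa _ := star_neg_of (by decide)
  a2 _ := sq_neg (by decide)
  aa i l h := absurd rfl h
  su := star_pos_of (by decide)
  u2 := sq_pos' (by decide)
  ua _ := anti_of (by decide)
  ρa k _ := by
    rw [Complex.lift_apply, Complex.liftAux_apply, add_mul, mul_add, smul_mul_assoc, mul_smul_comm,
      Algebra.commutes]

/-- Quaternion basis from two Pauli words. -/
noncomputable def qb {m : Type} [Fintype m] [DecidableEq m] (x z x' z' : m → ZMod 2)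
    (h1 : z ⬝ᵥ x = 1) (h2 : z' ⬝ᵥ x' = 1) (h3 : z' ⬝ᵥ x + z ⬝ᵥ x' = 1) :
    QuaternionAlgebra.Basis (Matrix (m → ZMod 2) (m → ZMod 2) ℝ) (-1 : ℝ) 0 (-1) where
  i := pw x z
  j := pw x' z'
  k := pw x z * pw x' z'
  i_mul_i := by rw [sq_neg h1]; simp
  j_mul_j := by rw [sq_neg h2]; simp
  i_mul_j := rfl
  j_mul_i := by rw [anti_of h3]; simp

theorem qb_comm {m : Type} [Fintype m] [DecidableEq m] (x z x' z' : m → ZMod 2)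
    (h1 : z ⬝ᵥ x = 1) (h2 : z' ⬝ᵥ x' = 1) (h3 : z' ⬝ᵥ x + z ⬝ᵥ x' = 1)
    (A : Matrix (m → ZMod 2) (m → ZMod 2) ℝ) (hA : pw x z * A = A * pw x z) (hA' : pw x' z' * A = A * pw x' z')
    (k : ℍ[ℝ]) : (qb x z x' z' h1 h2 h3).liftHom k * A = A * (qb x z x' z' h1 h2 h3).liftHom k := by
  show (qb x z x' z' h1 h2 h3).lift k * A = A * (qb x z x' z' h1 h2 h3).lift k
  have h : pw x z * pw x' z' * A = A * (pw x z * pw x' z') := by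
    rw [mul_assoc, hA', ← mul_assoc, hA, mul_assoc]
  simp only [QuaternionAlgebra.Basis.lift, qb, add_mul, mul_add, smul_mul_assoc, mul_smul_comm, hA, hA', h]
  rw [Algebra.commutes]

def x2 : Fin 2 → Fin 2 → ZMod 2 := ![![1, 0], ![1, 1]]
def z2 : Fin 2 → Fin 2 → ZMod 2 := ![![1, 0], ![0, 1]]

/-- Two skew generators. -/
noncomputable def ad2 : AD (Fin 2) (Fin 2 → ZMod 2) ℍ[ℝ] where
  a i := pw (x2 i) (z2 i)
  u := pw ![0, 0] ![1, 0]
  ρ := (qb ![0, 1] ![0, 1] ![1, 1] ![1, 0] (by decide) (by decide) (by decide)).liftHom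
  sa i := star_neg_of (by revert i; decide)
  a2 i := sq_neg (by revert i; decide)
  aa i l h := anti_of (by revert i l; decide)
  su := star_pos_of (by decide)
  u2 := sq_pos' (by decide)
  ua i := anti_of (by revert i; decide)
  ρa k i := qb_comm _ _ _ _ _ _ _ _ (comm_of (by revert i; decide)) (comm_of (by revert i; decide)) k

def x4 : Fin 4 → Fin 3 → ZMod 2 := ![![1, 0, 0], ![1, 1, 0], ![1, 1, 1], ![1, 0, 1]]
def z4 : Fin 4 → Fin 3 → ZMod 2 := ![![1, 0, 0], ![0, 1, 0], ![0, 0, 1], ![0, 1, 1]]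

/-- Four skew generators. -/
noncomputable def ad4 : AD (Fin 4) (Fin 3 → ZMod 2) ℍ[ℝ] where
  a i := pw (x4 i) (z4 i)
  u := pw ![0, 0, 0] ![1, 0, 0]
  ρ := (qb ![0, 0, 1] ![0, 0, 1] ![0, 1, 1] ![0, 1, 0] (by decide) (by decide) (by decide)).liftHom
  sa i := star_neg_of (by revert i; decide)
  a2 i := sq_neg (by revert i; decide)
  aa i l h := anti_of (by revert i l; decide)
  su := star_pos_of (by decide)
  u2 := sq_pos' (by decide)
  ua i := anti_of (by revert i; decide)
  ρa k i := qb_comm _ _ _ _ _ _ _ _ (comm_of (by revert i; decide)) (comm_of (by revert i; decide)) k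

end Instances

section Final
open Matrix

theorem bound_of {P Sa 𝕂 n : Type} [Fintype P] [DecidableEq P]
    [Fintype Sa] [DecidableEq Sa] [Fintype n] [DecidableEq n]
    [DivisionRing 𝕂] [Algebra ℝ 𝕂] [FiniteDimensional ℝ 𝕂] (A : AD P Sa 𝕂) (e : ℕ)
    (C : Submodule ℝ (Matrix n n ℝ)) (hC : ∀ A ∈ C, A ≠ 0 → IsUnit A)
    (hk : Fintype.card P + (8 * e + 1) ≤ Module.finrank ℝ C) :
    2 ^ (Fintype.card P + (8 * e + 1)) * Module.finrank ℝ 𝕂 ∣ Fintype.card Sa * (16 ^ e * (2 * Fintype.card n)) := by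
  obtain ⟨Q, S, i1, i2, i3, i4, B, h1, h2⟩ := exists_BD e
  rw [← h1, ← h2]
  rw [← h1, ← Fintype.card_sum] at hk
  let b := Module.finBasis ℝ C
  let f : P ⊕ Q → Fin (Module.finrank ℝ C) := fun i => Fin.castLE hk (Fintype.equivFin _ i)
  have hf : Function.Injective f := (Fin.castLE_injective hk).comp (Fintype.equivFin _).injective
  have hli : LinearIndependent ℝ (fun i => b (f i)) := b.linearIndependent.comp f hf
  refine assemble A B (fun i => (b (f i) : Matrix n n ℝ)) fun ξ hξ => ?_
  have hs : ∑ i, ξ i • (b (f i) : Matrix n n ℝ) = ((∑ i, ξ i • b (f i) : C) : Matrix n n ℝ) := by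
    rw [Submodule.coe_sum]; rfl
  rw [hs]
  refine hC _ (Submodule.coe_mem _) fun h0 => hξ ?_
  have h3 : ∑ i, ξ i • b (f i) = 0 := Subtype.ext h0
  exact funext fun i => Fintype.linearIndependent_iff.mp hli ξ h3 i

theorem pow_fin {a b x m : ℕ} (h : x * 2 ^ a ∣ x * (2 ^ b * m)) (hx : 0 < x) (c : ℕ) (hc : a = b + c) :
    2 ^ c ∣ m := by
  have h1 := Nat.dvd_of_mul_dvd_mul_left hx h
  rw [hc, pow_add] at h1
  exact Nat.dvd_of_mul_dvd_mul_left (by positivity) h1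

theorem main (n : ℕ) (hn : 0 < n) (C : Submodule ℝ (Matrix (Fin n) (Fin n) ℝ))
    (hC : ∀ A ∈ C, A ≠ 0 → IsUnit A) :
    Module.finrank ℝ C ≤ 2 ^ (padicValNat 2 n % 4) + 8 * (padicValNat 2 n / 4) := by
  by_contra hcon
  push Not at hcon
  have hnd : ¬ 2 ^ (padicValNat 2 n + 1) ∣ n := pow_succ_padicValNat_not_dvd hn.ne'
  generalize padicValNat 2 n = b at *
  obtain ⟨e, c, hc, rfl⟩ : ∃ e c, c < 4 ∧ b = 4 * e + c := ⟨b / 4, b % 4, Nat.mod_lt _ (by norm_num), by omega⟩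
  have h1 : (4 * e + c) % 4 = c := by omega
  have h2 : (4 * e + c) / 4 = e := by omega
  rw [h1, h2] at hcon
  have h16 : ∀ e : ℕ, 16 ^ e = 2 ^ (4 * e) := fun e => by rw [pow_mul]; norm_num
  apply hnd
  interval_cases c
  · have h := bound_of ad1 e C hC (by simp at hcon ⊢; omega)
    rw [Complex.finrank_real_complex, h16] at h
    simp only [Fintype.card_unit, Fintype.card_pi, ZMod.card, Finset.prod_const, Finset.card_univ, Fintype.card_fin] at h
    refine pow_fin (a := 8 * e + 3) (b := 4 * e + 2) (x := 1) ?_ one_pos _ (by ring)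
    convert h using 1 <;> ring
  · have h := bound_of ad2 e C hC (by simp at hcon ⊢; omega)
    rw [Quaternion.finrank_eq_four, h16] at h
    simp only [Fintype.card_unit, Fintype.card_pi, ZMod.card, Finset.prod_const, Finset.card_univ, Fintype.card_fin] at h
    refine pow_fin (a := 8 * e + 5) (b := 4 * e + 3) (x := 1) ?_ one_pos _ (by ring)
    convert h using 1 <;> ring
  · have h := bound_of ad4 e C hC (by simp at hcon ⊢; omega)
    rw [Quaternion.finrank_eq_four, h16] at h
    simp only [Fintype.card_unit, Fintype.card_pi, ZMod.card, Finset.prod_const, Finset.card_univ, Fintype.card_fin] at h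
    refine pow_fin (a := 8 * e + 7) (b := 4 * e + 4) (x := 1) ?_ one_pos _ (by ring)
    convert h using 1 <;> ring
  · have h := bound_of ad0 (e + 1) C hC (by simp at hcon ⊢; omega)
    rw [Module.finrank_self, h16] at h
    simp only [Fintype.card_unit, Fintype.card_empty, Fintype.card_fin] at h
    refine pow_fin (a := 8 * e + 9) (b := 4 * e + 5) (x := 1) ?_ one_pos _ (by ring)
    convert h using 1 <;> ring

end Final
end AdamsProof

/-- Adams: a subspace of `n×n` real matrices all of whose nonzero
elements are invertible has dimension at most `ρ(n)`. -/
theorem adams_bound (n : ℕ) (hn : 0 < n)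
    (C : Submodule ℝ (Matrix (Fin n) (Fin n) ℝ))
    (hC : ∀ A ∈ C, A ≠ 0 → IsUnit A) :
    Module.finrank ℝ C ≤ radonHurwitz n := by
  unfold radonHurwitz
  exact AdamsProof.main n hn C hC
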